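/- arXiv:1909.02247 — 2 statements merged into one kernel-verified Lean document; each statement's English description precedes it below -/
import Mathlib

section
/- Let G be a finite simple graph that is self-complementary (isomorphic to its own complement) and contains no induced subgraph isomorphic to the Chair (the 5-vertex tree obtained from a path on four vertices by adding a pendant vertex adjacent to the second vertex of the path). Then χ(G) ≤ ⌈(Δ(G) + ω(G) + 1)/2⌉. -/
open SimpleGraph

/-- The Chair: the path `0-1-2-3` together with a pendant vertex `4` adjacent to the
second vertex `1` of the path. -/
def chair : SimpleGraph (Fin 5) :=
  SimpleGraph.fromRel (fun a b =>
    (a = 0 ∧ b = 1) ∨ (a = 1 ∧ b = 2) ∨ (a = 2 ∧ b = 3) ∨ (a = 1 ∧ b = 4))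

namespace ChairFree

variable {V : Type*} {G : SimpleGraph V}

/-- A set of vertices which no outside vertex distinguishes. -/
def IsModule (G : SimpleGraph V) (M : Set V) : Prop :=
  ∀ x ∉ M, ∀ a ∈ M, ∀ b ∈ M, G.Adj x a → G.Adj x b

/-- Every module is trivial. -/
def IsPrime (G : SimpleGraph V) : Prop :=
  ∀ M : Set V, IsModule G M → M.Subsingleton ∨ M = Set.univ

/-- `G` has no induced chair with centre `c`, leaves `x`, `y` and long leg `c - z - t`. -/
def NoChair (G : SimpleGraph V) : Prop :=
  ∀ c x y z t, G.Adj c x → G.Adj c y → G.Adj c z → G.Adj z t → x ≠ y → ¬ G.Adj x y →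
    ¬ G.Adj x z → ¬ G.Adj y z → ¬ G.Adj t c → ¬ G.Adj t x → ¬ G.Adj t y → False

/-- `G` has no induced kite: a diamond on `a`, `b`, `c`, `d` with `c`, `d` nonadjacent and a
further vertex `e` whose only neighbour in the diamond is `c`. -/
def NoKite (G : SimpleGraph V) : Prop :=
  ∀ a b c d e, G.Adj a b → G.Adj a c → G.Adj a d → G.Adj b c → G.Adj b d → ¬ G.Adj c d →
    G.Adj e c → ¬ G.Adj e a → ¬ G.Adj e b → ¬ G.Adj e d → False

/-- The vertices `a`, `b`, `c`, `d` induce a diamond with missing edge `cd`. -/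
def Diamond (G : SimpleGraph V) (a b c d : V) : Prop :=
  G.Adj a b ∧ G.Adj a c ∧ G.Adj a d ∧ G.Adj b c ∧ G.Adj b d ∧ c ≠ d ∧ ¬ G.Adj c d

/-- `T` induces a connected subgraph: it is the only nonempty subset of `T` closed under
adjacency inside `T`. -/
def ConnOn (G : SimpleGraph V) (T : Set V) : Prop :=
  ∀ S ⊆ T, S.Nonempty → (∀ x ∈ S, ∀ y ∈ T, G.Adj x y → y ∈ S) → S = T

/-- The non-neighbours of `w`, other than `w` itself. -/
def nonNbr (G : SimpleGraph V) (w : V) : Set V := {x | x ≠ w ∧ ¬ G.Adj w x}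

theorem IsModule.compl {M : Set V} (h : IsModule G M) : IsModule Gᶜ M := by
  intro x hx a ha b hb
  have := h x hx b hb a ha
  simp only [compl_adj]
  grind

theorem IsPrime.compl (h : IsPrime G) : IsPrime Gᶜ := by
  intro M hM
  have := hM.compl
  rw [compl_compl] at this
  exact h M this

theorem NoChair.compl (h : NoChair G) : NoKite Gᶜ := by
  intro a b c d e
  have := h e a b d c
  simp only [compl_adj]
  grind [adj_comm]

theorem NoKite.compl (h : NoKite G) : NoChair Gᶜ := by
  intro c x y z t
  have := h x y t z c
  simp only [compl_adj]
  grind [adj_comm]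

theorem ConnOn.insert {T : Set V} (h : ConnOn G T) {y t : V} (ht : t ∈ T) (hyt : G.Adj y t) :
    ConnOn G (insert y T) := by
  intro S hS hne hcl
  have key : T ⊆ S := by
    by_cases hST : (S ∩ T).Nonempty
    · have := h (S ∩ T) Set.inter_subset_right hST
        (fun x hx z hz hxz => ⟨hcl x hx.1 z (Or.inr hz) hxz, hz⟩)
      exact this ▸ Set.inter_subset_left
    · obtain ⟨x, hx⟩ := hne
      rcases hS hx with rfl | hxT
      · exact absurd ⟨t, hcl x hx t (Or.inr ht) hyt, ht⟩ hST
      · exact absurd ⟨x, hx, hxT⟩ hST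
  refine Set.Subset.antisymm hS (Set.insert_subset ?_ key)
  exact hcl t (key ht) y (Or.inl rfl) hyt.symm

theorem ConnOn.exists_adj {T : Set V} (h : ConnOn G T) {A : Set V} {a b : V} (ha : a ∈ T)
    (haA : a ∈ A) (hb : b ∈ T) (hbA : b ∉ A) :
    ∃ x ∈ T, ∃ y ∈ T, x ∈ A ∧ y ∉ A ∧ G.Adj x y := by
  by_contra hcon
  push Not at hcon
  have := h (T ∩ A) Set.inter_subset_left ⟨a, ha, haA⟩
    (fun x hx y hy hxy => ⟨hy, by_contra fun hyA => hcon x hx.1 y hy hx.2 hyA hxy⟩)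
  exact hbA (this.symm ▸ hb : b ∈ T ∩ A).2

/-- In a prime graph a connected set missed by some vertex extends to the whole set of
non-neighbours of some vertex. -/
theorem IsPrime.exists_nonNbr_connOn [Finite V] (h : IsPrime G) {S : Set V} (hne : S.Nonempty)
    (hS : ConnOn G S) {u : V} (hu : S ⊆ nonNbr G u) :
    ∃ w, ConnOn G (nonNbr G w) ∧ S ⊆ nonNbr G w := by
  obtain ⟨T, hST, hT⟩ := (Set.toFinite {T : Set V | ConnOn G T ∧ ∃ w, T ⊆ nonNbr G w}).exists_le_maximal
    (show S ∈ _ from ⟨hS, u, hu⟩)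
  obtain ⟨⟨hTc, w, hw⟩, hmax⟩ := hT
  have hST : S ⊆ T := hST
  obtain ⟨s, hs⟩ := hne
  have ext : ∀ z ∉ T, ∀ x, T ⊆ nonNbr G x → z ≠ x → ¬ G.Adj x z → ∀ t ∈ T, ¬ G.Adj z t := by
    intro z hz x hx hzx hxz t ht hzt
    exact hz (hmax ⟨hTc.insert ht hzt, x, Set.insert_subset ⟨hzx, hxz⟩ hx⟩
      (Set.subset_insert z T) (Set.mem_insert z T))
  have hX : {x | T ⊆ nonNbr G x}.Subsingleton := by
    refine (h _ ?_).resolve_right ?_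
    · intro z hz a ha b hb hza
      by_contra hzb
      have hzT : z ∉ T := fun hzT => (ha hzT).2 hza.symm
      refine hz fun t ht => ⟨?_, ext z hzT b hb ?_ (fun h => hzb h.symm) t ht⟩
      · rintro rfl; exact hzT ht
      · rintro rfl; exact hz hb
    · intro hu
      have : s ∈ {x | T ⊆ nonNbr G x} := hu ▸ trivial
      exact (this (hST hs)).1 rfl
  have hTw : T = nonNbr G w := by
    refine Set.Subset.antisymm hw fun y hy => by_contra fun hyT => ?_
    refine hy.1 (hX (x := y) ?_ hw)
    intro t ht
    refine ⟨?_, ext y hyT w hw hy.1 hy.2 t ht⟩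
    rintro rfl; exact hyT ht
  exact ⟨w, hTw ▸ hTc, hTw ▸ hST⟩

theorem fork_adj (F : NoChair G) {w p a x y : V} (hwp : G.Adj w p) (hpa : G.Adj p a)
    (hwa : ¬ G.Adj w a) (hwx : ¬ G.Adj w x) (hwy : ¬ G.Adj w y) (hax : G.Adj a x)
    (hay : G.Adj a y) (hpx : ¬ G.Adj p x) (hpy : ¬ G.Adj p y) (hxy : x ≠ y) : G.Adj x y := by
  have := F a x y p w
  grind [adj_comm]

theorem triangle_adj (K : NoKite G) {w p a b c : V} (hwp : G.Adj w p) (hwa : ¬ G.Adj w a)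
    (hwb : ¬ G.Adj w b) (hwc : ¬ G.Adj w c) (hab : G.Adj a b) (hac : G.Adj a c)
    (hbc : G.Adj b c) (hpa : G.Adj p a) (hpb : G.Adj p b) : G.Adj p c := by
  have := K a b p c w
  grind [adj_comm]

theorem IsPrime.not_pair (hP : IsPrime G) {c d w : V} (hcd : c ≠ d) (hwc : w ≠ c) (hwd : w ≠ d)
    (h1 : ∀ x, x ≠ d → G.Adj x c → G.Adj x d) (h2 : ∀ x, x ≠ c → G.Adj x d → G.Adj x c) :
    False := by
  rcases hP {c, d} (by
    intro x hx a ha b hb hxa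
    simp only [Set.mem_insert_iff, Set.mem_singleton_iff] at hx ha hb
    grind) with h | h
  · exact hcd (h (by simp) (by simp))
  · rcases (h ▸ trivial : w ∈ ({c, d} : Set V)) with h | h
    · exact hwc h
    · exact hwd h

theorem missed_diamond_aux (F : NoChair G) (K : NoKite G) {w p c d a b x : V}
    (hD : Diamond G a b c d) (hwp : G.Adj w p) (hpc : G.Adj p c) (hpd : G.Adj p d)
    (hpa : ¬ G.Adj p a) (hpb : ¬ G.Adj p b) (hwa : ¬ G.Adj w a) (hwb : ¬ G.Adj w b)
    (hwc : ¬ G.Adj w c) (hwd : ¬ G.Adj w d) (hx : G.Adj x c) : G.Adj x d := by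
  obtain ⟨h1, h2, h3, h4, h5, h6, h7⟩ := hD
  by_contra hn
  have e1 := F p w d c x
  have e2 := F p w x d a
  have e3 := F p w x d b
  have e4 := K c x p a w
  have e5 := K a b c d x
  have e6 := K c b x a w
  have e7 := K c a x b w
  have e8 := K a b d x p
  have e9 := K p x c w a
  have e10 := K p x c w b
  have e11 := K a b x d w
  simp only [G.adj_comm] at *
  grind [adj_comm]

theorem missed_diamond_false (hP : IsPrime G) (F : NoChair G) (K : NoKite G) {w p c d a b : V}
    (hD : Diamond G a b c d) (hwp : G.Adj w p) (hpc : G.Adj p c) (hpd : G.Adj p d)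
    (hpa : ¬ G.Adj p a) (hpb : ¬ G.Adj p b) (hwa : ¬ G.Adj w a) (hwb : ¬ G.Adj w b)
    (hwc : ¬ G.Adj w c) (hwd : ¬ G.Adj w d) : False := by
  have hD' : Diamond G a b d c := by
    obtain ⟨h1, h2, h3, h4, h5, h6, h7⟩ := hD
    exact ⟨h1, h3, h2, h5, h4, h6.symm, fun h => h7 h.symm⟩
  refine hP.not_pair (c := c) (d := d) (w := w) hD.2.2.2.2.2.1 ?_ ?_ ?_ ?_
  · rintro rfl; exact hwa hD.2.1.symm
  · rintro rfl; exact hwa hD.2.2.1.symm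
  · intro x _ hx
    exact missed_diamond_aux F K hD hwp hpc hpd hpa hpb hwa hwb hwc hwd hx
  · intro x _ hx
    exact missed_diamond_aux F K hD' hwp hpd hpc hpa hpb hwa hwb hwd hwc hx

/-- A neighbour of a vertex missing a diamond sees all or none of that diamond. -/
theorem diamond_all_or_none (hP : IsPrime G) (F : NoChair G) (K : NoKite G) {z t a b c d : V}
    (hD : Diamond G a b c d) (hza : ¬ G.Adj z a) (hzb : ¬ G.Adj z b) (hzc : ¬ G.Adj z c)
    (hzd : ¬ G.Adj z d) (hzt : G.Adj z t)
    (ht : G.Adj t a ∨ G.Adj t b ∨ G.Adj t c ∨ G.Adj t d) :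
    G.Adj t a ∧ G.Adj t b ∧ G.Adj t c ∧ G.Adj t d := by
  have e0 := fun h1 h2 h3 h4 => missed_diamond_false hP F K hD hzt h1 h2 h3 h4 hza hzb hzc hzd
  obtain ⟨h1, h2, h3, h4, h5, h6, h7⟩ := hD
  have e1 := K a b c d t
  have e2 := K a b d c t
  have e3 := F a c d t z
  have e4 := F b c d t z
  have t1 := @triangle_adj _ _ K z t a b c hzt hza hzb hzc
  have t2 := @triangle_adj _ _ K z t a c b hzt hza hzc hzb
  have t3 := @triangle_adj _ _ K z t b c a hzt hzb hzc hza
  have t4 := @triangle_adj _ _ K z t a b d hzt hza hzb hzd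
  have t5 := @triangle_adj _ _ K z t a d b hzt hza hzd hzb
  have t6 := @triangle_adj _ _ K z t b d a hzt hzb hzd hza
  grind [adj_comm]

theorem Diamond.connOn {a b c d : V} (hD : Diamond G a b c d) :
    ConnOn G {a, b, c, d} := by
  obtain ⟨h1, h2, h3, h4, h5, h6, h7⟩ := hD
  intro S hS ⟨x, hx⟩ hcl
  have hxx := hS hx
  have m : ∀ {y}, y ∈ ({a, b, c, d} : Set V) ↔ y = a ∨ y = b ∨ y = c ∨ y = d := by simp
  have ha : a ∈ S := by
    rcases m.1 hxx with rfl | rfl | rfl | rfl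
    · exact hx
    · exact hcl _ hx _ (by simp) h1.symm
    · exact hcl _ hx _ (by simp) h2.symm
    · exact hcl _ hx _ (by simp) h3.symm
  refine Set.Subset.antisymm hS fun y hy => ?_
  rcases m.1 hy with rfl | rfl | rfl | rfl
  · exact ha
  · exact hcl _ ha _ hy h1
  · exact hcl _ ha _ hy h2
  · exact hcl _ ha _ hy h3

theorem IsPrime.exists_mixed (hP : IsPrime G) {w s t : V} (hs : s ∈ nonNbr G w)
    (ht : t ∈ nonNbr G w) (hst : s ≠ t) :
    ∃ p, G.Adj w p ∧ ∃ a ∈ nonNbr G w, ∃ b ∈ nonNbr G w, G.Adj p a ∧ ¬ G.Adj p b := by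
  by_contra hcon
  push Not at hcon
  rcases hP (nonNbr G w) (by
    intro x hx a ha b hb hxa
    refine hcon x ?_ a ha b hb hxa
    by_contra hwx
    refine hx ⟨?_, hwx⟩
    rintro rfl
    exact ha.2 hxa) with h | h
  · exact hst (h hs ht)
  · have : w ∈ nonNbr G w := h ▸ trivial
    exact this.1 rfl

/-- No diamond among the neighbours in `nonNbr G w` of a vertex `p` which is mixed on it. -/
theorem no_diamond_in_nbrs (hP : IsPrime G) (F : NoChair G) (K : NoKite G) {w p : V}
    (hc : ConnOn G (nonNbr G w)) (hwp : G.Adj w p) {b₀ : V} (hb₀ : b₀ ∈ nonNbr G w)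
    (hpb₀ : ¬ G.Adj p b₀) {a₁ a₂ c d : V} (hD : Diamond G a₁ a₂ c d)
    (h1 : a₁ ∈ nonNbr G w) (h2 : a₂ ∈ nonNbr G w) (h3 : c ∈ nonNbr G w) (h4 : d ∈ nonNbr G w)
    (p1 : G.Adj p a₁) (p2 : G.Adj p a₂) (p3 : G.Adj p c) (p4 : G.Adj p d) : False := by
  obtain ⟨k1, k2, k3, k4, k5, k6, k7⟩ := id hD
  let A : Set V := {x | x ∈ nonNbr G w ∧ G.Adj p x}
  have hwA : ∀ x ∈ A, ¬ G.Adj w x := fun x hx => hx.1.2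
  -- attached vertices
  have att : ∀ b ∈ nonNbr G w, ¬ G.Adj p b → ∀ a ∈ A, G.Adj b a → ∀ a' ∈ A, a ≠ a' →
      (G.Adj b a' ↔ ¬ G.Adj a a') := by
    intro b hb hpb a ha hba a' ha' hne
    have e1 := F p w a' a b hwp.symm ha'.2 ha.2 hba.symm ha'.1.1.symm (hwA _ ha')
    have e2 := @triangle_adj _ _ K w p a a' b hwp (hwA _ ha) (hwA _ ha') hb.2
    have := hwA _ ha
    have := hb.2
    have := ha.2
    have := ha'.2
    grind [adj_comm]
  let R : V → V → Prop := fun u v => u ∈ A ∧ v ∈ A ∧ ¬ G.Adj u v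
  let D : Set V := {x | Relation.ReflTransGen R c x}
  have hcD : c ∈ D := Relation.ReflTransGen.refl
  have hdD : d ∈ D := Relation.ReflTransGen.single ⟨⟨h3, p3⟩, ⟨h4, p4⟩, k7⟩
  have hDA : D ⊆ A := by
    intro x hx
    induction hx with
    | refl => exact ⟨h3, p3⟩
    | tail _ h _ => exact h.2.1
  have hDcl : ∀ x ∈ D, ∀ y ∈ A, ¬ G.Adj x y → y ∈ D := fun x hx y hy hxy =>
    Relation.ReflTransGen.tail hx ⟨hDA hx, hy, hxy⟩
  have hDadj : ∀ y ∈ A, y ∉ D → ∀ u ∈ D, G.Adj y u := fun y hy hyD u hu =>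
    by_contra fun h => hyD (hDcl u hu y hy fun h' => h h'.symm)
  have allornone : ∀ y, (∀ u ∈ D, ∀ v ∈ D, u ≠ v → ¬ G.Adj u v → (G.Adj y u ↔ G.Adj y v)) →
      ∀ u ∈ D, (G.Adj y c ↔ G.Adj y u) := by
    intro y hy u hu
    induction hu with
    | refl => rfl
    | @tail b' c' h1 h2 ih =>
      by_cases hbc : b' = c'
      · subst hbc; exact ih
      · exact ih.trans (hy b' h1 c' (Relation.ReflTransGen.tail h1 h2) hbc h2.2.2)
  have hB : ∀ b ∈ nonNbr G w, ¬ G.Adj p b → ∀ u ∈ D, (G.Adj b c ↔ G.Adj b u) := by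
    intro b hb hpb
    refine allornone b fun u hu v hv huv hn => ?_
    have e1 := att b hb hpb u (hDA hu)
    have e2 := att b hb hpb v (hDA hv)
    constructor
    · intro h; exact (e1 h v (hDA hv) huv).2 hn
    · intro h; exact (e2 h u (hDA hu) huv.symm).2 (fun h => hn h.symm)
  have L2 := fun (y : V) (hy : G.Adj w y) {a b c d : V} (hD : Diamond G a b c d)
      (h1 : a ∈ nonNbr G w) (h2 : b ∈ nonNbr G w) (h3 : c ∈ nonNbr G w) (h4 : d ∈ nonNbr G w) =>
    diamond_all_or_none hP F K hD h1.2 h2.2 h3.2 h4.2 hy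
  have nw : ∀ y, y ∉ nonNbr G w → y ≠ w → G.Adj w y := by
    intro y hy hyw
    by_contra h
    exact hy ⟨hyw, h⟩
  have wA : w ∉ A := fun h => h.1.1 rfl
  by_cases hcase : ∃ u ∈ A, ∃ v ∈ A, u ∉ D ∧ v ∉ D ∧ G.Adj u v
  · obtain ⟨u, hu, v, hv, huD, hvD, huv⟩ := hcase
    rcases hP D (by
      intro x hx
      have key : ∀ u ∈ D, (G.Adj x c ↔ G.Adj x u) := by
        by_cases hxT : x ∈ nonNbr G w
        · by_cases hxp : G.Adj p x
          · intro u hu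
            exact iff_of_true (hDadj x ⟨hxT, hxp⟩ hx c hcD) (hDadj x ⟨hxT, hxp⟩ hx u hu)
          · exact hB x hxT hxp
        · by_cases hxw : x = w
          · intro u hu
            subst hxw
            exact iff_of_false (hwA c (hDA hcD)) (hwA u (hDA hu))
          · refine allornone x fun s hs s' hs' hne hn => ?_
            have := L2 x (nw x hxT hxw) (a := u) (b := v) (c := s) (d := s')
              ⟨huv, hDadj u hu huD s hs, hDadj u hu huD s' hs', hDadj v hv hvD s hs,
                hDadj v hv hvD s' hs', hne, hn⟩ hu.1 hv.1 (hDA hs).1 (hDA hs').1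
            clear * - this
            tauto
      intro a ha b hb hab
      exact (key b hb).1 ((key a ha).2 hab)) with h | h
    · exact k6 (h hcD hdD)
    · exact wA (hDA (h ▸ trivial : w ∈ D))
  · push Not at hcase
    -- `D` is not attached
    have unatt : ∀ b ∈ nonNbr G w, ¬ G.Adj p b → ∀ u ∈ D, ¬ G.Adj b u := by
      intro b hb hpb u hu hbu
      have hbc := (hB b hb hpb u hu).2 hbu
      have q : ∀ v ∈ D, ¬ G.Adj c v := fun v hv hcv =>
        (att b hb hpb c (hDA hcD) hbc v (hDA hv) hcv.ne).1 ((hB b hb hpb v hv).1 hbc) hcv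
      exact hcase a₁ ⟨h1, p1⟩ a₂ ⟨h2, p2⟩ (fun h => q _ h k2.symm) (fun h => q _ h k4.symm) k1
    obtain ⟨c₀, hc₀T, b, hbT, hc₀, hb, hc₀b⟩ := hc.exists_adj (A := A) h1 ⟨h1, p1⟩ hb₀
      (fun h => hpb₀ h.2)
    have hpb : ¬ G.Adj p b := fun h => hb ⟨hbT, h⟩
    have hc₀D : c₀ ∉ D := fun h => unatt b hbT hpb c₀ h hc₀b.symm
    obtain ⟨m, hm, hmc, hmd⟩ : ∃ m ∈ D, G.Adj m c ∧ G.Adj m d := by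
      by_cases hh : a₁ ∈ D
      · exact ⟨a₁, hh, k2, k3⟩
      · refine ⟨a₂, ?_, k4, k5⟩
        by_contra hh'
        exact hcase a₁ ⟨h1, p1⟩ a₂ ⟨h2, p2⟩ hh hh' k1
    let Q : Set V := {x | Relation.ReflTransGen (fun u v => u ∈ D ∧ v ∈ D ∧ G.Adj u v) c x}
    have hcQ : c ∈ Q := Relation.ReflTransGen.refl
    have hmQ : m ∈ Q := Relation.ReflTransGen.single ⟨hcD, hm, hmc.symm⟩
    have hQD : Q ⊆ D := by
      intro x hx
      induction hx with
      | refl => exact hcD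
      | tail _ h _ => exact h.2.1
    have hdia : ∀ m ∈ D, ∀ x ∈ D, ∀ x' ∈ D, G.Adj m x → G.Adj m x' → x ≠ x' → ¬ G.Adj x x' →
        Diamond G c₀ m x x' := fun m hm x hx x' hx' h1 h2 h3 h4 =>
      ⟨hDadj c₀ hc₀ hc₀D m hm, hDadj c₀ hc₀ hc₀D x hx, hDadj c₀ hc₀ hc₀D x' hx', h1, h2, h3, h4⟩
    have hP3 : ∀ q ∈ Q, ∃ m ∈ D, ∃ x ∈ D, ∃ x' ∈ D, G.Adj m x ∧ G.Adj m x' ∧ x ≠ x' ∧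
        ¬ G.Adj x x' ∧ (q = m ∨ q = x) := by
      intro q hq
      induction hq with
      | refl => exact ⟨m, hm, c, hcD, d, hdD, hmc, hmd, k6, k7, Or.inr rfl⟩
      | @tail q q' _ h ih =>
        obtain ⟨m, hm, x, hx, x', hx', h1, h2, h3, h4, h5⟩ := ih
        obtain ⟨hqD, hq'D, hqq⟩ := h
        by_cases f0 : q' = m
        · exact ⟨m, hm, x, hx, x', hx', h1, h2, h3, h4, Or.inl f0⟩
        by_cases f0' : q' = x
        · exact ⟨m, hm, x, hx, x', hx', h1, h2, h3, h4, Or.inr f0'⟩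
        by_cases f0'' : q' = x'
        · exact ⟨m, hm, x', hx', x, hx, h2, h1, h3.symm, fun h => h4 h.symm, Or.inr f0''⟩
        by_cases f1 : G.Adj q' x
        · by_cases f2 : G.Adj q' x'
          · exact ⟨q', hq'D, x, hx, x', hx', f1, f2, h3, h4, Or.inl rfl⟩
          · by_cases f3 : G.Adj q' m
            · exact ⟨m, hm, q', hq'D, x', hx', f3.symm, h2, f0'', f2, Or.inr rfl⟩
            · exact ⟨x, hx, q', hq'D, m, hm, f1.symm, h1.symm, f0, f3, Or.inr rfl⟩
        · rcases h5 with rfl | rfl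
          · exact ⟨q, hqD, q', hq'D, x, hx, hqq, h1, f0', f1, Or.inr rfl⟩
          · exact absurd hqq.symm f1
    rcases hP Q (by
      intro y hy u hu v hv hyu
      by_cases hyT : y ∈ nonNbr G w
      · by_cases hyp : G.Adj p y
        · by_cases hyD : y ∈ D
          · exact absurd (Relation.ReflTransGen.tail hu ⟨hQD hu, hyD, hyu.symm⟩) hy
          · exact hDadj y ⟨hyT, hyp⟩ hyD v (hQD hv)
        · exact absurd hyu (unatt y hyT hyp u (hQD hu))
      · by_cases hyw : y = w
        · subst hyw
          exact absurd hyu (hwA u (hDA (hQD hu)))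
        · have hwy := nw y hyT hyw
          by_cases hyc : G.Adj y c₀
          · have : G.Adj y c := by
              have := L2 y hwy (hdia m hm c hcD d hdD hmc hmd k6 k7) hc₀T (hDA hm).1 h3 h4
              clear * - this hyc
              tauto
            clear hyu hu
            induction hv with
            | refl => exact this
            | @tail q q' _ h ih =>
              have e1 := hDadj c₀ hc₀ hc₀D q h.1
              have e2 := hDadj c₀ hc₀ hc₀D q' h.2.1
              exact triangle_adj K hwy (hwA _ hc₀) (hwA _ (hDA h.1)) (hwA _ (hDA h.2.1)) e1 e2
                h.2.2 hyc ih
          · exfalso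
            obtain ⟨m, hm, x, hx, x', hx', h1, h2, h3, h4, h5⟩ := hP3 u hu
            have := L2 y hwy (hdia m hm x hx x' hx' h1 h2 h3 h4) hc₀T (hDA hm).1 (hDA hx).1
              (hDA hx').1
            rcases h5 with rfl | rfl <;> clear * - this hyc hyu <;> tauto) with h | h
    · exact hmc.ne (h hmQ hcQ)
    · exact wA (hDA (hQD (h ▸ trivial : w ∈ Q)))

/-- In a prime graph without induced chairs and kites every diamond is dominating. -/
theorem diamond_dominating [Finite V] (hP : IsPrime G) (F : NoChair G) (K : NoKite G)
    {a b c d : V} (hD : Diamond G a b c d) (z : V) :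
    G.Adj z a ∨ G.Adj z b ∨ G.Adj z c ∨ G.Adj z d := by
  by_contra hz
  push Not at hz
  obtain ⟨za, zb, zc, zd⟩ := hz
  obtain ⟨w, hconn, hsub⟩ := hP.exists_nonNbr_connOn (S := {a, b, c, d}) ⟨a, by simp⟩
    hD.connOn (u := z) (by
      obtain ⟨h1, h2, h3, h4, h5, h6, h7⟩ := hD
      rintro y (rfl | rfl | rfl | rfl) <;> refine ⟨?_, ‹_›⟩ <;> rintro rfl <;> simp_all [adj_comm])
  have haT : a ∈ nonNbr G w := hsub (by simp)
  have hbT : b ∈ nonNbr G w := hsub (by simp)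
  have hcT : c ∈ nonNbr G w := hsub (by simp)
  have hdT : d ∈ nonNbr G w := hsub (by simp)
  obtain ⟨p, hwp, a₀, ha₀, b₀, hb₀, hpa₀, hpb₀⟩ := hP.exists_mixed haT hbT hD.1.ne
  clear za zb zc zd
  let X : Set V := {x | ∃ a ∈ nonNbr G w, ∃ b ∈ nonNbr G w, ∃ c ∈ nonNbr G w,
    ∃ d ∈ nonNbr G w, Diamond G a b c d ∧ (x = a ∨ x = b ∨ x = c ∨ x = d)}
  have hXT : X ⊆ nonNbr G w := by
    rintro x ⟨a, ha, b, hb, c, hc, d, hd, -, h⟩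
    grind
  have none : ∀ a ∈ nonNbr G w, ∀ b ∈ nonNbr G w, ∀ c ∈ nonNbr G w, ∀ d ∈ nonNbr G w,
      Diamond G a b c d → ¬ G.Adj p a ∧ ¬ G.Adj p b ∧ ¬ G.Adj p c ∧ ¬ G.Adj p d := by
    intro a ha b hb c hc d hd hD
    have e1 := diamond_all_or_none hP F K hD ha.2 hb.2 hc.2 hd.2 hwp
    have e2 := no_diamond_in_nbrs hP F K hconn hwp hb₀ hpb₀ hD ha hb hc hd
    grind
  have hX' : X ∪ {x | x ∈ nonNbr G w ∧ ∃ y ∈ X, G.Adj x y} = nonNbr G w := by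
    refine hconn _ ?_ ⟨a, Or.inl ⟨a, haT, b, hbT, c, hcT, d, hdT, hD, Or.inl rfl⟩⟩ ?_
    · exact Set.union_subset hXT fun x hx => hx.1
    · intro x hx y hy hxy
      rcases hx with hx | ⟨hxT, x', hx', hxx'⟩
      · exact Or.inr ⟨hy, x, hx, hxy.symm⟩
      · by_contra hcon
        have hyX : ∀ u ∈ X, ¬ G.Adj y u := fun u hu hyu => hcon (Or.inr ⟨hy, u, hu, hyu⟩)
        obtain ⟨a, ha, b, hb, c, hc, d, hd, hD, h⟩ := hx'
        have ma : a ∈ X := ⟨a, ha, b, hb, c, hc, d, hd, hD, by grind⟩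
        have mb : b ∈ X := ⟨a, ha, b, hb, c, hc, d, hd, hD, by grind⟩
        have mc : c ∈ X := ⟨a, ha, b, hb, c, hc, d, hd, hD, by grind⟩
        have md : d ∈ X := ⟨a, ha, b, hb, c, hc, d, hd, hD, by grind⟩
        have e := diamond_all_or_none hP F K hD (hyX _ ma) (hyX _ mb) (hyX _ mc) (hyX _ md)
          hxy.symm (by grind)
        refine hyX x ⟨x, hxT, a, ha, c, hc, d, hd, ?_, Or.inl rfl⟩ hxy.symm
        exact ⟨e.1, e.2.2.1, e.2.2.2, hD.2.1, hD.2.2.1, hD.2.2.2.2.2⟩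
  rcases hX'.symm.subset ha₀ with
    ⟨a, ha, b, hb, c, hc, d, hd, hD, h⟩ | ⟨-, x, ⟨a, ha, b, hb, c, hc, d, hd, hD, h⟩, hx⟩
  · have := none a ha b hb c hc d hd hD
    grind
  · have h1 := none a ha b hb c hc d hd hD
    have e := diamond_all_or_none hP F K hD h1.1 h1.2.1 h1.2.2.1 h1.2.2.2 hpa₀ (by grind)
    have := none a₀ ha₀ a ha c hc d hd
      ⟨e.1, e.2.2.1, e.2.2.2, hD.2.1, hD.2.2.1, hD.2.2.2.2.2⟩
    grind

/-- A prime graph without induced chairs and kites. -/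
structure Basic (G : SimpleGraph V) : Prop where
  prime : IsPrime G
  noChair : NoChair G
  noKite : NoKite G

theorem Basic.compl (h : Basic G) : Basic Gᶜ :=
  ⟨h.prime.compl, h.noKite.compl, h.noChair.compl⟩

theorem Basic.diamond [Finite V] (h : Basic G) {a b c d z : V} (hab : G.Adj a b)
    (hac : G.Adj a c) (had : G.Adj a d) (hbc : G.Adj b c) (hbd : G.Adj b d) (hcd : c ≠ d)
    (hncd : ¬ G.Adj c d) : G.Adj z a ∨ G.Adj z b ∨ G.Adj z c ∨ G.Adj z d :=
  diamond_dominating h.prime h.noChair h.noKite ⟨hab, hac, had, hbc, hbd, hcd, hncd⟩ z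

/-- No vertex is complete to a co-diamond. -/
theorem Basic.codiamond [Finite V] (h : Basic G) {a b c d z : V} (hab : G.Adj a b)
    (hac : ¬ G.Adj a c) (had : ¬ G.Adj a d) (hbc : ¬ G.Adj b c) (hbd : ¬ G.Adj b d) (hcd : c ≠ d)
    (hncd : ¬ G.Adj c d) (za : G.Adj z a) (zb : G.Adj z b) (zc : G.Adj z c) (zd : G.Adj z d) :
    False := by
  have e : ∀ {x y}, G.Adj x y → ¬ Gᶜ.Adj x y := fun h h' => h'.2 h
  have n : ∀ {x y}, x ≠ y → ¬ G.Adj x y → Gᶜ.Adj x y := fun h h' => ⟨h, h'⟩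
  have hac' : a ≠ c := fun h => hbc (h ▸ hab.symm)
  have had' : a ≠ d := fun h => hbd (h ▸ hab.symm)
  have hbc' : b ≠ c := fun h => hac (h ▸ hab)
  have hbd' : b ≠ d := fun h => had (h ▸ hab)
  rcases h.compl.diamond (z := z) (n hcd hncd) (n hac' hac).symm (n hbc' hbc).symm
    (n had' had).symm (n hbd' hbd).symm hab.ne (e hab) with h | h | h | h
  · exact e zc h
  · exact e zd h
  · exact e za h
  · exact e zb h

/-- The non-neighbours of `w` induce a connected graph containing the triangle `k₁k₂k₃`. -/
structure Special (G : SimpleGraph V) (w k₁ k₂ k₃ : V) : Prop where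
  conn : ConnOn G (nonNbr G w)
  mem₁ : k₁ ∈ nonNbr G w
  mem₂ : k₂ ∈ nonNbr G w
  mem₃ : k₃ ∈ nonNbr G w
  adj₁₂ : G.Adj k₁ k₂
  adj₁₃ : G.Adj k₁ k₃
  adj₂₃ : G.Adj k₂ k₃

theorem Basic.diamond_free [Finite V] (h : Basic G) {w a b c d : V} (ha : a ∈ nonNbr G w)
    (hb : b ∈ nonNbr G w) (hc : c ∈ nonNbr G w) (hd : d ∈ nonNbr G w) (hab : G.Adj a b)
    (hac : G.Adj a c) (had : G.Adj a d) (hbc : G.Adj b c) (hbd : G.Adj b d) (hcd : c ≠ d) :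
    G.Adj c d := by
  by_contra hn
  rcases h.diamond (z := w) hab hac had hbc hbd hcd hn with h | h | h | h
  · exact ha.2 h
  · exact hb.2 h
  · exact hc.2 h
  · exact hd.2 h

theorem Basic.no_triangle_of_nonadj [Finite V] (h : Basic G) {w p : V} (hwp : G.Adj w p)
    {a₁ a₂ : V} (h1 : a₁ ∈ nonNbr G w) (h2 : a₂ ∈ nonNbr G w) (p1 : G.Adj p a₁)
    (p2 : G.Adj p a₂) (hne : a₁ ≠ a₂) (hn : ¬ G.Adj a₁ a₂) {x y z : V} (hx : x ∈ nonNbr G w)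
    (hy : y ∈ nonNbr G w) (hz : z ∈ nonNbr G w) (px : G.Adj p x) (hxy : G.Adj x y)
    (hxz : G.Adj x z) (hyz : G.Adj y z) : False := by
  have cd : ∀ {u v z}, u ∈ nonNbr G w → v ∈ nonNbr G w → z ∈ nonNbr G w → G.Adj p u → G.Adj p v →
      G.Adj p z → G.Adj u v → G.Adj u z ∨ G.Adj v z := by
    intro u v z hu hv hz pu pv pz huv
    by_contra hcon
    push Not at hcon
    exact h.codiamond huv hcon.1 (fun h => hu.2 h.symm) hcon.2 (fun h => hv.2 h.symm) hz.1
      (fun h => hz.2 h.symm) pu pv pz hwp.symm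
  have tri : ∀ {x y z}, x ∈ nonNbr G w → y ∈ nonNbr G w → z ∈ nonNbr G w → G.Adj p x →
      G.Adj p y → G.Adj x y → G.Adj x z → G.Adj y z → False := by
    intro x y z hx hy hz px py hxy hxz hyz
    have pz := triangle_adj h.noKite hwp hx.2 hy.2 hz.2 hxy hxz hyz px py
    have all : ∀ u ∈ nonNbr G w, G.Adj p u → (u = x ∨ G.Adj x u) ∧ (u = y ∨ G.Adj y u) ∧
        (u = z ∨ G.Adj z u) := by
      intro u hu pu
      have c1 := cd hx hy hu px py pu hxy
      have c2 := cd hx hz hu px pz pu hxz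
      have c3 := cd hy hz hu py pz pu hyz
      have d1 := @Basic.diamond_free _ _ _ h w x y z u hx hy hz hu
      have d2 := @Basic.diamond_free _ _ _ h w x z y u hx hz hy hu
      have d3 := @Basic.diamond_free _ _ _ h w y z x u hy hz hx hu
      clear h cd
      grind [adj_comm]
    have b1 := all a₁ h1 p1
    have b2 := all a₂ h2 p2
    have d1 := @Basic.diamond_free _ _ _ h w x y a₁ a₂ hx hy h1 h2
    clear all h cd
    grind [adj_comm]
  have F := h.noChair
  by_cases py : G.Adj p y
  · exact tri hx hy hz px py hxy hxz hyz
  by_cases pz : G.Adj p z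
  · exact tri hx hz hy px pz hxz hxy hyz.symm
  by_cases ha : ∃ a' ∈ nonNbr G w, G.Adj p a' ∧ a' ≠ x ∧ ¬ G.Adj a' x
  · obtain ⟨a', ha', pa', hne', hna'⟩ := ha
    have e1 := F p w a' x y hwp.symm pa' px hxy ha'.1.symm ha'.2 hx.2 hna'
      (fun h => py h.symm) (fun h => hy.2 h.symm)
    have e2 := F p w a' x z hwp.symm pa' px hxz ha'.1.symm ha'.2 hx.2 hna'
      (fun h => pz h.symm) (fun h => hz.2 h.symm)
    have d := @Basic.diamond_free _ _ _ h w y z x a' hy hz hx ha'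
    clear cd tri h
    grind [adj_comm]
  · push Not at ha
    have c1 : a₁ ≠ x := by rintro rfl; exact hn (ha a₂ h2 p2 hne.symm).symm
    have c2 : a₂ ≠ x := by rintro rfl; exact hn (ha a₁ h1 p1 hne)
    have ha1 := ha a₁ h1 p1 c1
    have ha2 := ha a₂ h2 p2 c2
    exact h.codiamond (z := x) hyz
      (fun hh => tri hx h1 hy px p1 ha1.symm hxy hh.symm)
      (fun hh => tri hx h2 hy px p2 ha2.symm hxy hh.symm)
      (fun hh => tri hx h1 hz px p1 ha1.symm hxz hh.symm)
      (fun hh => tri hx h2 hz px p2 ha2.symm hxz hh.symm) hne hn hxy hxz ha1.symm ha2.symm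

/-- If `p` is adjacent to `w`, then the neighbours of `p` among the non-neighbours of `w`
form a clique. -/
theorem Basic.adj_of_common_nbr [Finite V] (h : Basic G) {w k₁ k₂ k₃ p : V}
    (hw : Special G w k₁ k₂ k₃) (hwp : G.Adj w p) {a₁ a₂ : V}
    (h1 : a₁ ∈ nonNbr G w) (h2 : a₂ ∈ nonNbr G w) (p1 : G.Adj p a₁)
    (p2 : G.Adj p a₂) (hne : a₁ ≠ a₂) : G.Adj a₁ a₂ := by
  by_contra hn
  have F := h.noChair
  have noTri : ∀ {x y z}, x ∈ nonNbr G w → y ∈ nonNbr G w → z ∈ nonNbr G w → G.Adj p x →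
      G.Adj x y → G.Adj x z → G.Adj y z → False := fun hx hy hz px =>
    h.no_triangle_of_nonadj hwp h1 h2 p1 p2 hne hn hx hy hz px
  have fork : ∀ {c c' b}, c ∈ nonNbr G w → c' ∈ nonNbr G w → b ∈ nonNbr G w → G.Adj p c →
      G.Adj p c' → ¬ G.Adj p b → c' ≠ c → ¬ G.Adj c' c → G.Adj c b → G.Adj c' b := by
    intro c c' b hc hc' hb pc pc' pb hne' hn' hcb
    by_contra hcon
    exact F p w c' c b hwp.symm pc' pc hcb hc'.1.symm hc'.2 hc.2 hn' (fun h => pb h.symm)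
      (fun h => hb.2 h.symm) (fun h => hcon h.symm)
  -- vertices attached to the neighbourhood of `p` lie in no triangle
  have attTri' : ∀ {x y z c c'}, x ∈ nonNbr G w → y ∈ nonNbr G w → z ∈ nonNbr G w →
      c ∈ nonNbr G w → c' ∈ nonNbr G w → G.Adj p c → G.Adj p c' → c ≠ c' → ¬ G.Adj c c' →
      G.Adj x y → G.Adj x z → G.Adj y z → G.Adj x c → False := by
    intro x y z c c' hx hy hz hc hc' pc pc' hcc hncc hxy hxz hyz hxc
    have px : ¬ G.Adj p x := fun hp => noTri hx hy hz hp hxy hxz hyz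
    have hxc' := fork hc hc' hx pc pc' px hcc.symm (fun h => hncc h.symm) hxc.symm
    exact h.codiamond (z := x) hyz
      (fun hh => noTri hc hx hy pc hxc.symm hh.symm hxy)
      (fun hh => noTri hc' hx hy pc' hxc' hh.symm hxy)
      (fun hh => noTri hc hx hz pc hxc.symm hh.symm hxz)
      (fun hh => noTri hc' hx hz pc' hxc' hh.symm hxz) hcc hncc hxy hxz hxc hxc'.symm
  have attTri : ∀ {x y z c}, x ∈ nonNbr G w → y ∈ nonNbr G w → z ∈ nonNbr G w →
      c ∈ nonNbr G w → G.Adj p c → G.Adj x y → G.Adj x z → G.Adj y z → G.Adj x c → False := by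
    intro x y z c hx hy hz hc pc hxy hxz hyz hxc
    by_cases ha : ∃ a' ∈ nonNbr G w, G.Adj p a' ∧ c ≠ a' ∧ ¬ G.Adj c a'
    · obtain ⟨c', hc', pc', hne', hn'⟩ := ha
      exact attTri' hx hy hz hc hc' pc pc' hne' hn' hxy hxz hyz hxc
    · push Not at ha
      have c1 : a₁ ≠ c := by rintro rfl; exact hn (ha a₂ h2 p2 hne)
      have c2 : a₂ ≠ c := by rintro rfl; exact hn (ha a₁ h1 p1 hne.symm).symm
      have ha1 := ha a₁ h1 p1 c1.symm
      have ha2 := ha a₂ h2 p2 c2.symm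
      refine F c a₁ a₂ x y ha1 ha2 hxc.symm hxy hne hn ?_ ?_ ?_ ?_ ?_
      · exact fun hh => noTri hc h1 hx pc ha1 hxc.symm hh
      · exact fun hh => noTri hc h2 hx pc ha2 hxc.symm hh
      · exact fun hh => noTri hc hx hy pc hxc.symm hh.symm hxy
      · exact fun hh => attTri' hy hx hz h1 h2 p1 p2 hne hn hxy.symm hyz hxz hh
      · exact fun hh => attTri' hy hx hz h2 h1 p2 p1 hne.symm (fun h => hn h.symm) hxy.symm hyz
          hxz hh
  let Y : Set V := {t | t ∈ nonNbr G w ∧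
    (G.Adj p t ∨ ∃ c ∈ nonNbr G w, G.Adj p c ∧ G.Adj t c)}
  have uniq : ∀ {t b t'}, t ∈ nonNbr G w → t ∉ Y → b ∈ Y → G.Adj t b → t' ∈ nonNbr G w →
      G.Adj t t' → t' = b := by
    intro t b t' ht htY hb htb ht' htt'
    by_contra hne'
    have pt : ¬ G.Adj p t := fun hp => htY ⟨ht, Or.inl hp⟩
    have tA : ∀ {c}, c ∈ nonNbr G w → G.Adj p c → ¬ G.Adj t c := fun hc pc htc =>
      htY ⟨ht, Or.inr ⟨_, hc, pc, htc⟩⟩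
    obtain ⟨hbT, hb⟩ := hb
    have pb : ¬ G.Adj p b := fun hp => tA hbT hp htb
    obtain ⟨c, hc, pc, hbc⟩ := hb.resolve_left pb
    have pt' : ¬ G.Adj p t' := fun hp => tA ht' hp htt'
    obtain ⟨c, c', hc, hc', pc, pc', hcc, hncc, hbc, hbc'⟩ : ∃ c c', c ∈ nonNbr G w ∧
        c' ∈ nonNbr G w ∧ G.Adj p c ∧ G.Adj p c' ∧ c ≠ c' ∧ ¬ G.Adj c c' ∧ G.Adj b c ∧
        G.Adj b c' := by
      by_cases ha : ∃ a' ∈ nonNbr G w, G.Adj p a' ∧ c ≠ a' ∧ ¬ G.Adj c a'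
      · obtain ⟨c', hc', pc', hne', hn'⟩ := ha
        exact ⟨c, c', hc, hc', pc, pc', hne', hn', hbc,
          (fork hc hc' hbT pc pc' pb hne'.symm (fun h => hn' h.symm) hbc.symm).symm⟩
      · push Not at ha
        have c1 : a₁ ≠ c := by rintro rfl; exact hn (ha a₂ h2 p2 hne)
        have c2 : a₂ ≠ c := by rintro rfl; exact hn (ha a₁ h1 p1 hne.symm).symm
        have ha1 := ha a₁ h1 p1 c1.symm
        have ha2 := ha a₂ h2 p2 c2.symm
        exact (F c a₁ a₂ b t ha1 ha2 hbc.symm htb.symm hne hn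
          (fun hh => noTri hc h1 hbT pc ha1 hbc.symm hh)
          (fun hh => noTri hc h2 hbT pc ha2 hbc.symm hh) (tA hc pc) (tA h1 p1) (tA h2 p2)).elim
    by_cases htb' : G.Adj t' b
    · exact attTri hbT ht ht' hc pc htb.symm htb'.symm htt' hbc
    · have key : ∀ {c}, c ∈ nonNbr G w → G.Adj p c → G.Adj b c → ¬ G.Adj t' c :=
        fun hc pc hbc hh => htb' (fork_adj F hwp pc hc.2 ht'.2 hbT.2 hh.symm hbc.symm pt' pb hne')
      exact F b c c' t t' hbc hbc' htb.symm htt' hcc hncc (fun h => tA hc pc h.symm)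
        (fun h => tA hc' pc' h.symm) htb' (key hc pc hbc) (key hc' pc' hbc')
  have hY : Y ∪ {x | x ∈ nonNbr G w ∧ ∃ y ∈ Y, G.Adj x y} = nonNbr G w := by
    refine hw.conn _ (Set.union_subset (fun x hx => hx.1) fun x hx => hx.1)
      ⟨a₁, Or.inl ⟨h1, Or.inl p1⟩⟩ fun x hx y hy hxy => ?_
    by_cases hxY : x ∈ Y
    · exact Or.inr ⟨hy, x, hxY, hxy.symm⟩
    · obtain ⟨hxT, b, hb, hxb⟩ := hx.resolve_left hxY
      exact Or.inl (uniq hxT hxY hb hxb hy hxy ▸ hb)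
  have hkY : k₁ ∉ Y := by
    rintro ⟨-, hp | ⟨c, hc, pc, hkc⟩⟩
    · exact noTri hw.mem₁ hw.mem₂ hw.mem₃ hp hw.adj₁₂ hw.adj₁₃ hw.adj₂₃
    · exact attTri hw.mem₁ hw.mem₂ hw.mem₃ hc pc hw.adj₁₂ hw.adj₁₃ hw.adj₂₃ hkc
  obtain ⟨-, b, hb, hkb⟩ := (hY.symm.subset hw.mem₁).resolve_left hkY
  exact hw.adj₂₃.ne ((uniq hw.mem₁ hkY hb hkb hw.mem₂ hw.adj₁₂).trans
    (uniq hw.mem₁ hkY hb hkb hw.mem₃ hw.adj₁₃).symm)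

/-- The vertices `a`, `b`, `c` are distinct and pairwise nonadjacent. -/
def Indep (G : SimpleGraph V) (a b c : V) : Prop :=
  a ≠ b ∧ a ≠ c ∧ b ≠ c ∧ ¬ G.Adj a b ∧ ¬ G.Adj a c ∧ ¬ G.Adj b c

theorem Indep.swap {a b c : V} (h : Indep G a b c) : Indep G b a c := by
  obtain ⟨h1, h2, h3, h4, h5, h6⟩ := h
  exact ⟨h1.symm, h3, h2, fun h => h4 h.symm, h6, h5⟩

theorem Indep.rot {a b c : V} (h : Indep G a b c) : Indep G b c a := by
  obtain ⟨h1, h2, h3, h4, h5, h6⟩ := h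
  exact ⟨h3, h1.symm, h2.symm, h6, fun h => h4 h.symm, fun h => h5 h.symm⟩

theorem Basic.no_claw_of_complete [Finite V] (h : Basic G) {w k₁ k₂ k₃ y₀ : V}
    (hw : Special G w k₁ k₂ k₃) (hy₀ : G.Adj w y₀) (hy₀T : ∀ t ∈ nonNbr G w, G.Adj y₀ t)
    {x l₁ l₂ l₃ : V} (hx1 : G.Adj x l₁) (hx2 : G.Adj x l₂) (hx3 : G.Adj x l₃)
    (hl : Indep G l₁ l₂ l₃) : False := by
  have F := h.noChair
  have K := h.noKite
  obtain ⟨hconn, m1, m2, m3, k12, k13, k23⟩ := id hw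
  have TT : ∀ {s t}, s ∈ nonNbr G w → t ∈ nonNbr G w → s ≠ t → G.Adj s t := fun hs ht hst =>
    h.adj_of_common_nbr hw hy₀ hs ht (hy₀T _ hs) (hy₀T _ ht) hst
  let C : V → Prop := fun y => G.Adj w y ∧ ∀ t ∈ nonNbr G w, G.Adj y t
  let N : V → Prop := fun p => G.Adj w p ∧ ∃ t ∈ nonNbr G w, ¬ G.Adj p t
  have cls : ∀ v, v = w ∨ v ∈ nonNbr G w ∨ C v ∨ N v := by
    intro v
    by_cases h1 : v = w
    · exact Or.inl h1
    by_cases h2 : G.Adj w v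
    · by_cases h3 : ∀ t ∈ nonNbr G w, G.Adj v t
      · exact Or.inr (Or.inr (Or.inl ⟨h2, h3⟩))
      · push Not at h3
        exact Or.inr (Or.inr (Or.inr ⟨h2, h3⟩))
    · exact Or.inr (Or.inl ⟨h1, h2⟩)
  have hC₀ : C y₀ := ⟨hy₀, hy₀T⟩
  have one : ∀ {p k k'}, N p → k ∈ nonNbr G w → k' ∈ nonNbr G w → G.Adj p k → G.Adj p k' →
      k = k' := by
    rintro p k k' ⟨hwp, t, ht, hpt⟩ hk hk' hpk hpk'
    by_contra hne
    have h1 : k ≠ t := by rintro rfl; exact hpt hpk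
    have h2 : k' ≠ t := by rintro rfl; exact hpt hpk'
    exact hpt (triangle_adj K hwp hk.2 hk'.2 ht.2 (TT hk hk' hne) (TT hk ht h1) (TT hk' ht h2)
      hpk hpk')
  have two : ∀ k : V, ∃ k' ∈ nonNbr G w, ∃ k'' ∈ nonNbr G w, k' ≠ k ∧ k'' ≠ k ∧
      G.Adj k' k'' := by
    intro k
    by_cases h1 : k = k₁
    · exact ⟨k₂, m2, k₃, m3, h1 ▸ k12.ne', h1 ▸ k13.ne', k23⟩
    · by_cases h2 : k = k₂
      · exact ⟨k₁, m1, k₃, m3, h2 ▸ k12.ne, h2 ▸ k23.ne', k13⟩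
      · exact ⟨k₁, m1, k₂, m2, Ne.symm h1, Ne.symm h2, k12⟩
  have twoN : ∀ {p}, N p → ∃ k' ∈ nonNbr G w, ∃ k'' ∈ nonNbr G w, G.Adj k' k'' ∧ ¬ G.Adj p k' ∧
      ¬ G.Adj p k'' := by
    intro p hp
    by_cases h1 : ∃ k ∈ nonNbr G w, G.Adj p k
    · obtain ⟨k, hk, hpk⟩ := h1
      obtain ⟨k', hk', k'', hk'', n1, n2, n3⟩ := two k
      exact ⟨k', hk', k'', hk'', n3, fun hh => n1 (one hp hk' hk hh hpk),
        fun hh => n2 (one hp hk'' hk hh hpk)⟩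
    · push Not at h1
      exact ⟨k₁, m1, k₂, m2, k12, h1 _ m1, h1 _ m2⟩
  have common : ∀ {p q}, N p → N q → ∃ t ∈ nonNbr G w, ¬ G.Adj p t ∧ ¬ G.Adj q t := by
    intro p q hp hq
    obtain ⟨k', hk', k'', hk'', n1, n2, n3⟩ := twoN hp
    by_cases h1 : G.Adj q k'
    · exact ⟨k'', hk'', n3, fun hh => n1.ne (one hq hk' hk'' h1 hh)⟩
    · exact ⟨k', hk', n2, h1⟩
  have E2 : ∀ {p q k}, N p → N q → k ∈ nonNbr G w → p ≠ q → G.Adj p k → G.Adj q k → False := by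
    intro p q k hp hq hk hpq hpk hqk
    obtain ⟨k', hk', k'', hk'', n1, n2, n3⟩ := two k
    have p1 : ¬ G.Adj p k' := fun hh => n1 (one hp hk' hk hh hpk)
    have p2 : ¬ G.Adj p k'' := fun hh => n2 (one hp hk'' hk hh hpk)
    have q1 : ¬ G.Adj q k' := fun hh => n1 (one hq hk' hk hh hqk)
    have q2 : ¬ G.Adj q k'' := fun hh => n2 (one hq hk'' hk hh hqk)
    by_cases hadj : G.Adj p q
    · exact K p q k w k' hadj hpk hp.1.symm hqk hq.1.symm (fun h => hk.2 h.symm)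
        (TT hk' hk n1) (fun h => p1 h.symm) (fun h => q1 h.symm) (fun h => hk'.2 h.symm)
    · exact h.codiamond n3 (fun h => p1 h.symm) (fun h => q1 h.symm) (fun h => p2 h.symm)
        (fun h => q2 h.symm) hpq hadj (TT hk hk' n1.symm) (TT hk hk'' n2.symm) hpk.symm hqk.symm
  have E6 : ∀ {y z p}, C y → C z → y ≠ z → ¬ G.Adj y z → N p → G.Adj p y := by
    intro y z p hy hz hyz hn hp
    by_contra hcon
    obtain ⟨k', hk', k'', hk'', n1, n2, n3⟩ := twoN hp
    have hpz : G.Adj p z := by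
      rcases h.diamond (z := p) n1 (hy.2 _ hk').symm (hz.2 _ hk').symm (hy.2 _ hk'').symm
        (hz.2 _ hk'').symm hyz hn with h | h | h | h
      · exact absurd h n2
      · exact absurd h n3
      · exact absurd h hcon
      · exact h
    exact K k' k'' z y p n1 (hz.2 _ hk').symm (hy.2 _ hk').symm (hz.2 _ hk'').symm
        (hy.2 _ hk'').symm (fun h => hn h.symm) hpz n2 n3 hcon
  have CC : ∀ {y z}, C y → C z → y ≠ z → G.Adj y z := by
    intro y z hy hz hyz
    by_contra hn
    rcases h.prime {y | C y ∧ ∃ z, C z ∧ y ≠ z ∧ ¬ G.Adj y z} (by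
      rintro v hv a - b ⟨hb, z, hz, hbz, hnbz⟩ -
      rcases cls v with rfl | hvT | hvC | hvN
      · exact hb.1
      · exact (hb.2 _ hvT).symm
      · by_contra hcon
        refine hv ⟨hvC, b, hb, ?_, hcon⟩
        rintro rfl
        exact hv ⟨hb, z, hz, hbz, hnbz⟩
      · exact E6 hb hz hbz hnbz hvN) with hh | hh
    · exact hyz (hh ⟨hy, z, hz, hyz, hn⟩ ⟨hz, y, hy, hyz.symm, fun h => hn h.symm⟩)
    · exact G.irrefl (hh.symm.subset (Set.mem_univ w)).1.1
  have E7 : ∀ {y p k}, C y → N p → k ∈ nonNbr G w → G.Adj p k → ¬ G.Adj y p := by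
    intro y p k hy hp hk hpk hyp
    rcases h.prime {v | v ≠ y} (by
      intro v hv a _ b (hb : b ≠ y) _
      have hv : v = y := by by_contra hh; exact hv hh
      subst hv
      rcases cls b with rfl | hbT | hbC | hbN
      · exact hy.1.symm
      · exact hy.2 _ hbT
      · exact CC hy hbC hb.symm
      · by_cases hpb : p = b
        · exact hpb ▸ hyp
        by_contra hn
        have hbk : ¬ G.Adj b k := fun hh => E2 hp hbN hk hpb hpk hh
        by_cases hadj : G.Adj p b
        · obtain ⟨k', hk', n1, n2⟩ := common hp hbN
          exact K w p v b k' hp.1 hy.1 hbN.1 hyp.symm hadj hn (hy.2 _ hk').symm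
            (fun h => hk'.2 h.symm) (fun h => n1 h.symm) (fun h => n2 h.symm)
        · exact K v p w k b hyp hy.1.symm (hy.2 _ hk) hp.1.symm hpk hk.2 hbN.1.symm
            (fun h => hn h.symm) (fun h => hadj h.symm) hbk) with hh | hh
    · exact hk.1 (hh (show k ∈ {v | v ≠ y} from (hy.2 _ hk).ne') hy.1.ne)
    · exact hh.symm.subset (Set.mem_univ y) rfl
  have E0 : ∀ {p q y}, N p → N q → C y → p ≠ q → ¬ G.Adj p q → ¬ G.Adj p y → ¬ G.Adj q y →
      False := by
    intro p q y hp hq hy hpq n1 n2 n3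
    obtain ⟨t, ht, n4, n5⟩ := common hp hq
    exact F w p q y t hp.1 hq.1 hy.1 (hy.2 _ ht) hpq n1 n2 n3 (fun h => ht.2 h.symm)
      (fun h => n4 h.symm) (fun h => n5 h.symm)
  have E1 : ∀ {p q k k'}, N p → N q → k ∈ nonNbr G w → k' ∈ nonNbr G w → G.Adj p k →
      G.Adj q k' → p ≠ q → G.Adj p q := by
    intro p q k k' hp hq hk hk' hpk hqk' hpq
    by_contra hn
    exact E0 hp hq hC₀ hpq hn (fun h => E7 hC₀ hp hk hpk h.symm)
      (fun h => E7 hC₀ hq hk' hqk' h.symm)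
  have E3a : ∀ {p q k y}, N p → k ∈ nonNbr G w → G.Adj p k → N q → (∀ t ∈ nonNbr G w, ¬ G.Adj q t) →
      C y → G.Adj q y → ¬ G.Adj q p := by
    intro p q k y hp hk hpk hq hqT hy hqy hqp
    obtain ⟨k', hk', n1, n2⟩ := common hp hq
    exact K w q y p k' hq.1 hy.1 hp.1 hqy hqp (E7 hy hp hk hpk) (hy.2 _ hk').symm
      (fun h => hk'.2 h.symm) (fun h => n2 h.symm) (fun h => n1 h.symm)
  have E3b : ∀ {p q k y}, N p → k ∈ nonNbr G w → G.Adj p k → N q → (∀ t ∈ nonNbr G w, ¬ G.Adj q t) →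
      C y → ¬ G.Adj q y → G.Adj q p := by
    intro p q k y hp hk hpk hq hqT hy hqy
    by_contra hqp
    refine E0 hp hq hy ?_ (fun h => hqp h.symm) (fun h => E7 hy hp hk hpk h.symm) hqy
    rintro rfl
    exact hqT k hk hpk
  have E4 : ∀ {q q' y}, N q → (∀ t ∈ nonNbr G w, ¬ G.Adj q t) → N q' →
      (∀ t ∈ nonNbr G w, ¬ G.Adj q' t) → C y → q ≠ q' → ¬ G.Adj q q' → G.Adj y q → G.Adj y q' →
      False := by
    intro q q' y _ hq _ hq' hy hne hn h1 h2
    exact h.codiamond k12 (fun h => hq _ m1 h.symm) (fun h => hq' _ m1 h.symm)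
      (fun h => hq _ m2 h.symm) (fun h => hq' _ m2 h.symm) hne hn (hy.2 _ m1) (hy.2 _ m2) h1 h2
  have P : ∀ {p}, N p → (∃ k ∈ nonNbr G w, G.Adj p k) ∨ ∀ t ∈ nonNbr G w, ¬ G.Adj p t := by
    intro p _
    by_cases hh : ∃ k ∈ nonNbr G w, G.Adj p k
    · exact Or.inl hh
    · push Not at hh; exact Or.inr hh
  have mixed : ∀ {p q k y}, N p → k ∈ nonNbr G w → G.Adj p k → N q →
      (∀ t ∈ nonNbr G w, ¬ G.Adj q t) → C y → ¬ G.Adj p q → G.Adj y q := by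
    intro p q k y hp hk hpk hq hqT hy hn
    by_contra hcon
    exact hn (E3b hp hk hpk hq hqT hy (fun h => hcon h.symm)).symm
  have WN : ∀ {p q r}, N p → N q → N r → Indep G p q r → False := by
    intro p q r hp hq hr ⟨d1, d2, d3, n1, n2, n3⟩
    have n1' := fun h : G.Adj q p => n1 h.symm
    have n2' := fun h : G.Adj r p => n2 h.symm
    have n3' := fun h : G.Adj r q => n3 h.symm
    rcases P hp with ⟨k, hk, hpk⟩ | hpT <;> rcases P hq with ⟨k', hk', hqk⟩ | hqT <;>
      rcases P hr with ⟨k'', hk'', hrk⟩ | hrT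
    · exact n1 (E1 hp hq hk hk' hpk hqk d1)
    · exact n1 (E1 hp hq hk hk' hpk hqk d1)
    · exact n2 (E1 hp hr hk hk'' hpk hrk d2)
    · exact E4 hq hqT hr hrT hC₀ d3 n3 (mixed hp hk hpk hq hqT hC₀ n1)
        (mixed hp hk hpk hr hrT hC₀ n2)
    · exact n3 (E1 hq hr hk' hk'' hqk hrk d3)
    · exact E4 hp hpT hr hrT hC₀ d2 n2 (mixed hq hk' hqk hp hpT hC₀ n1')
        (mixed hq hk' hqk hr hrT hC₀ n3)
    · exact E4 hp hpT hq hqT hC₀ d1 n1 (mixed hr hk'' hrk hp hpT hC₀ n2')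
        (mixed hr hk'' hrk hq hqT hC₀ n3')
    · by_cases hyp : G.Adj p y₀
      · by_cases hyq : G.Adj q y₀
        · exact E4 hp hpT hq hqT hC₀ d1 n1 hyp.symm hyq.symm
        · by_cases hyr : G.Adj r y₀
          · exact E4 hp hpT hr hrT hC₀ d2 n2 hyp.symm hyr.symm
          · exact E0 hq hr hC₀ d3 n3 hyq hyr
      · by_cases hyq : G.Adj q y₀
        · by_cases hyr : G.Adj r y₀
          · exact E4 hq hqT hr hrT hC₀ d3 n3 hyq.symm hyr.symm
          · exact E0 hp hr hC₀ d2 n2 hyp hyr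
        · exact E0 hp hq hC₀ d1 n1 hyp hyq
  have NC : ∀ {v}, G.Adj w v → C v ∨ N v := by
    intro v hv
    rcases cls v with rfl | hT | hC | hN
    · exact absurd hv (G.irrefl)
    · exact absurd hv hT.2
    · exact Or.inl hC
    · exact Or.inr hN
  have W : ∀ {p q r}, G.Adj w p → G.Adj w q → G.Adj w r → Indep G p q r → False := by
    intro p q r hp hq hr hI
    obtain ⟨d1, d2, d3, n1, n2, n3⟩ := id hI
    rcases NC hp with hp | hp <;> rcases NC hq with hq | hq <;> rcases NC hr with hr | hr
    · exact n1 (CC hp hq d1)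
    · exact n1 (CC hp hq d1)
    · exact n2 (CC hp hr d2)
    · exact E0 hq hr hp d3 n3 (fun h => n1 h.symm) (fun h => n2 h.symm)
    · exact n3 (CC hq hr d3)
    · exact E0 hp hr hq d2 n2 n1 (fun h => n3 h.symm)
    · exact E0 hp hq hr d1 n1 n2 n3
    · exact WN hp hq hr hI
  -- a leaf outside the neighbourhood of `w`
  have leafT : ∀ {l q r}, G.Adj x l → G.Adj x q → G.Adj x r → Indep G l q r → l ∈ nonNbr G w →
      False := by
    intro l q r xl xq xr ⟨d1, d2, d3, n1, n2, n3⟩ hl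
    have qN : G.Adj w q → N q := fun hh => (NC hh).resolve_left fun hC => n1 (hC.2 _ hl).symm
    have rN : G.Adj w r → N r := fun hh => (NC hh).resolve_left fun hC => n2 (hC.2 _ hl).symm
    have qT : q ∉ nonNbr G w := fun hh => n1 (TT hl hh d1)
    have rT : r ∉ nonNbr G w := fun hh => n2 (TT hl hh d2)
    have adj : ∀ {v}, v ∉ nonNbr G w → v ≠ w → G.Adj w v := fun h1 h2 =>
      by_contra fun h3 => h1 ⟨h2, h3⟩
    rcases cls x with rfl | hx | hx | hx
    · exact hl.2 xl
    · have qN := qN (adj qT (fun hh => hx.2 (hh ▸ xq.symm)))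
      have rN := rN (adj rT (fun hh => hx.2 (hh ▸ xr.symm)))
      exact E2 qN rN hx d3 xq.symm xr.symm
    · have key : ∀ {q}, (G.Adj w q → N q) → G.Adj x q → q ≠ w →
          q ∉ nonNbr G w → N q ∧ ∀ t ∈ nonNbr G w, ¬ G.Adj q t := by
        intro q hqN xq hqw hqT
        have hN := hqN (adj hqT hqw)
        refine ⟨hN, fun t ht hqt => E7 hx hN ht hqt xq⟩
      by_cases hqw : q = w
      · subst hqw
        exact n3 (rN (adj rT d3.symm)).1
      by_cases hrw : r = w
      · subst hrw
        exact n3 (qN (adj qT hqw)).1.symm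
      obtain ⟨a1, a2⟩ := key qN xq hqw qT
      obtain ⟨b1, b2⟩ := key rN xr hrw rT
      exact E4 a1 a2 b1 b2 hx d3 n3 xq xr
    · by_cases hqw : q = w
      · subst hqw
        exact n3 (rN (adj rT d3.symm)).1
      by_cases hrw : r = w
      · subst hrw
        exact n3 (qN (adj qT hqw)).1.symm
      have qN := qN (adj qT hqw)
      have rN := rN (adj rT hrw)
      have n3' := fun h : G.Adj r q => n3 h.symm
      rcases P qN with ⟨k', hk', hqk⟩ | hqT <;> rcases P rN with ⟨k'', hk'', hrk⟩ | hrT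
      · exact n3 (E1 qN rN hk' hk'' hqk hrk d3)
      · exact E3a hx hl xl rN hrT hC₀ (mixed qN hk' hqk rN hrT hC₀ n3).symm xr.symm
      · exact E3a hx hl xl qN hqT hC₀ (mixed rN hk'' hrk qN hqT hC₀ n3').symm xq.symm
      · exact E0 qN rN hC₀ d3 n3 (fun h => E3a hx hl xl qN hqT hC₀ h xq.symm)
          (fun h => E3a hx hl xl rN hrT hC₀ h xr.symm)
  have leafw : ∀ {q r}, G.Adj x q → G.Adj x r → G.Adj x w → Indep G w q r → False := by
    intro q r xq xr xw ⟨d1, d2, d3, n1, n2, n3⟩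
    exact n3 (TT ⟨d1.symm, n1⟩ ⟨d2.symm, n2⟩ d3)
  rcases cls l₁ with rfl | h1 | h1
  · exact leafw hx2 hx3 hx1 hl
  · exact leafT hx1 hx2 hx3 hl h1
  rcases cls l₂ with rfl | h2 | h2
  · exact leafw hx1 hx3 hx2 hl.swap
  · exact leafT hx2 hx3 hx1 hl.rot h2
  rcases cls l₃ with rfl | h3 | h3
  · exact leafw hx1 hx2 hx3 hl.rot.rot
  · exact leafT hx3 hx1 hx2 hl.rot.rot h3
  exact W (h1.elim And.left And.left) (h2.elim And.left And.left) (h3.elim And.left And.left) hl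

theorem Special.no_closed_pair {w k₁ k₂ k₃ a b : V} (hw : Special G w k₁ k₂ k₃)
    (ha : a ∈ nonNbr G w) (hb : b ∈ nonNbr G w)
    (h1 : ∀ t ∈ nonNbr G w, G.Adj a t → t = a ∨ t = b)
    (h2 : ∀ t ∈ nonNbr G w, G.Adj b t → t = a ∨ t = b) : False := by
  have hT : ({a, b} : Set V) = nonNbr G w := by
    refine hw.conn _ ?_ ⟨a, Or.inl rfl⟩ ?_
    · rintro x (rfl | rfl)
      exacts [ha, hb]
    · rintro x (rfl | rfl) y hy hxy
      exacts [h1 y hy hxy, h2 y hy hxy]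
  have e1 := hT.symm.subset hw.mem₁
  have e2 := hT.symm.subset hw.mem₂
  have e3 := hT.symm.subset hw.mem₃
  have n1 := hw.adj₁₂.ne
  have n2 := hw.adj₁₃.ne
  have n3 := hw.adj₂₃.ne
  simp only [Set.mem_insert_iff, Set.mem_singleton_iff] at e1 e2 e3
  clear h1 h2 hT ha hb hw
  grind

theorem Basic.private_nbr_unique [Finite V] (h : Basic G) {w p q a t t' : V} (hp : G.Adj w p)
    (hpq : p ≠ q) (hn : ¬ G.Adj p q) (ha : a ∈ nonNbr G w) (hpa : G.Adj p a) (hqa : G.Adj q a)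
    (ht : t ∈ nonNbr G w) (ht' : t' ∈ nonNbr G w) (hat : G.Adj a t) (hat' : G.Adj a t')
    (hpt : ¬ G.Adj p t) (hqt : ¬ G.Adj q t) (hpt' : ¬ G.Adj p t') (hqt' : ¬ G.Adj q t') :
    t = t' := by
  by_contra hne
  exact h.codiamond (fork_adj h.noChair hp hpa ha.2 ht.2 ht'.2 hat hat' hpt hpt' hne)
    (fun h => hpt h.symm) (fun h => hqt h.symm) (fun h => hpt' h.symm) (fun h => hqt' h.symm)
    hpq hn hat hat' hpa.symm hqa.symm

theorem Basic.nbrs_subset_of_two [Finite V] (h : Basic G) {w k₁ k₂ k₃ : V}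
    (hw : Special G w k₁ k₂ k₃) {p q x y : V} (hp : G.Adj w p) (hq : G.Adj w q)
    (hx : x ∈ nonNbr G w) (hy : y ∈ nonNbr G w) (hxy : x ≠ y) (hpx : G.Adj p x) (hpy : G.Adj p y)
    (hqx : G.Adj q x) (hqy : G.Adj q y) : ∀ t ∈ nonNbr G w, G.Adj p t → G.Adj q t := by
  intro t ht hpt
  by_cases h1 : x = t
  · exact h1 ▸ hqx
  by_cases h2 : y = t
  · exact h2 ▸ hqy
  exact triangle_adj h.noKite hq hx.2 hy.2 ht.2 (h.adj_of_common_nbr hw hp hx hy hpx hpy hxy)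
    (h.adj_of_common_nbr hw hp hx ht hpx hpt h1) (h.adj_of_common_nbr hw hp hy ht hpy hpt h2)
    hqx hqy

theorem Basic.nbrs_ne [Finite V] (h : Basic G) {w k₁ k₂ k₃ : V}
    (hw : Special G w k₁ k₂ k₃) (hE : ∀ p, G.Adj w p → ∃ t ∈ nonNbr G w, ¬ G.Adj p t) {p q a : V}
    (hp : G.Adj w p) (hpq : p ≠ q) (hn : ¬ G.Adj p q)
    (ha : a ∈ nonNbr G w) (hpa : G.Adj p a) (hA : ∀ t ∈ nonNbr G w, G.Adj p t ↔ G.Adj q t) :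
    False := by
  obtain ⟨t₀, ht₀, hpt₀⟩ := hE p hp
  obtain ⟨a₀, ha₀, b, hb, pa₀, pb, hab⟩ := hw.conn.exists_adj (A := {x | G.Adj p x}) ha hpa ht₀
    hpt₀
  have pa₀ : G.Adj p a₀ := pa₀
  have pb : ¬ G.Adj p b := pb
  have clq : ∀ {x y}, x ∈ nonNbr G w → y ∈ nonNbr G w → G.Adj p x → G.Adj p y → x ≠ y →
      G.Adj x y := fun hx hy => h.adj_of_common_nbr hw hp hx hy
  have tri : ∀ {x y z}, x ∈ nonNbr G w → y ∈ nonNbr G w → z ∈ nonNbr G w → G.Adj x y →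
      G.Adj x z → G.Adj y z → G.Adj p x → G.Adj p y → G.Adj p z := fun hx hy hz =>
    triangle_adj h.noKite hp hx.2 hy.2 hz.2
  have uniq : ∀ {c t t'}, c ∈ nonNbr G w → G.Adj p c → t ∈ nonNbr G w → t' ∈ nonNbr G w →
      G.Adj c t → G.Adj c t' → ¬ G.Adj p t → ¬ G.Adj p t' → t = t' := by
    intro c t t' hc hpc ht ht' hct hct' hpt hpt'
    exact h.private_nbr_unique hp hpq hn hc hpc ((hA c hc).1 hpc) ht ht' hct hct'
      hpt (fun h => hpt ((hA t ht).2 h)) hpt' (fun h => hpt' ((hA t' ht').2 h))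
  by_cases h2 : ∃ a₁ ∈ nonNbr G w, G.Adj p a₁ ∧ a₁ ≠ a₀
  · obtain ⟨a₁, ha₁, pa₁, hne⟩ := h2
    have dom : ∀ {c c' t}, c ∈ nonNbr G w → c' ∈ nonNbr G w → G.Adj p c → G.Adj p c' → c ≠ c' →
        t ∈ nonNbr G w → ¬ G.Adj p t → G.Adj c t ∨ G.Adj c' t := by
      intro c c' t hc hc' pc pc' hcc ht pt
      rcases h.diamond (z := t) (clq hc hc' pc pc' hcc) pc.symm ((hA c hc).1 pc).symm pc'.symm
        ((hA c' hc').1 pc').symm hpq hn with hh | hh | hh | hh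
      · exact Or.inl hh.symm
      · exact Or.inr hh.symm
      · exact absurd hh.symm pt
      · exact absurd ((hA t ht).2 hh.symm) pt
    have bna : ∀ {c}, c ∈ nonNbr G w → G.Adj p c → c ≠ a₀ → ¬ G.Adj c b := by
      intro c hc pc hca hcb
      exact pb (tri ha₀ hc hb (clq ha₀ hc pa₀ pc hca.symm) hab hcb pa₀ pc)
    have only : ∀ c ∈ nonNbr G w, G.Adj p c → c = a₀ ∨ c = a₁ := by
      intro c hc pc
      by_contra hcon
      push Not at hcon
      exact (dom hc ha₁ pc pa₁ hcon.2 hb pb).elim (bna hc pc hcon.1) (bna ha₁ pa₁ hne)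
    -- a triangle with a vertex seen by `p`
    have seen : ∀ {x y z}, x ∈ nonNbr G w → y ∈ nonNbr G w → z ∈ nonNbr G w → G.Adj x y →
        G.Adj x z → G.Adj y z → G.Adj p x → False := by
      intro x y z hx hy hz hxy hxz hyz px
      by_cases py : G.Adj p y
      · have pz := tri hx hy hz hxy hxz hyz px py
        have o1 := only x hx px
        have o2 := only y hy py
        have o3 := only z hz pz
        have := hxy.ne
        have := hxz.ne
        have := hyz.ne
        clear * - o1 o2 o3 this hxy hxz hyz
        grind [SimpleGraph.irrefl]
      by_cases pz : G.Adj p z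
      · exact py (tri hx hz hy hxz hxy hyz.symm px pz)
      exact hyz.ne (uniq hx px hy hz hxy hxz py pz)
    obtain ⟨-, m1, m2, m3, k12, k13, k23⟩ := hw
    have p1 : ¬ G.Adj p k₁ := seen m1 m2 m3 k12 k13 k23
    have p2 : ¬ G.Adj p k₂ := seen m2 m1 m3 k12.symm k23 k13
    have p3 : ¬ G.Adj p k₃ := seen m3 m1 m2 k13.symm k23.symm k12
    have d1 := dom ha₀ ha₁ pa₀ pa₁ hne.symm m1 p1
    have d2 := dom ha₀ ha₁ pa₀ pa₁ hne.symm m2 p2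
    have d3 := dom ha₀ ha₁ pa₀ pa₁ hne.symm m3 p3
    rcases d1 with d1 | d1 <;> rcases d2 with d2 | d2
    · exact k12.ne (uniq ha₀ pa₀ m1 m2 d1 d2 p1 p2)
    · rcases d3 with d3 | d3
      · exact k13.ne (uniq ha₀ pa₀ m1 m3 d1 d3 p1 p3)
      · exact k23.ne (uniq ha₁ pa₁ m2 m3 d2 d3 p2 p3)
    · rcases d3 with d3 | d3
      · exact k23.ne (uniq ha₀ pa₀ m2 m3 d2 d3 p2 p3)
      · exact k13.ne (uniq ha₁ pa₁ m1 m3 d1 d3 p1 p3)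
    · exact k12.ne (uniq ha₁ pa₁ m1 m2 d1 d2 p1 p2)
  · push Not at h2
    refine hw.no_closed_pair ha₀ hb ?_ ?_
    · intro t ht hat
      by_cases pt : G.Adj p t
      · exact Or.inl (h2 t ht pt)
      · exact Or.inr (uniq ha₀ pa₀ ht hb hat hab pt pb)
    · intro t ht hbt
      by_cases pt : G.Adj p t
      · exact Or.inl (h2 t ht pt)
      exfalso
      refine h.noChair a₀ p q b t pa₀.symm ((hA _ ha₀).1 pa₀).symm hab hbt hpq hn pb
        (fun h => pb ((hA b hb).2 h)) ?_ (fun h => pt h.symm)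
        (fun h => pt ((hA t ht).2 h.symm))
      intro hta
      exact hbt.ne' (uniq ha₀ pa₀ ht hb hta.symm hab pt pb)

theorem Basic.no_indep_common [Finite V] (h : Basic G) {w k₁ k₂ k₃ : V}
    (hw : Special G w k₁ k₂ k₃) (hE : ∀ p, G.Adj w p → ∃ t ∈ nonNbr G w, ¬ G.Adj p t) {p q r a : V}
    (hp : G.Adj w p) (hq : G.Adj w q) (hr : G.Adj w r) (hI : Indep G p q r)
    (ha : a ∈ nonNbr G w) (hpa : G.Adj p a) (hqa : G.Adj q a) : False := by
  have clq : ∀ {p x y}, G.Adj w p → x ∈ nonNbr G w → y ∈ nonNbr G w → G.Adj p x → G.Adj p y →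
      x ≠ y → G.Adj x y := fun hp hx hy => h.adj_of_common_nbr hw hp hx hy
  have fork : ∀ {p q r t}, G.Adj w p → G.Adj w q → G.Adj w r → Indep G p q r → t ∈ nonNbr G w →
      G.Adj p t → G.Adj q t ∨ G.Adj r t := by
    intro p q r t hp hq hr ⟨d1, d2, d3, n1, n2, n3⟩ ht hpt
    by_contra hcon
    push Not at hcon
    exact h.noChair w q r p t hq hr hp hpt d3 n3 (fun h => n1 h.symm) (fun h => n2 h.symm)
      (fun h => ht.2 h.symm) (fun h => hcon.1 h.symm) (fun h => hcon.2 h.symm)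
  have sub : ∀ {p q r a}, G.Adj w p → G.Adj w q → G.Adj w r → Indep G p q r →
      a ∈ nonNbr G w → G.Adj p a → G.Adj q a → ∀ x ∈ nonNbr G w, G.Adj p x → G.Adj q x := by
    clear hp hq hr hI ha hpa hqa p q r a
    intro p q r a hp hq hr hI ha hpa hqa x hx hpx
    by_contra hqx
    obtain ⟨d1, d2, d3, n1, n2, n3⟩ := id hI
    have hax : a ≠ x := by rintro rfl; exact hqx hqa
    have eq := fun {p q x y} hp hq hx hy hxy hpx hpy hqx hqy =>
      h.nbrs_subset_of_two hw (p := p) (q := q) (x := x) (y := y) hp hq hx hy hxy hpx hpy hqx hqy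
    have hrx : G.Adj r x := (fork hp hq hr hI hx hpx).resolve_left hqx
    have hra : ¬ G.Adj r a := by
      intro hra
      refine h.nbrs_ne hw hE hp d2 n2 ha hpa fun t ht => ⟨?_, ?_⟩
      · exact eq hp hr ha hx hax hpa hpx hra hrx t ht
      · exact eq hr hp ha hx hax hra hrx hpa hpx t ht
    have Aq : ∀ y ∈ nonNbr G w, G.Adj q y → y = a := by
      intro y hy hqy
      by_contra hya
      by_cases hpy : G.Adj p y
      · exact hqx (eq hp hq ha hy (Ne.symm hya) hpa hpy hqa hqy x hx hpx)
      · have hry : G.Adj r y := (fork hq hr hp hI.rot hy hqy).resolve_right hpy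
        have hxy : x ≠ y := by rintro rfl; exact hpy hpx
        exact hpy (triangle_adj h.noKite hp ha.2 hx.2 hy.2 (clq hp ha hx hpa hpx hax)
          (clq hq ha hy hqa hqy (Ne.symm hya)) (clq hr hx hy hrx hry hxy) hpa hpx)
    have Ap : ∀ z ∈ nonNbr G w, G.Adj p z → z = a ∨ z = x := by
      intro z hz hpz
      by_contra hcon
      push Not at hcon
      have hrz : G.Adj r z := (fork hp hq hr hI hz hpz).resolve_left fun hh =>
        hcon.1 (Aq z hz hh)
      exact hra (eq hp hr hx hz hcon.2.symm hpx hpz hrx hrz a ha hpa)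
    have Ar : ∀ z ∈ nonNbr G w, G.Adj r z → z = x := by
      intro z hz hrz
      rcases fork hr hp hq hI.rot.rot hz hrz with hh | hh
      · exact (Ap z hz hh).resolve_left (by rintro rfl; exact hra hrz)
      · exact absurd (Aq z hz hh ▸ hrz) hra
    have hadj := clq hp ha hx hpa hpx hax
    refine hw.no_closed_pair ha hx ?_ ?_
    · intro t ht hat
      by_contra hcon
      push Not at hcon
      have htx : G.Adj x t := fork_adj h.noChair hq hqa ha.2 hx.2 ht.2 hadj hat hqx
        (fun hh => hcon.1 (Aq t ht hh)) hcon.2.symm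
      exact (Ap t ht (triangle_adj h.noKite hp ha.2 hx.2 ht.2 hadj hat htx hpa hpx)).elim hcon.1
        hcon.2
    · intro t ht hxt
      by_contra hcon
      push Not at hcon
      have hat : G.Adj a t := fork_adj h.noChair hr hrx hx.2 ha.2 ht.2 hadj.symm hxt hra
        (fun hh => hcon.2 (Ar t ht hh)) hcon.1.symm
      exact (Ap t ht (triangle_adj h.noKite hp ha.2 hx.2 ht.2 hadj hat hxt hpa hpx)).elim hcon.1
        hcon.2
  exact h.nbrs_ne hw hE hp hI.1 hI.2.2.2.1 ha hpa fun t ht =>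
    ⟨sub hp hq hr hI ha hpa hqa t ht, sub hq hp hr hI.swap ha hqa hpa t ht⟩

theorem Basic.no_claw_at [Finite V] (h : Basic G) {w k₁ k₂ k₃ : V}
    (hw : Special G w k₁ k₂ k₃) (hE : ∀ p, G.Adj w p → ∃ t ∈ nonNbr G w, ¬ G.Adj p t) {p q r : V}
    (hp : G.Adj w p) (hq : G.Adj w q) (hr : G.Adj w r) (hI : Indep G p q r) : False := by
  have fork : ∀ {p q r t}, G.Adj w p → G.Adj w q → G.Adj w r → Indep G p q r → t ∈ nonNbr G w →
      ¬ G.Adj p t := by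
    intro p q r t hp hq hr hI ht hpt
    obtain ⟨d1, d2, d3, n1, n2, n3⟩ := id hI
    have h1 : ¬ G.Adj q t := fun hh => h.no_indep_common hw hE hp hq hr hI ht hpt hh
    have h2 : ¬ G.Adj r t := fun hh => h.no_indep_common hw hE hr hp hq hI.rot.rot ht hh hpt
    exact h.noChair w q r p t hq hr hp hpt d3 n3 (fun h => n1 h.symm) (fun h => n2 h.symm)
      (fun h => ht.2 h.symm) (fun h => h1 h.symm) (fun h => h2 h.symm)
  obtain ⟨u, hwu, a, ha, b, hb, hua, hub⟩ := h.prime.exists_mixed hw.mem₁ hw.mem₂ hw.adj₁₂.ne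
  obtain ⟨a, ha, b, hb, hua, hub, hab⟩ := hw.conn.exists_adj (A := {x | G.Adj u x}) ha hua hb hub
  have hua : G.Adj u a := hua
  have hub : ¬ G.Adj u b := hub
  have two : ∀ {p q r}, G.Adj w p → G.Adj w q → G.Adj w r → Indep G p q r →
      G.Adj u p ∨ G.Adj u q := by
    intro p q r hp hq hr hI
    by_contra hcon
    push Not at hcon
    exact h.noChair w p q u a hp hq hwu hua hI.1 hI.2.2.2.1 (fun h => hcon.1 h.symm)
      (fun h => hcon.2 h.symm) (fun h => ha.2 h.symm) (fun h => fork hp hq hr hI ha h.symm)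
      (fun h => fork hq hp hr hI.swap ha h.symm)
  have fin : ∀ {p q r}, G.Adj w p → G.Adj w q → G.Adj w r → Indep G p q r →
      G.Adj u p → ¬ G.Adj u q := by
    intro p q r hp hq hr hI hup huq
    exact h.noChair u p q a b hup huq hua hab hI.1 hI.2.2.2.1 (fork hp hq hr hI ha)
      (fork hq hp hr hI.swap ha) (fun h => hub h.symm) (fun h => fork hp hq hr hI hb h.symm)
      (fun h => fork hq hp hr hI.swap hb h.symm)
  have t1 := two hp hq hr hI
  have t2 := two hq hr hp hI.rot
  have t3 := two hr hp hq hI.rot.rot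
  have f1 := fin hp hq hr hI
  have f2 := fin hq hr hp hI.rot
  have f3 := fin hr hp hq hI.rot.rot
  clear * - t1 t2 t3 f1 f2 f3
  tauto

theorem Basic.special_pair_false [Finite V] (h : Basic G) {w k₁ k₂ k₃ : V}
    (hw : Special G w k₁ k₂ k₃) (hE : ∀ p, G.Adj w p → ∃ t ∈ nonNbr G w, ¬ G.Adj p t)
    {v a b c : V} (hv : v ∈ nonNbr G w) (hva : G.Adj v a) (hvb : G.Adj v b) (hvc : G.Adj v c)
    (hI : Indep G a b c) (hE' : ∃ t, G.Adj v t ∧ G.Adj w t) : False := by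
  have clq : ∀ {p x y}, G.Adj w p → x ∈ nonNbr G w → y ∈ nonNbr G w → G.Adj p x → G.Adj p y →
      x ≠ y → G.Adj x y := fun hp hx hy => h.adj_of_common_nbr hw hp hx hy
  have F1 : ∀ {p x y}, G.Adj w p → G.Adj p v → x ∈ nonNbr G w → y ∈ nonNbr G w → G.Adj v x →
      G.Adj v y → ¬ G.Adj p x → ¬ G.Adj p y → x ≠ y → G.Adj x y := fun hp hpv hx hy =>
    fork_adj h.noChair hp hpv hv.2 hx.2 hy.2
  have two : ∀ {a b c}, a ∈ nonNbr G w → b ∈ nonNbr G w → G.Adj w c → G.Adj v a → G.Adj v b →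
      G.Adj v c → Indep G a b c → False := by
    intro a b c ha hb hc hva hvb hvc ⟨d1, d2, d3, n1, n2, n3⟩
    exact n1 (F1 hc hvc.symm ha hb hva hvb (fun h => n2 h.symm) (fun h => n3 h.symm) d1)
  have one : ∀ {a p q}, a ∈ nonNbr G w → G.Adj w p → G.Adj w q → G.Adj v a → G.Adj v p →
      G.Adj v q → Indep G a p q → False := by
    intro a p q ha hp hq hva hvp hvq ⟨d1, d2, d3, n1, n2, n3⟩
    have n1' := fun h : G.Adj p a => n1 h.symm
    have n2' := fun h : G.Adj q a => n2 h.symm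
    have Na : ∀ t ∈ nonNbr G w, G.Adj a t → t = v := by
      intro t ht hat
      by_contra htv
      by_cases hadj : G.Adj t v
      · have hpt : ¬ G.Adj p t := fun hh => n1' (triangle_adj h.noKite hp hv.2 ht.2 ha.2
          hadj.symm hva hat.symm hvp.symm hh)
        have hqt : ¬ G.Adj q t := fun hh => n2' (triangle_adj h.noKite hq hv.2 ht.2 ha.2
          hadj.symm hva hat.symm hvq.symm hh)
        exact hat.ne (h.private_nbr_unique hp d3 n3 hv hvp.symm hvq.symm ha ht hva hadj.symm
          n1' n2' hpt hqt)
      · exact h.noChair v p q a t hvp hvq hva hat d3 n3 n1' n2' hadj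
          (fun hh => hadj (clq hp ht hv hh.symm hvp.symm htv))
          (fun hh => hadj (clq hq ht hv hh.symm hvq.symm htv))
    have sub : ∀ {p q}, G.Adj w p → G.Adj w q → G.Adj v p → G.Adj v q → ¬ G.Adj q a →
        ¬ G.Adj p a → ∀ x ∈ nonNbr G w, G.Adj p x → G.Adj q x := by
      intro p q hp hq hvp hvq hqa hpa x hx hpx
      by_contra hqx
      have hxv : x ≠ v := by rintro rfl; exact hqx hvq.symm
      have hax : a ≠ x := by rintro rfl; exact hpa hpx
      exact hxv (Na x hx (F1 hq hvq.symm ha hx hva (clq hp hv hx hvp.symm hpx hxv.symm) hqa hqx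
        hax))
    exact h.nbrs_ne hw hE hp d3 n3 hv hvp.symm fun t ht =>
      ⟨sub hp hq hvp hvq n2' n1' t ht, sub hq hp hvq hvp n1' n2' t ht⟩
  have loc : ∀ {x}, G.Adj v x → x ∈ nonNbr G w ∨ G.Adj w x := by
    intro x hvx
    by_cases hh : G.Adj w x
    · exact Or.inr hh
    · refine Or.inl ⟨?_, hh⟩
      rintro rfl
      exact hv.2 hvx.symm
  rcases loc hva with ha | ha <;> rcases loc hvb with hb | hb <;> rcases loc hvc with hc | hc
  · obtain ⟨p, hvp, hwp⟩ := hE'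
    obtain ⟨d1, d2, d3, n1, n2, n3⟩ := hI
    have a1 : ¬ (G.Adj p a ∧ G.Adj p b) := fun hh => n1 (clq hwp ha hb hh.1 hh.2 d1)
    have a2 : ¬ (G.Adj p a ∧ G.Adj p c) := fun hh => n2 (clq hwp ha hc hh.1 hh.2 d2)
    have a3 : ¬ (G.Adj p b ∧ G.Adj p c) := fun hh => n3 (clq hwp hb hc hh.1 hh.2 d3)
    have b1 := fun h1 h2 => n1 (F1 hwp hvp.symm ha hb hva hvb h1 h2 d1)
    have b2 := fun h1 h2 => n2 (F1 hwp hvp.symm ha hc hva hvc h1 h2 d2)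
    have b3 := fun h1 h2 => n3 (F1 hwp hvp.symm hb hc hvb hvc h1 h2 d3)
    clear * - a1 a2 a3 b1 b2 b3
    tauto
  · exact two ha hb hc hva hvb hvc hI
  · exact two hc ha hb hvc hva hvb hI.rot.rot
  · exact one ha hb hc hva hvb hvc hI
  · exact two hb hc ha hvb hvc hva hI.rot
  · exact one hb hc ha hvb hvc hva hI.rot
  · exact one hc ha hb hvc hva hvb hI.rot.rot
  · exact h.no_claw_at hw hE ha hb hc hI

/-- `G` contains an induced claw. -/
def HasClaw (G : SimpleGraph V) : Prop :=
  ∃ x a b c, G.Adj x a ∧ G.Adj x b ∧ G.Adj x c ∧ Indep G a b c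

theorem Indep.triangle_of_compl {a b c : V} (h : Indep Gᶜ a b c) :
    G.Adj a b ∧ G.Adj a c ∧ G.Adj b c := by
  obtain ⟨h1, h2, h3, h4, h5, h6⟩ := h
  simp only [compl_adj, not_and, not_not] at h4 h5 h6
  exact ⟨h4 h1, h5 h2, h6 h3⟩

theorem Basic.exists_special [Finite V] (h : Basic G) (hc : HasClaw Gᶜ) :
    ∃ w k₁ k₂ k₃, Special G w k₁ k₂ k₃ := by
  obtain ⟨x, a, b, c, xa, xb, xc, hI⟩ := hc
  obtain ⟨ab, ac, bc⟩ := hI.triangle_of_compl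
  have hS : ConnOn G {a, b, c} := by
    rintro S hS ⟨s, hs⟩ hcl
    have key : a ∈ S ∧ b ∈ S ∧ c ∈ S := by
      have ia : a ∈ S → b ∈ S ∧ c ∈ S := fun h =>
        ⟨hcl a h b (by simp) ab, hcl a h c (by simp) ac⟩
      rcases hS hs with rfl | rfl | rfl
      · exact ⟨hs, ia hs⟩
      · exact ⟨hcl _ hs a (by simp) ab.symm, ia (hcl _ hs a (by simp) ab.symm)⟩
      · exact ⟨hcl _ hs a (by simp) ac.symm, ia (hcl _ hs a (by simp) ac.symm)⟩
    refine hS.antisymm ?_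
    rintro t (rfl | rfl | rfl)
    exacts [key.1, key.2.1, key.2.2]
  have hu : ({a, b, c} : Set V) ⊆ nonNbr G x := by
    rintro t (rfl | rfl | rfl)
    exacts [⟨xa.1.symm, xa.2⟩, ⟨xb.1.symm, xb.2⟩, ⟨xc.1.symm, xc.2⟩]
  obtain ⟨w, hw, hsub⟩ := h.prime.exists_nonNbr_connOn ⟨a, by simp⟩ hS hu
  exact ⟨w, a, b, c, hw, hsub (by simp), hsub (by simp), hsub (by simp), ab, ac, bc⟩

theorem Special.adj_of_compl {v j₁ j₂ j₃ : V} (h : Special Gᶜ v j₁ j₂ j₃) :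
    G.Adj v j₁ ∧ G.Adj v j₂ ∧ G.Adj v j₃ ∧ Indep G j₁ j₂ j₃ := by
  have m : ∀ {j}, j ∈ nonNbr Gᶜ v → G.Adj v j := by
    rintro j ⟨h1, h2⟩
    by_contra h3
    exact h2 ⟨h1.symm, h3⟩
  exact ⟨m h.mem₁, m h.mem₂, m h.mem₃, h.adj₁₂.1, h.adj₁₃.1, h.adj₂₃.1, h.adj₁₂.2, h.adj₁₃.2,
    h.adj₂₃.2⟩

theorem Basic.exists_not_adj [Finite V] (h : Basic G) (hc : HasClaw G) {w k₁ k₂ k₃ : V}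
    (hw : Special G w k₁ k₂ k₃) :
    ∀ p, G.Adj w p → ∃ t ∈ nonNbr G w, ¬ G.Adj p t := by
  intro p hp
  by_contra hcon
  push Not at hcon
  obtain ⟨x, a, b, c, xa, xb, xc, hI⟩ := hc
  exact h.no_claw_of_complete hw hp hcon xa xb xc hI

theorem Basic.adj_of_special [Finite V] (h : Basic G) (hc : HasClaw G) (hc' : HasClaw Gᶜ)
    {w k₁ k₂ k₃ v j₁ j₂ j₃ : V} (hw : Special G w k₁ k₂ k₃) (hv : Special Gᶜ v j₁ j₂ j₃) :
    G.Adj w v := by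
  obtain ⟨v1, v2, v3, hI⟩ := hv.adj_of_compl
  by_contra hn
  by_cases hvw : v = w
  · subst hvw
    exact h.no_claw_at hw (h.exists_not_adj hc hw) v1 v2 v3 hI
  obtain ⟨t, ⟨htv, ht⟩, hwt⟩ := h.compl.exists_not_adj hc' hv w ⟨hvw, fun h => hn h.symm⟩
  simp only [compl_adj, not_and, not_not] at ht hwt
  have hvt := ht (Ne.symm htv)
  exact h.special_pair_false hw (h.exists_not_adj hc hw) ⟨hvw, hn⟩ v1 v2 v3 hI
    ⟨t, hvt, hwt (fun e => hn (e ▸ hvt.symm))⟩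

/-- A prime graph without chairs and kites does not contain both a claw and a co-claw. -/
theorem Basic.not_hasClaw [Finite V] (h : Basic G) (hc : HasClaw G) : ¬ HasClaw Gᶜ := by
  intro hc'
  obtain ⟨w, k₁, k₂, k₃, hw⟩ := h.exists_special hc'
  obtain ⟨v, j₁, j₂, j₃, hv⟩ := h.compl.exists_special ((compl_compl G).symm ▸ hc)
  have h1 := h.adj_of_special hc hc' hw hv
  have h2 := h.compl.adj_of_special hc' ((compl_compl G).symm ▸ hc) hv
    ((compl_compl G).symm ▸ hw)
  exact h2.2 h1.symm

/-- `k` colours suffice for the subgraph induced by `T`. -/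
def ColOn (G : SimpleGraph V) (T : Set V) (k : ℕ) : Prop :=
  ∃ f : V → ℕ, (∀ x ∈ T, f x < k) ∧ ∀ x ∈ T, ∀ y ∈ T, G.Adj x y → f x ≠ f y

/-- No triangle lies inside `T`. -/
def NoTri (G : SimpleGraph V) (T : Set V) : Prop :=
  ∀ a ∈ T, ∀ b ∈ T, ∀ c ∈ T, G.Adj a b → G.Adj a c → ¬ G.Adj b c

/-- No independent triple lies inside `T`. -/
def NoIndep (G : SimpleGraph V) (T : Set V) : Prop :=
  ∀ a ∈ T, ∀ b ∈ T, ∀ c ∈ T, ¬ Indep G a b c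

theorem ColOn.colorable {k : ℕ} (h : ColOn G Set.univ k) : G.Colorable k := by
  obtain ⟨f, hf, hf'⟩ := h
  exact ⟨Coloring.mk (fun x => (⟨f x, hf x trivial⟩ : Fin k)) fun {x y} hxy e =>
    hf' x trivial y trivial hxy (Fin.mk.inj e)⟩

theorem ColOn.mono {k l : ℕ} {S T : Set V} (h : ColOn G T k) (hST : S ⊆ T) (hkl : k ≤ l) :
    ColOn G S l := by
  obtain ⟨f, hf, hf'⟩ := h
  exact ⟨f, fun x hx => (hf x (hST hx)).trans_le hkl, fun x hx y hy => hf' x (hST hx) y (hST hy)⟩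

theorem ColOn.union {k l : ℕ} {S T : Set V} (hS : ColOn G S k) (hT : ColOn G T l) :
    ColOn G (S ∪ T) (k + l) := by
  classical
  obtain ⟨f, hf, hf'⟩ := hS
  obtain ⟨g, hg, hg'⟩ := hT
  refine ⟨fun x => if x ∈ S then f x else k + g x, ?_, ?_⟩
  · intro x hx
    by_cases h : x ∈ S
    · simpa [h] using (hf x h).trans_le (Nat.le_add_right _ _)
    · simpa [h] using hg x (hx.resolve_left h)
  · intro x hx y hy hxy
    by_cases h : x ∈ S <;> by_cases h' : y ∈ S
    · simpa [h, h'] using hf' x h y h' hxy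
    · have := hf x h
      simp only [h, h', if_true, if_false]
      omega
    · have := hf y h'
      simp only [h, h', if_true, if_false]
      omega
    · simpa [h, h'] using hg' x (hx.resolve_left h) y (hy.resolve_left h') hxy

theorem ColOn.of_indep {T : Set V} (h : ∀ x ∈ T, ∀ y ∈ T, ¬ G.Adj x y) : ColOn G T 1 :=
  ⟨fun _ => 0, by simp, fun x hx y hy hxy => (h x hx y hy hxy).elim⟩

theorem ColOn.insert {T : Set V} {k : ℕ} {v : V} (h : ColOn G T k) (hk : 0 < k)
    (hv : ∀ x ∈ T, ¬ G.Adj v x) : ColOn G (Insert.insert v T) k := by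
  classical
  obtain ⟨f, hf, hf'⟩ := h
  refine ⟨fun x => if x = v then 0 else f x, ?_, ?_⟩
  · rintro x hx
    by_cases h : x = v
    · simpa [h]
    · simpa [h] using hf x (hx.resolve_left h)
  · intro x hx y hy hxy
    rcases hx with rfl | hx <;> rcases hy with rfl | hy
    · exact (G.loopless.irrefl _ hxy).elim
    · exact (hv y hy hxy).elim
    · exact (hv x hx hxy.symm).elim
    · have h1 : x ≠ v := fun h => hv y hy (h ▸ hxy)
      have h2 : y ≠ v := fun h => hv x hx (h ▸ hxy.symm)
      simpa [h1, h2] using hf' x hx y hy hxy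

theorem NoTri.mono {S T : Set V} (h : NoTri G T) (hST : S ⊆ T) : NoTri G S :=
  fun a ha b hb c hc => h a (hST ha) b (hST hb) c (hST hc)

theorem ColOn.pair {x y : V} (h : ¬ G.Adj x y) : ColOn G {x, y} 1 :=
  .of_indep (by
    rintro a (rfl | rfl) b (rfl | rfl)
    exacts [G.loopless.irrefl _, h, fun h' => h h'.symm, G.loopless.irrefl _])

theorem NoTri.exists_not_adj {T : Finset V} (h : NoTri G T) (hT : 2 < T.card) :
    ∃ x ∈ T, ∃ y ∈ T, x ≠ y ∧ ¬ G.Adj x y := by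
  obtain ⟨a, ha, b, hb, c, hc, hab, hac, hbc⟩ := Finset.two_lt_card.1 hT
  by_contra! hcon
  exact h a ha b hb c hc (hcon a ha b hb hab) (hcon a ha c hc hac) (hcon b hb c hc hbc)

section

variable [DecidableEq V]

theorem ColOn.of_card (T : Finset V) : ColOn G T T.card := by
  induction T using Finset.induction_on with
  | empty => exact ⟨fun _ => 0, by simp, by simp⟩
  | insert a s ha ih =>
    have := ColOn.union ih (ColOn.of_indep (G := G) (T := {a})
      (by rintro x rfl y rfl; exact G.loopless.irrefl _))
    rw [Finset.card_insert_of_notMem ha]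
    refine this.mono ?_ le_rfl
    simp

theorem ColOn.of_sdiff_pair {T : Finset V} {x y : V} {k : ℕ} (h : ¬ G.Adj x y)
    (hT : ColOn G (T \ {x, y} : Finset V) k) : ColOn G T (k + 1) :=
  (hT.union (ColOn.pair h)).mono (by intro z; simp; tauto) le_rfl

theorem card_sdiff_pair {T : Finset V} {x y : V} (hx : x ∈ T) (hy : y ∈ T) (hxy : x ≠ y) :
    (T \ {x, y}).card + 2 = T.card := by
  rw [← Finset.card_pair hxy]
  exact Finset.card_sdiff_add_card_eq_card (by simp [Finset.insert_subset_iff, hx, hy])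

theorem NoTri.colOn {k : ℕ} (hk : 0 < k) {T : Finset V} (h : NoTri G T)
    (hT : T.card + 1 ≤ 2 * k) : ColOn G T k := by
  induction k, hk using Nat.le_induction generalizing T with
  | base => exact (ColOn.of_card T).mono subset_rfl (by omega)
  | succ k hk ih =>
    rcases Nat.lt_or_ge 2 T.card with h2 | h2
    · obtain ⟨x, hx, y, hy, hxy, hn⟩ := h.exists_not_adj h2
      refine ColOn.of_sdiff_pair hn (ih (h.mono ?_) ?_)
      · simp
      · have := card_sdiff_pair hx hy hxy
        omega
    · exact (ColOn.of_card T).mono subset_rfl (by omega)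

theorem NoTri.colOn_two {T : Finset V} (h : NoTri G T) (hT : T.card ≤ 4) : ColOn G T 2 := by
  rcases Nat.lt_or_ge T.card 4 with h4 | h4
  · exact h.colOn (by norm_num) (by omega)
  obtain ⟨x, hx, y, hy, hxy, hn⟩ := h.exists_not_adj (by omega)
  have hc := card_sdiff_pair hx hy hxy
  obtain ⟨z, w, hzw, hzw'⟩ := Finset.card_eq_two.1 (show (T \ {x, y}).card = 2 by omega)
  have hz : z ∈ T := (Finset.mem_sdiff.1 (hzw'.symm ▸ Finset.mem_insert_self z {w} : z ∈ T \ {x, y})).1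
  have hw : w ∈ T := (Finset.mem_sdiff.1 (hzw'.symm ▸ by simp : w ∈ T \ {x, y})).1
  have hsub : ∀ t ∈ T, t = x ∨ t = y ∨ t = z ∨ t = w := by
    intro t ht
    by_contra! hcon
    have : t ∈ T \ {x, y} := by simp [ht, hcon.1, hcon.2.1]
    rw [hzw'] at this
    simp [hcon.2.2.1, hcon.2.2.2] at this
  have build : ∀ {A B : Set V}, ColOn G A 1 → ColOn G B 1 →
      (∀ t, t = x ∨ t = y ∨ t = z ∨ t = w → t ∈ A ∪ B) → ColOn G T 2 := fun hA hB hAB =>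
    (hA.union hB).mono (fun t ht => hAB t (hsub t ht)) le_rfl
  have pr : ∀ {a b c d : V}, ¬ G.Adj a b → ¬ G.Adj c d →
      (∀ t, t = x ∨ t = y ∨ t = z ∨ t = w → t = a ∨ t = b ∨ t = c ∨ t = d) → ColOn G T 2 := by
    intro a b c d hab hcd hh
    refine build (ColOn.pair hab) (ColOn.pair hcd) fun t ht => ?_
    have := hh t ht
    simp only [Set.mem_union, Set.mem_insert_iff, Set.mem_singleton_iff]
    tauto
  have tr : ∀ {a b c d : V}, ¬ G.Adj a b → ¬ G.Adj a c → ¬ G.Adj b c →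
      (∀ t, t = x ∨ t = y ∨ t = z ∨ t = w → t = a ∨ t = b ∨ t = c ∨ t = d) → ColOn G T 2 := by
    intro a b c d hab hac hbc hh
    refine build (A := {a, b, c}) (B := {d, d}) (ColOn.of_indep ?_)
      (ColOn.pair (G.loopless.irrefl _)) fun t ht => ?_
    · rintro s (rfl | rfl | rfl) t (rfl | rfl | rfl) <;>
        first | exact G.loopless.irrefl _ | assumption | (intro h; exact absurd h.symm ‹_›)
    · have := hh t ht
      simp only [Set.mem_union, Set.mem_insert_iff, Set.mem_singleton_iff]
      tauto
  by_cases h1 : G.Adj z w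
  · have hx' : ¬ (G.Adj x z ∧ G.Adj x w) := fun h' => h x hx z hz w hw h'.1 h'.2 h1
    have hy' : ¬ (G.Adj y z ∧ G.Adj y w) := fun h' => h y hy z hz w hw h'.1 h'.2 h1
    by_cases xz : G.Adj x z
    · have xw : ¬ G.Adj x w := fun h' => hx' ⟨xz, h'⟩
      by_cases yz : G.Adj y z
      · exact tr hn xw (fun h' => hy' ⟨yz, h'⟩) (d := z) (by tauto)
      · exact pr xw yz (by tauto)
    · by_cases yw : G.Adj y w
      · have yz : ¬ G.Adj y z := fun h' => hy' ⟨h', yw⟩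
        exact tr hn xz yz (d := w) (by tauto)
      · exact pr xz yw (by tauto)
  · exact pr hn h1 (by tauto)

theorem card_le_five {T : Finset V} (h : NoTri G T) (h' : NoIndep G T) : T.card ≤ 5 := by
  classical
  by_contra! hT
  obtain ⟨v, hv⟩ : T.Nonempty := Finset.card_pos.1 (by omega)
  have h1 := Finset.card_erase_of_mem hv
  have h2 := Finset.card_filter_add_card_filter_not (s := T.erase v) (fun x => G.Adj v x)
  rcases Nat.lt_or_ge 2 ((T.erase v).filter (fun x => G.Adj v x)).card with h3 | h3
  · obtain ⟨a, ha, b, hb, c, hc, hab, hac, hbc⟩ := Finset.two_lt_card.1 h3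
    simp only [Finset.mem_filter, Finset.mem_erase] at ha hb hc
    exact h' a ha.1.2 b hb.1.2 c hc.1.2 ⟨hab, hac, hbc, h v hv a ha.1.2 b hb.1.2 ha.2 hb.2,
      h v hv a ha.1.2 c hc.1.2 ha.2 hc.2, h v hv b hb.1.2 c hc.1.2 hb.2 hc.2⟩
  · obtain ⟨a, ha, b, hb, c, hc, hab, hac, hbc⟩ := Finset.two_lt_card.1
      (show 2 < ((T.erase v).filter (fun x => ¬ G.Adj v x)).card by omega)
    simp only [Finset.mem_filter, Finset.mem_erase] at ha hb hc
    have key : ∀ {a b}, a ≠ v → b ≠ v → a ∈ T → b ∈ T → ¬ G.Adj v a → ¬ G.Adj v b → a ≠ b →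
        G.Adj a b := by
      intro a b ha hb haT hbT hva hvb hab
      by_contra hn
      exact h' v hv a haT b hbT ⟨ha.symm, hb.symm, hab, hva, hvb, hn⟩
    exact h a ha.1.2 b hb.1.2 c hc.1.2 (key ha.1.1 hb.1.1 ha.1.2 hb.1.2 ha.2 hb.2 hab)
      (key ha.1.1 hc.1.1 ha.1.2 hc.1.2 ha.2 hc.2 hac) (key hb.1.1 hc.1.1 hb.1.2 hc.1.2 hb.2 hc.2 hbc)

end

/-- The bound of Reed's conjecture, witnessed by the degree of a vertex and a clique. -/
def Reed (G : SimpleGraph V) : Prop :=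
  ∃ (v : V) (K : Finset V), G.IsClique K ∧
    G.Colorable (((G.neighborSet v).ncard + K.card + 2) / 2)

theorem not_hasClaw_of_iso {W : Type*} {H : SimpleGraph W} (f : G ≃g H) (h : ¬ HasClaw H) :
    ¬ HasClaw G := by
  rintro ⟨x, a, b, c, xa, xb, xc, h1, h2, h3, h4, h5, h6⟩
  exact h ⟨f x, f a, f b, f c, f.map_adj_iff.2 xa, f.map_adj_iff.2 xb, f.map_adj_iff.2 xc,
    f.injective.ne h1, f.injective.ne h2, f.injective.ne h3, mt f.map_adj_iff.1 h4,
    mt f.map_adj_iff.1 h5, mt f.map_adj_iff.1 h6⟩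

theorem no_coclaw (h : ¬ HasClaw Gᶜ) {x a b c : V} (hxa : x ≠ a) (hxb : x ≠ b)
    (hxc : x ≠ c) (ab : G.Adj a b) (ac : G.Adj a c) (bc : G.Adj b c) :
    G.Adj x a ∨ G.Adj x b ∨ G.Adj x c := by
  by_contra! hcon
  exact h ⟨x, a, b, c, ⟨hxa, hcon.1⟩, ⟨hxb, hcon.2.1⟩, ⟨hxc, hcon.2.2⟩, ab.ne, ac.ne, bc.ne,
    fun h => h.2 ab, fun h => h.2 ac, fun h => h.2 bc⟩

theorem no_claw (h : ¬ HasClaw G) {x a b c : V} (xa : G.Adj x a) (xb : G.Adj x b)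
    (xc : G.Adj x c) : ¬ Indep G a b c := fun hI => h ⟨x, a, b, c, xa, xb, xc, hI⟩

/-- A graph without claws and co-claws has no disjoint `K₄` and independent set of size four. -/
theorem not_disjoint_clique_indep [DecidableEq V] (hc : ¬ HasClaw G) (hc' : ¬ HasClaw Gᶜ)
    {K S : Finset V} (hKS : Disjoint K S) (hK : G.IsClique K) (hS : Gᶜ.IsClique S)
    (hK4 : K.card = 4) (hS4 : S.card = 4) : False := by
  classical
  have ne : ∀ {k s}, k ∈ K → s ∈ S → k ≠ s := fun hk hs e =>
    Finset.disjoint_left.1 hKS hk (e ▸ hs)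
  have hrow : ∀ k ∈ K, (S.filter (G.Adj k)).card ≤ 2 := by
    intro k hk
    by_contra! h
    obtain ⟨a, ha, b, hb, c, hc1, hab, hac, hbc⟩ := Finset.two_lt_card.1 h
    simp only [Finset.mem_filter] at ha hb hc1
    exact no_claw hc ha.2 hb.2 hc1.2 ⟨hab, hac, hbc, (hS ha.1 hb.1 hab).2, (hS ha.1 hc1.1 hac).2,
      (hS hb.1 hc1.1 hbc).2⟩
  have hcol : ∀ s ∈ S, 2 ≤ (K.filter (fun k => G.Adj k s)).card := by
    intro s hs
    by_contra! h
    have h2 := Finset.card_filter_add_card_filter_not (s := K) (fun k => G.Adj k s)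
    obtain ⟨a, ha, b, hb, c, hc1, hab, hac, hbc⟩ := Finset.two_lt_card.1
      (show 2 < (K.filter (fun k => ¬ G.Adj k s)).card by omega)
    simp only [Finset.mem_filter] at ha hb hc1
    rcases no_coclaw hc' (ne ha.1 hs).symm (ne hb.1 hs).symm (ne hc1.1 hs).symm
      (hK ha.1 hb.1 hab) (hK ha.1 hc1.1 hac) (hK hb.1 hc1.1 hbc) with h | h | h
    exacts [ha.2 h.symm, hb.2 h.symm, hc1.2 h.symm]
  obtain ⟨k₁, hk₁, h1⟩ : ∃ k ∈ K, 2 ≤ (S.filter (G.Adj k)).card := by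
    by_contra! h
    have := Finset.card_mul_le_card_mul' (s := K) (t := S) G.Adj (n := 2) (m := 1) hcol
      (fun k hk => Nat.le_of_lt_succ (h k hk))
    omega
  have h2 : (S.filter (G.Adj k₁)).card = 2 := le_antisymm (hrow k₁ hk₁) h1
  obtain ⟨s₁, s₂, hs, hs'⟩ := Finset.card_eq_two.1 h2
  have hs₁ : s₁ ∈ S ∧ G.Adj k₁ s₁ := Finset.mem_filter.1 (hs'.symm ▸ by simp)
  have hs₂ : s₂ ∈ S ∧ G.Adj k₁ s₂ := Finset.mem_filter.1 (hs'.symm ▸ by simp)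
  have hM := Finset.card_filter_add_card_filter_not (s := S) (G.Adj k₁)
  have hK' := Finset.card_erase_of_mem hk₁
  have := Finset.card_mul_le_card_mul' (s := K.erase k₁) (t := S.filter (fun s => ¬ G.Adj k₁ s))
    G.Adj (n := 2) (m := 1) ?_ ?_
  · omega
  · intro s hs
    rw [Finset.mem_filter] at hs
    refine (hcol s hs.1).trans (Finset.card_le_card ?_)
    intro k hk
    simp only [Finset.mem_filter, Finset.mem_bipartiteBelow, Finset.mem_erase] at hk ⊢
    exact ⟨⟨fun e => hs.2 (e ▸ hk.2), hk.1⟩, hk.2⟩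
  · intro k hk
    rw [Finset.mem_erase] at hk
    have hkk := hK hk₁ hk.2 hk.1.symm
    have hor : G.Adj k s₁ ∨ G.Adj k s₂ := by
      by_contra! h
      exact no_claw hc hs₁.2 hs₂.2 hkk ⟨hs, (ne hk.2 hs₁.1).symm, (ne hk.2 hs₂.1).symm,
        (hS hs₁.1 hs₂.1 hs).2, fun h' => h.1 h'.symm, fun h' => h.2 h'.symm⟩
    have h3 : ((S.filter (fun s => ¬ G.Adj k₁ s)).bipartiteAbove G.Adj k).card
        < (S.filter (G.Adj k)).card := by
      refine Finset.card_lt_card (Finset.ssubset_iff_subset_ne.2 ⟨?_, ?_⟩)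
      · intro s hs
        simp only [Finset.mem_filter, Finset.mem_bipartiteAbove] at hs ⊢
        exact ⟨hs.1.1, hs.2⟩
      · intro e
        rcases hor with h | h
        · have : s₁ ∈ S.filter (G.Adj k) := Finset.mem_filter.2 ⟨hs₁.1, h⟩
          rw [← e, Finset.mem_bipartiteAbove, Finset.mem_filter] at this
          exact this.1.2 hs₁.2
        · have : s₂ ∈ S.filter (G.Adj k) := Finset.mem_filter.2 ⟨hs₂.1, h⟩
          rw [← e, Finset.mem_bipartiteAbove, Finset.mem_filter] at this
          exact this.1.2 hs₂.2
    have := hrow k hk.2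
    omega

/-- A graph without claws and co-claws has no `K₄` meeting an independent set of size four. -/
theorem not_mem_clique_indep [DecidableEq V] (hc : ¬ HasClaw G) (hc' : ¬ HasClaw Gᶜ)
    {K S : Finset V} {x : V} (hxK : x ∈ K) (hxS : x ∈ S) (hK : G.IsClique K)
    (hS : Gᶜ.IsClique S) (hK4 : K.card = 4) (hS4 : S.card = 4) : False := by
  classical
  have h1 := Finset.card_erase_of_mem hxK
  have h2 := Finset.card_erase_of_mem hxS
  have := Finset.card_mul_le_card_mul' (s := K.erase x) (t := S.erase x)
    G.Adj (n := 2) (m := 1) ?_ ?_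
  · omega
  · intro s hs
    rw [Finset.mem_erase] at hs
    have hxs := hS hxS hs.2 hs.1.symm
    by_contra! h
    have h2 := Finset.card_filter_add_card_filter_not (s := K.erase x) (fun k => G.Adj k s)
    have h3 : ((K.erase x).filter (fun k => G.Adj k s)).card < 2 := h
    obtain ⟨a, ha, b, hb, hab⟩ := Finset.one_lt_card.1
      (show 1 < ((K.erase x).filter (fun k => ¬ G.Adj k s)).card by omega)
    simp only [Finset.mem_filter, Finset.mem_erase] at ha hb
    have xa := hK hxK ha.1.2 ha.1.1.symm
    have xb := hK hxK hb.1.2 hb.1.1.symm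
    rcases no_coclaw hc' hs.1 (fun e => hxs.2 (e ▸ xa)) (fun e => hxs.2 (e ▸ xb)) xa xb
      (hK ha.1.2 hb.1.2 hab) with h | h | h
    exacts [hxs.2 h.symm, ha.2 h.symm, hb.2 h.symm]
  · intro k hk
    rw [Finset.mem_erase] at hk
    have hkx := hK hk.2 hxK hk.1
    by_contra! h
    obtain ⟨a, ha, b, hb, hab⟩ := Finset.one_lt_card.1 h
    simp only [Finset.mem_bipartiteAbove, Finset.mem_erase] at ha hb
    exact no_claw hc hkx ha.2 hb.2 ⟨ha.1.1.symm, hb.1.1.symm, hab, (hS hxS ha.1.2 ha.1.1.symm).2,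
      (hS hxS hb.1.2 hb.1.1.symm).2, (hS ha.1.2 hb.1.2 hab).2⟩

theorem IsClique.map_iso {W : Type*} {H : SimpleGraph W} (f : G ≃g H) {K : Finset V}
    (hK : G.IsClique K) : H.IsClique (K.map f.toEquiv.toEmbedding : Finset W) := by
  intro x hx y hy hxy
  simp only [Finset.coe_map, Set.mem_image] at hx hy
  obtain ⟨a, ha, rfl⟩ := hx
  obtain ⟨b, hb, rfl⟩ := hy
  exact f.map_adj_iff.2 (hK ha hb fun e => hxy (e ▸ rfl))

theorem no_four_clique [DecidableEq V] (σ : G ≃g Gᶜ) (hc : ¬ HasClaw G) {K : Finset V}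
    (hK : G.IsClique K) : K.card ≠ 4 := by
  intro hK4
  have hc' : ¬ HasClaw Gᶜ := not_hasClaw_of_iso σ.symm hc
  have hS := IsClique.map_iso σ hK
  have hS4 : (K.map σ.toEquiv.toEmbedding).card = 4 := by simpa
  by_cases h : Disjoint K (K.map σ.toEquiv.toEmbedding)
  · exact not_disjoint_clique_indep hc hc' h hK hS hK4 hS4
  · obtain ⟨x, hx, hx'⟩ := Finset.not_disjoint_iff.1 h
    exact not_mem_clique_indep hc hc' hx hx' hK hS hK4 hS4

theorem noTri_neighborSet [DecidableEq V] (h4 : ∀ K : Finset V, G.IsClique K → K.card ≠ 4)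
    (v : V) : NoTri G (G.neighborSet v) := by
  intro a ha b hb c hc ab ac bc
  have va : G.Adj v a := ha
  have vb : G.Adj v b := hb
  have vc : G.Adj v c := hc
  refine h4 {v, a, b, c} ?_ ?_
  · simp only [Finset.coe_insert, Finset.coe_singleton, isClique_insert]
    simp [va, vb, vc, ab, ac, bc]
  · rw [Finset.card_insert_of_notMem (by simp [va.ne, vb.ne, vc.ne]),
      Finset.card_insert_of_notMem (by simp [ab.ne, ac.ne]), Finset.card_pair bc.ne]

theorem noIndep_neighborSet (hc : ¬ HasClaw G) (v : V) : NoIndep G (G.neighborSet v) :=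
  fun _ ha _ hb _ hc' hI => no_claw hc ha hb hc' hI

theorem noTri_neighborSet_compl (hc : ¬ HasClaw Gᶜ) (v : V) : NoTri G (Gᶜ.neighborSet v) := by
  intro a ha b hb c hc' ab ac bc
  rcases no_coclaw hc ha.1 hb.1 hc'.1 ab ac bc with h | h | h
  exacts [ha.2 h, hb.2 h, hc'.2 h]

theorem four_dvd_of_iso [Fintype V] (σ : G ≃g Gᶜ) :
    4 ∣ Fintype.card V * (Fintype.card V - 1) := by
  classical
  have h1 := G.sum_degrees_eq_twice_card_edges
  have h2 := Gᶜ.sum_degrees_eq_twice_card_edges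
  have h3 : G.edgeFinset.card = Gᶜ.edgeFinset.card := σ.card_edgeFinset_eq
  have h4 : ∑ v, (G.degree v + Gᶜ.degree v) = ∑ _v : V, (Fintype.card V - 1) := by
    refine Finset.sum_congr rfl fun v _ => ?_
    have := G.degree_lt_card_verts v
    rw [degree_compl]
    omega
  rw [Finset.sum_add_distrib, h1, h2, Finset.sum_const, Finset.card_univ, smul_eq_mul] at h4
  exact ⟨G.edgeFinset.card, by omega⟩

theorem colorable_of_neighborhoods {v : V} {k l : ℕ} (h1 : ColOn G (G.neighborSet v) k)
    (h2 : ColOn G (Gᶜ.neighborSet v) l) (hl : 0 < l) : G.Colorable (k + l) := by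
  refine ColOn.colorable ((h1.union (h2.insert hl (v := v) fun x hx => hx.2)).mono ?_ le_rfl)
  intro x _
  by_cases h : G.Adj v x
  · exact Or.inl h
  · by_cases h' : x = v
    · exact Or.inr (Or.inl h')
    · exact Or.inr (Or.inr ⟨Ne.symm h', h⟩)

theorem Iso.degree_add [Fintype V] [DecidableEq V] [DecidableRel G.Adj] (σ : G ≃g Gᶜ) (v : V) :
    G.degree (σ v) + G.degree v + 1 = Fintype.card V := by
  have h1 : Gᶜ.degree (σ v) = G.degree v := by
    convert σ.degree_eq v
  rw [degree_compl] at h1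
  have := G.degree_lt_card_verts (σ v)
  have := G.degree_lt_card_verts v
  omega

theorem Reed.of_degree [Fintype V] [DecidableRel G.Adj] {v : V} {K : Finset V} {d k m : ℕ}
    (hK : G.IsClique K) (hd : d ≤ G.degree v) (hk : K.card = k) (h : G.Colorable m)
    (hm : m ≤ (d + k + 2) / 2) : Reed G := by
  refine ⟨v, K, hK, h.mono (hm.trans (Nat.div_le_div_right ?_))⟩
  have : (G.neighborSet v).ncard = G.degree v := by
    rw [Set.ncard_eq_toFinset_card']; rfl
  omega

theorem Reed.of_not_hasClaw [Finite V] [Nonempty V] (σ : G ≃g Gᶜ) (hc : ¬ HasClaw G) :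
    Reed G := by
  classical
  have := Fintype.ofFinite V
  have hc' : ¬ HasClaw Gᶜ := not_hasClaw_of_iso σ.symm hc
  have h4 : ∀ K : Finset V, G.IsClique K → K.card ≠ 4 := fun K hK => no_four_clique σ hc hK
  have h4' : ∀ K : Finset V, Gᶜ.IsClique K → K.card ≠ 4 := fun K hK =>
    no_four_clique ((compl_compl G).symm ▸ σ.symm : Gᶜ ≃g Gᶜᶜ) hc' hK
  have hN : ∀ v, G.degree v ≤ 5 := fun v =>
    card_le_five (G := G) (by simpa using noTri_neighborSet h4 v)
      (by simpa using noIndep_neighborSet hc v)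
  have hR : ∀ v, Gᶜ.degree v ≤ 5 := fun v =>
    card_le_five (G := Gᶜ) (by simpa using noTri_neighborSet h4' v)
      (by simpa using noIndep_neighborSet hc' v)
  have hdeg := Iso.degree_add σ
  have hdeg' : ∀ v, Gᶜ.degree v + G.degree v + 1 = Fintype.card V := by
    intro v
    have := G.degree_lt_card_verts v
    rw [degree_compl]
    omega
  have hdvd := four_dvd_of_iso σ
  obtain ⟨v₀⟩ := ‹Nonempty V›
  have hcard : Fintype.card V ≤ 11 := by
    have := hN v₀
    have := hR v₀
    have := hdeg' v₀
    omega
  have hbig : ∀ d, 2 * d ≤ Fintype.card V → ∃ v, d ≤ G.degree v := by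
    intro d hd
    by_cases h : d ≤ G.degree v₀
    · exact ⟨v₀, h⟩
    · exact ⟨σ v₀, by have := hdeg v₀; omega⟩
  have hpair : ∀ {u w}, G.Adj u w → ∃ x y, x ≠ y ∧ ¬ G.Adj x y := fun {u w} h =>
    ⟨σ u, σ w, (σ.map_adj_iff.2 h).1, (σ.map_adj_iff.2 h).2⟩
  have hind : ∀ {a b c}, G.Adj a b → G.Adj a c → G.Adj b c → ∃ x y z, Indep G x y z :=
    fun {a b c} h1 h2 h3 => ⟨σ a, σ b, σ c, (σ.map_adj_iff.2 h1).1, (σ.map_adj_iff.2 h2).1,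
      (σ.map_adj_iff.2 h3).1, (σ.map_adj_iff.2 h1).2, (σ.map_adj_iff.2 h2).2,
      (σ.map_adj_iff.2 h3).2⟩
  have hedge : 4 ≤ Fintype.card V → ∃ v u w, 2 ≤ G.degree v ∧ G.Adj u w := by
    intro h
    obtain ⟨v, hv⟩ := hbig 2 (by omega)
    obtain ⟨w, hw⟩ := (G.degree_pos_iff_exists_adj v).1 (by omega)
    exact ⟨v, v, w, hv, hw⟩
  have clq : ∀ {u w}, G.Adj u w → G.IsClique ({u, w} : Finset V) := by
    intro u w h
    rw [Finset.coe_pair, isClique_pair]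
    exact fun _ => h
  have hcases : Fintype.card V = 1 ∨ Fintype.card V = 4 ∨ Fintype.card V = 5 ∨
      Fintype.card V = 8 ∨ Fintype.card V = 9 := by
    have : 0 < Fintype.card V := Fintype.card_pos_iff.2 ⟨v₀⟩
    clear * - hdvd hcard this
    interval_cases Fintype.card V <;> simp_all
  have cu := ColOn.of_card (G := G) Finset.univ
  rcases hcases with h | h | h | h
  · rw [Finset.coe_univ, Finset.card_univ, h] at cu
    exact Reed.of_degree (v := v₀) (K := {v₀}) (d := 0) (k := 1) (by simp) (Nat.zero_le _)
      (by simp) cu.colorable le_rfl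
  · obtain ⟨v, u, w, hv, huw⟩ := hedge (by omega)
    obtain ⟨x, y, hxy, hn⟩ := hpair huw
    have h2 := card_sdiff_pair (Finset.mem_univ x) (Finset.mem_univ y) hxy
    have := ColOn.of_sdiff_pair (k := 2) hn
      ((ColOn.of_card (G := G) (Finset.univ \ {x, y})).mono subset_rfl (by
        rw [Finset.card_univ] at h2; omega))
    rw [Finset.coe_univ] at this
    exact Reed.of_degree (clq huw) hv (Finset.card_pair huw.ne) this.colorable le_rfl
  · obtain ⟨v, u, w, hv, huw⟩ := hedge (by omega)
    have : ColOn G Set.univ 3 := by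
      by_cases ht : NoTri G (Set.univ : Set V)
      · rw [← Finset.coe_univ] at ht ⊢
        exact ht.colOn (by norm_num) (by rw [Finset.card_univ]; omega)
      · unfold NoTri at ht
        push Not at ht
        obtain ⟨a, -, b, -, c, -, ab, ac, bc⟩ := ht
        obtain ⟨x, y, z, d1, d2, d3, n1, n2, n3⟩ := hind ab ac bc
        have h3 : (Finset.univ \ {x, y, z} : Finset V).card + 3 = 5 := by
          have := Finset.card_sdiff_add_card_eq_card (Finset.subset_univ ({x, y, z} : Finset V))
          rwa [Finset.card_univ, h, Finset.card_insert_of_notMem (by simp [d1, d2]),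
            Finset.card_pair d3] at this
        have c1 : ColOn G ({x, y, z} : Set V) 1 := by
          refine ColOn.of_indep ?_
          rintro s (rfl | rfl | rfl) t (rfl | rfl | rfl) <;>
            first | exact G.loopless.irrefl _ | assumption | (intro h; exact absurd h.symm ‹_›)
        refine ((ColOn.of_card (G := G) (Finset.univ \ {x, y, z})).union c1).mono ?_ (by omega)
        intro t _
        simp only [Finset.coe_sdiff, Finset.coe_univ, Finset.coe_insert, Finset.coe_singleton,
          Set.mem_union, Set.mem_sdiff, Set.mem_univ, true_and]
        exact (em _).symm
    exact Reed.of_degree (clq huw) hv (Finset.card_pair huw.ne) this.colorable le_rfl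
  · obtain ⟨v, hv⟩ := hbig 4 (by omega)
    have hv5 := hN v
    have hRv := hdeg' v
    obtain ⟨a, b, c, ab, ac, bc⟩ : ∃ a b c, G.Adj a b ∧ G.Adj a c ∧ G.Adj b c := by
      by_contra! hcon
      have := card_le_five (G := G) (T := Finset.univ) (fun a _ b _ c _ => hcon a b c) ?_
      · rw [Finset.card_univ] at this
        omega
      · rintro a - b - c - ⟨d1, d2, d3, n1, n2, n3⟩
        have e : ∀ {x y}, x ≠ y → ¬ G.Adj x y → G.Adj (σ.symm x) (σ.symm y) := fun h h' =>
          σ.symm.map_adj_iff.2 ⟨h, h'⟩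
        exact hcon _ _ _ (e d1 n1) (e d2 n2) (e d3 n3)
    have hK : G.IsClique ({a, b, c} : Finset V) := by
      simp only [Finset.coe_insert, Finset.coe_singleton, isClique_insert]
      simp [ab, ac, bc]
    have hK3 : ({a, b, c} : Finset V).card = 3 := by
      rw [Finset.card_insert_of_notMem (by simp [ab.ne, ac.ne]), Finset.card_pair bc.ne]
    have tN : NoTri G (G.neighborFinset v : Finset V) := by
      simpa using noTri_neighborSet h4 v
    have tR : NoTri G (Gᶜ.neighborFinset v : Finset V) := by
      simpa using noTri_neighborSet_compl hc' v
    have cR : ColOn G (Gᶜ.neighborSet v) 2 := by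
      have := tR.colOn_two (by rw [card_neighborFinset_eq_degree]; omega)
      simpa using this
    rcases Nat.lt_or_ge 4 (G.degree v) with h5 | h5
    · have cN : ColOn G (G.neighborSet v) 3 := by
        have := tN.colOn (k := 3) (by norm_num) (by rw [card_neighborFinset_eq_degree]; omega)
        simpa using this
      exact Reed.of_degree hK h5 hK3 (colorable_of_neighborhoods cN cR (by norm_num)) le_rfl
    · have cN : ColOn G (G.neighborSet v) 2 := by
        have := tN.colOn_two (by rw [card_neighborFinset_eq_degree]; omega)
        simpa using this
      exact Reed.of_degree hK hv hK3 (colorable_of_neighborhoods cN cR (by norm_num)) le_rfl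

/-- Every nontrivial cut of `G` contains an edge. -/
def Linked (G : SimpleGraph V) : Prop :=
  ∀ S : Set V, S.Nonempty → S ≠ Set.univ → ∃ x ∈ S, ∃ y ∉ S, G.Adj x y

theorem linked_of_iso (σ : G ≃g Gᶜ) : Linked G := by
  intro S hS hS'
  by_contra! hcon
  obtain ⟨s, hs⟩ := hS
  obtain ⟨u, hu⟩ := (Set.ne_univ_iff_exists_notMem S).1 hS'
  have key : ∀ x ∈ S, ∀ y ∉ S, (σ.symm x ∈ S ↔ σ.symm y ∈ S) := by
    intro x hx y hy
    have hadj : G.Adj (σ.symm x) (σ.symm y) :=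
      σ.symm.map_adj_iff.2 ⟨fun e => hy (e ▸ hx), hcon x hx y hy⟩
    refine ⟨fun h => ?_, fun h => ?_⟩
    · by_contra h'
      exact hcon _ h _ h' hadj
    · by_contra h'
      exact hcon _ h _ h' hadj.symm
  have all : ∀ x, σ.symm x ∈ S ↔ σ.symm s ∈ S := by
    intro x
    by_cases hx : x ∈ S
    · rw [key x hx u hu, key s hs u hu]
    · rw [key s hs x hx]
  have h1 := all (σ s)
  have h2 := all (σ u)
  simp only [RelIso.symm_apply_apply] at h1 h2
  exact hu (h2.2 (h1.1 hs))

theorem linked_compl_of_iso (σ : G ≃g Gᶜ) : Linked Gᶜ :=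
  linked_of_iso ((compl_compl G).symm ▸ σ.symm : Gᶜ ≃g Gᶜᶜ)

/-- The vertex `q` is not an end of an induced path on four vertices. -/
def NotEnd (G : SimpleGraph V) (q : V) : Prop :=
  ∀ b c d, G.Adj q b → G.Adj b c → G.Adj c d → ¬ G.Adj q c → ¬ G.Adj q d → ¬ G.Adj b d →
    q ≠ c → False

/-- The vertices `a`, `b`, `c`, `d` form, in this order, an induced path, and every further
vertex is fixed by `σ`, adjacent to `b` and `c`, and not adjacent to `a` and `d`. -/
structure PathLike (σ : G ≃g Gᶜ) (a b c d : V) : Prop where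
  ab : G.Adj a b
  bc : G.Adj b c
  cd : G.Adj c d
  ac : ¬ G.Adj a c
  ad : ¬ G.Adj a d
  bd : ¬ G.Adj b d
  ne : a ≠ d
  rest : ∀ t, t = a ∨ t = b ∨ t = c ∨ t = d ∨
    (G.Adj t b ∧ G.Adj t c ∧ ¬ G.Adj t a ∧ ¬ G.Adj t d ∧ σ t = t)

theorem pathLike_of_bull (σ : G ≃g Gᶜ) {a b c d e : V} (ab : G.Adj a b) (bc : G.Adj b c)
    (cd : G.Adj c d) (ac : ¬ G.Adj a c) (ad : ¬ G.Adj a d) (bd : ¬ G.Adj b d) (ne : a ≠ d)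
    (eb : G.Adj e b) (ec : G.Adj e c) (ea : ¬ G.Adj e a) (ed : ¬ G.Adj e d)
    (hall : ∀ t, t = a ∨ t = b ∨ t = c ∨ t = d ∨ t = e) : PathLike σ a b c d := by
  refine ⟨ab, bc, cd, ac, ad, bd, ne, fun t => ?_⟩
  have up : ∀ {x y}, x ≠ y → ¬ G.Adj x y → G.Adj (σ x) (σ y) := by
    intro x y hxy h
    by_contra h'
    exact h (σ.map_adj_iff.1 ⟨σ.injective.ne hxy, h'⟩)
  have down : ∀ {x y}, G.Adj x y → σ y ≠ σ x ∧ ¬ G.Adj (σ x) (σ y) := fun h =>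
    ⟨(σ.map_adj_iff.2 h).1.symm, (σ.map_adj_iff.2 h).2⟩
  have hea : e ≠ a := fun h => ac (h ▸ ec)
  have hed : e ≠ d := fun h => bd (h ▸ eb).symm
  have na : ∀ t, G.Adj a t → t = b := by
    intro t ht
    rcases hall t with rfl | rfl | rfl | rfl | rfl
    exacts [(G.loopless.irrefl _ ht).elim, rfl, (ac ht).elim, (ad ht).elim, (ea ht.symm).elim]
  have nd : ∀ t, G.Adj d t → t = c := by
    intro t ht
    rcases hall t with rfl | rfl | rfl | rfl | rfl
    exacts [(ad ht.symm).elim, (bd ht.symm).elim, rfl, (G.loopless.irrefl _ ht).elim,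
      (ed ht.symm).elim]
  have nb : ∀ t, t ≠ b → ¬ G.Adj b t → t = d := by
    intro t htb ht
    rcases hall t with rfl | rfl | rfl | rfl | rfl
    exacts [(ht ab.symm).elim, (htb rfl).elim, (ht bc).elim, rfl, (ht eb.symm).elim]
  have nc : ∀ t, t ≠ c → ¬ G.Adj c t → t = a := by
    intro t htc ht
    rcases hall t with rfl | rfl | rfl | rfl | rfl
    exacts [rfl, (ht bc.symm).elim, (htc rfl).elim, (ht cd).elim, (ht ec.symm).elim]
  have h1 := up hea ea
  have h2 := up hed ed
  obtain ⟨h3, h3'⟩ := down eb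
  obtain ⟨h4, h4'⟩ := down ec
  have fixed : σ e = e := by
    rcases hall (σ e) with h | h | h | h | h
    · rw [h] at h1 h2
      exact (ne (σ.injective ((na _ h1).trans (na _ h2).symm))).elim
    · rw [h] at h3 h3' h4 h4'
      exact (bc.ne (σ.injective ((nb _ h3 h3').trans (nb _ h4 h4').symm))).elim
    · rw [h] at h3 h3' h4 h4'
      exact (bc.ne (σ.injective ((nc _ h3 h3').trans (nc _ h4 h4').symm))).elim
    · rw [h] at h1 h2
      exact (ne (σ.injective ((nd _ h1).trans (nd _ h2).symm))).elim
    · exact h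
  rcases hall t with h | h | h | h | rfl
  · exact Or.inl h
  · exact Or.inr (Or.inl h)
  · exact Or.inr (Or.inr (Or.inl h))
  · exact Or.inr (Or.inr (Or.inr (Or.inl h)))
  · exact Or.inr (Or.inr (Or.inr (Or.inr ⟨eb, ec, ea, ed, fixed⟩)))

theorem NotEnd.indep_nonNbr (hp : IsPrime G) {q : V} (hq : NotEnd G q) {r s : V}
    (hr : r ∈ nonNbr G q) (hs : s ∈ nonNbr G q) : ¬ G.Adj r s := by
  intro hrs
  have hC : ∀ x, Relation.ReflTransGen (fun a b => G.Adj a b ∧ b ∈ nonNbr G q) r x →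
      x ∈ nonNbr G q ∧ ∀ n, G.Adj q n → (G.Adj n r ↔ G.Adj n x) := by
    intro x hx
    induction hx with
    | refl => exact ⟨hr, fun n _ => Iff.rfl⟩
    | @tail b c _ hbc ih =>
      refine ⟨hbc.2, fun n hn => (ih.2 n hn).trans ⟨fun h => ?_, fun h => ?_⟩⟩
      · by_contra h'
        exact hq n b c hn h hbc.1 ih.1.2 hbc.2.2 h' ih.1.1.symm
      · by_contra h'
        exact hq n c b hn h hbc.1.symm hbc.2.2 ih.1.2 h' hbc.2.1.symm
  have hM : IsModule G
      {x | Relation.ReflTransGen (fun a b => G.Adj a b ∧ b ∈ nonNbr G q) r x} := by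
    intro x hx a ha b hb hxa
    by_cases hxq : x = q
    · subst hxq
      exact ((hC a ha).1.2 hxa).elim
    by_cases hqx : G.Adj q x
    · exact ((hC b hb).2 x hqx).1 (((hC a ha).2 x hqx).2 hxa)
    · exact (hx (Relation.ReflTransGen.tail ha ⟨hxa.symm, hxq, hqx⟩)).elim
  rcases hp _ hM with h | h
  · exact hrs.ne (h Relation.ReflTransGen.refl (Relation.ReflTransGen.single ⟨hrs, hs⟩))
  · have hqC := Set.mem_univ q
    rw [← h] at hqC
    exact (hC q hqC).1.1 rfl

theorem IsPrime.not_twins (hp : IsPrime G) {x y z : V} (hxy : x ≠ y) (hzx : z ≠ x) (hzy : z ≠ y)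
    (h : ∀ t, t ≠ x → t ≠ y → (G.Adj t x ↔ G.Adj t y)) : False := by
  have hM : IsModule G {x, y} := by
    intro t ht
    simp only [Set.mem_insert_iff, Set.mem_singleton_iff, not_or] at ht
    have := h t ht.1 ht.2
    rintro a (rfl | rfl) b (rfl | rfl) <;> tauto
  rcases hp _ hM with h' | h'
  · exact hxy (h' (by simp) (by simp))
  · have : z ∈ ({x, y} : Set V) := h' ▸ Set.mem_univ z
    simp [hzx, hzy] at this

theorem NotEnd.exists_nbr_adj (σ : G ≃g Gᶜ) (hp : IsPrime G) {q r : V} (hq : NotEnd G q)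
    (hr : r ∈ nonNbr G q) : ∃ n, G.Adj q n ∧ G.Adj n r := by
  obtain ⟨x, hx, n, -, hn⟩ := linked_of_iso σ {r} ⟨r, rfl⟩ (fun h => by
    have hqr := Set.mem_univ q
    rw [← h] at hqr
    exact hr.1 hqr.symm)
  rw [Set.mem_singleton_iff.1 hx] at hn
  refine ⟨n, ?_, hn.symm⟩
  by_contra h
  exact hq.indep_nonNbr hp hr ⟨fun e => hr.2 (e ▸ hn.symm), h⟩ hn

theorem NotEnd.nonNbr_unique (hp : IsPrime G) (hc : ¬ HasClaw G) {q r s n : V} (hq : NotEnd G q)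
    (hr : r ∈ nonNbr G q) (hs : s ∈ nonNbr G q) (hn : G.Adj q n) (hnr : G.Adj n r)
    (hns : G.Adj n s) : r = s := by
  by_contra hrs
  exact no_claw hc hn.symm hnr hns ⟨hr.1.symm, hs.1.symm, hrs, hr.2, hs.2,
    hq.indep_nonNbr hp hr hs⟩

theorem adj_or_adj_of_nonNbr (hc' : ¬ HasClaw Gᶜ) {q r m n : V} (hr : r ∈ nonNbr G q)
    (hm : G.Adj q m) (hn : G.Adj q n) (hmn : G.Adj m n) : G.Adj m r ∨ G.Adj n r := by
  rcases no_coclaw hc' hr.1 (fun e => hr.2 (e ▸ hm)) (fun e => hr.2 (e ▸ hn)) hm hn hmn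
    with h | h | h
  exacts [(hr.2 h.symm).elim, Or.inl h.symm, Or.inr h.symm]

theorem NotEnd.not_three_nonNbr (σ : G ≃g Gᶜ) (hp : IsPrime G) (hc : ¬ HasClaw G) {q r₁ r₂ r₃ : V}
    (hq : NotEnd G q) (h₁ : r₁ ∈ nonNbr G q) (h₂ : r₂ ∈ nonNbr G q) (h₃ : r₃ ∈ nonNbr G q)
    (h₁₂ : r₁ ≠ r₂) (h₁₃ : r₁ ≠ r₃) (h₂₃ : r₂ ≠ r₃) : False := by
  have hc' : ¬ HasClaw Gᶜ := not_hasClaw_of_iso σ.symm hc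
  obtain ⟨n₁, q₁, a₁⟩ := hq.exists_nbr_adj σ hp h₁
  obtain ⟨n₂, q₂, a₂⟩ := hq.exists_nbr_adj σ hp h₂
  obtain ⟨n₃, q₃, a₃⟩ := hq.exists_nbr_adj σ hp h₃
  have key : ∀ {r s t m n}, r ∈ nonNbr G q → s ∈ nonNbr G q → t ∈ nonNbr G q → r ≠ s → r ≠ t →
      s ≠ t → G.Adj q m → G.Adj q n → G.Adj m r → G.Adj n s → m ≠ n ∧ ¬ G.Adj m n := by
    intro r s t m n hr hs ht hrs hrt hst hm hn hmr hns
    refine ⟨fun e => hrs (hq.nonNbr_unique hp hc hr hs hn (e ▸ hmr) hns), fun hmn => ?_⟩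
    rcases adj_or_adj_of_nonNbr hc' ht hm hn hmn with h | h
    · exact hrt (hq.nonNbr_unique hp hc hr ht hm hmr h)
    · exact hst (hq.nonNbr_unique hp hc hs ht hn hns h)
  have k₁₂ := key h₁ h₂ h₃ h₁₂ h₁₃ h₂₃ q₁ q₂ a₁ a₂
  have k₁₃ := key h₁ h₃ h₂ h₁₃ h₁₂ h₂₃.symm q₁ q₃ a₁ a₃
  have k₂₃ := key h₂ h₃ h₁ h₂₃ h₁₂.symm h₁₃.symm q₂ q₃ a₂ a₃
  exact no_claw hc q₁ q₂ q₃ ⟨k₁₂.1, k₁₃.1, k₂₃.1, k₁₂.2, k₁₃.2, k₂₃.2⟩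

theorem Iso.adj_of_not_adj (σ : G ≃g Gᶜ) {x y : V} (hxy : x ≠ y) (h : ¬ G.Adj x y) :
    G.Adj (σ x) (σ y) := by
  by_contra h'
  exact h (σ.map_adj_iff.1 ⟨σ.injective.ne hxy, h'⟩)

theorem Iso.not_adj_of_adj (σ : G ≃g Gᶜ) {x y : V} (h : G.Adj x y) : ¬ G.Adj (σ x) (σ y) :=
  (σ.map_adj_iff.2 h).2

theorem NotEnd.pathLike_of_unique [Finite V] (σ : G ≃g Gᶜ) (hp : IsPrime G) (hc : ¬ HasClaw G)
    {q r : V} (hq : NotEnd G q) (hr : r ∈ nonNbr G q) (hR : ∀ t ∈ nonNbr G q, t = r) :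
    ∃ a b c d, PathLike σ a b c d := by
  classical
  have hc' : ¬ HasClaw Gᶜ := not_hasClaw_of_iso σ.symm hc
  have hnr : ∀ t, t ≠ q → ¬ G.Adj q t → t = r := fun t h h' => hR t ⟨h, h'⟩
  have hqr : q ≠ r := hr.1.symm
  have hs : G.Adj (σ q) (σ r) := Iso.adj_of_not_adj σ hqr hr.2
  have hs' : ∀ t, G.Adj (σ q) t → t = σ r := by
    intro t ht
    have e := σ.apply_symm_apply t
    rw [← e, hnr (σ.symm t)]
    · intro h
      rw [h] at e
      exact ht.ne e
    · intro h
      have := Iso.not_adj_of_adj σ h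
      rw [e] at this
      exact this ht
  have hnq : ∀ n, G.Adj q n → n ≠ r := fun n h e => hr.2 (e ▸ h)
  obtain ⟨n, qn, nr⟩ := hq.exists_nbr_adj σ hp hr
  by_cases h1 : σ q = q
  · rw [h1] at hs hs'
    have e := hs' n qn
    have e' : σ n = r := by
      have := Iso.not_adj_of_adj σ qn
      rw [h1] at this
      exact hnr _ (fun h => qn.ne (σ.injective (h1.trans h.symm))) this
    have := Iso.not_adj_of_adj σ nr
    rw [e', ← e] at this
    exact (this nr.symm).elim
  by_cases h2 : G.Adj q (σ q)
  · have hsq : ∀ t, G.Adj (σ q) t → t = q := fun t ht => (hs' t ht).trans (hs' q h2.symm).symm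
    set p := σ q with hpdef
    have hpr : ¬ G.Adj p r := fun h => hqr (hsq r h).symm
    have hnp : n ≠ p := fun e => hpr (e ▸ nr)
    have hpn : ¬ G.Adj p n := fun h => qn.ne (hsq n h).symm
    have base : G.Adj p q ∧ ¬ G.Adj q r := ⟨h2.symm, hr.2⟩
    by_cases hy : ∃ y, G.Adj q y ∧ y ≠ p ∧ y ≠ n
    · obtain ⟨y, qy, hyp, hyn⟩ := hy
      have hW : ∀ {x y}, G.Adj q x → G.Adj q y → x ≠ p → y ≠ p → x ≠ y → G.Adj x y := by
        intro x y hx hy hxp hyp hxy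
        by_contra h
        exact no_claw hc h2 hx hy ⟨hxp.symm, hyp.symm, hxy, fun h => hx.ne (hsq x h).symm,
          fun h => hy.ne (hsq y h).symm, h⟩
      have hny := hW qn qy hnp hyp hyn.symm
      have hall : ∀ t, t = p ∨ t = q ∨ t = n ∨ t = r ∨ t = y := by
        intro t
        by_contra! hcon
        have qt : G.Adj q t := by
          by_contra h
          exact hcon.2.2.2.1 (hnr t hcon.2.1 h)
        have tn := hW qt qn hcon.1 hnp hcon.2.2.1
        have ty := hW qt qy hcon.1 hyp hcon.2.2.2.2
        refine no_four_clique σ hc (K := {q, t, n, y}) ?_ ?_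
        · simp only [Finset.coe_insert, Finset.coe_singleton, isClique_insert]
          simp [qt, qn, qy, tn, ty, hny]
        · rw [Finset.card_insert_of_notMem (by simp [qt.ne, qn.ne, qy.ne]),
            Finset.card_insert_of_notMem (by simp [tn.ne, ty.ne]), Finset.card_pair hny.ne]
      have hpy : ¬ G.Adj p y := fun h => qy.ne (hsq y h).symm
      by_cases hyr : G.Adj y r
      · refine (hp.not_twins hny.ne qn.ne qy.ne fun t htn hty => ?_).elim
        rcases hall t with rfl | rfl | rfl | rfl | rfl
        · exact iff_of_false hpn hpy
        · exact iff_of_true qn qy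
        · exact (htn rfl).elim
        · exact iff_of_true nr.symm hyr.symm
        · exact (hty rfl).elim
      · exact ⟨p, q, n, r, pathLike_of_bull σ h2.symm qn nr hpn hpr hr.2 (hnq p h2) qy.symm
          hny.symm (fun h => hpy h.symm) hyr hall⟩
    · push Not at hy
      refine ⟨p, q, n, r, h2.symm, qn, nr, hpn, hpr, hr.2, hnq p h2, fun t => ?_⟩
      by_cases htq : t = q
      · exact Or.inr (Or.inl htq)
      by_cases htp : t = p
      · exact Or.inl htp
      by_cases hqt : G.Adj q t
      · exact Or.inr (Or.inr (Or.inl (hy t hqt htp)))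
      · exact Or.inr (Or.inr (Or.inr (Or.inl (hnr t htq hqt))))
  · have h3 : σ q = r := hnr _ h1 h2
    rw [h3] at hs hs'
    have hrn : ∀ t, G.Adj r t → t = n := fun t ht => (hs' t ht).trans (hs' n nr.symm).symm
    have hσr : σ r = n := (hs' n nr.symm).symm
    have hru : ∀ u, G.Adj q u → u ≠ n → ¬ G.Adj u r := fun u _ hun h => hun (hrn u h.symm)
    have hU : ∀ {u v}, G.Adj q u → G.Adj q v → u ≠ n → v ≠ n → ¬ G.Adj u v := by
      intro u v hu hv hun hvn h
      rcases adj_or_adj_of_nonNbr hc' hr hu hv h with h | h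
      · exact hru u hu hun h
      · exact hru v hv hvn h
    obtain ⟨u, qu, hun⟩ : ∃ u, G.Adj q u ∧ u ≠ n := by
      by_contra! hcon
      have e : σ n = q := by
        by_contra h
        by_cases h' : G.Adj q (σ n)
        · exact nr.ne (σ.injective ((hcon _ h').trans hσr.symm))
        · exact qn.ne (σ.injective (h3.trans (hnr _ h h').symm))
      have := Iso.not_adj_of_adj σ nr
      rw [e, hσr] at this
      exact this qn
    have hur := hru u qu hun
    by_cases hy : ∃ y, G.Adj q y ∧ y ≠ n ∧ y ≠ u
    · obtain ⟨v, qv, hvn, hvu⟩ := hy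
      have huv := hU qu qv hun hvn
      have hvr := hru v qv hvn
      have hall : ∀ t, t = q ∨ t = n ∨ t = r ∨ t = u ∨ t = v := by
        intro t
        by_contra! hcon
        have qt : G.Adj q t := by
          by_contra h
          exact hcon.2.2.1 (hnr t hcon.1 h)
        exact no_claw hc qt qu qv ⟨hcon.2.2.2.1, hcon.2.2.2.2, hvu.symm, hU qt qu hcon.2.1 hun,
          hU qt qv hcon.2.1 hvn, huv⟩
      by_cases hnu : G.Adj n u
      · by_cases hnv : G.Adj n v
        · refine (hp.not_twins hvu.symm qu.ne qv.ne fun t htu htv => ?_).elim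
          rcases hall t with rfl | rfl | rfl | rfl | rfl
          · exact iff_of_true qu qv
          · exact iff_of_true hnu hnv
          · exact iff_of_false (fun h => hur h.symm) (fun h => hvr h.symm)
          · exact (htu rfl).elim
          · exact (htv rfl).elim
        · exact ⟨v, q, n, r, pathLike_of_bull σ qv.symm qn nr (fun h => hnv h.symm) hvr hr.2
            (hnq v qv) qu.symm hnu.symm huv hur (by intro t; have := hall t; tauto)⟩
      · by_cases hnv : G.Adj n v
        · exact ⟨u, q, n, r, pathLike_of_bull σ qu.symm qn nr (fun h => hnu h.symm) hur hr.2
            (hnq u qu) qv.symm hnv.symm (fun h => huv h.symm) hvr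
            (by intro t; have := hall t; tauto)⟩
        · exact (no_claw hc qn qu qv ⟨hun.symm, hvn.symm, hvu.symm, hnu, hnv, huv⟩).elim
    · push Not at hy
      have hall : ∀ t, t = u ∨ t = q ∨ t = n ∨ t = r := by
        intro t
        by_contra! hcon
        have qt : G.Adj q t := by
          by_contra h
          exact hcon.2.2.2 (hnr t hcon.2.1 h)
        exact hcon.1 (hy t qt hcon.2.2.1)
      by_cases hnu : G.Adj n u
      · refine (hp.not_twins qu.ne hqr.symm (hnq u qu).symm fun t htq htu => ?_).elim
        rcases hall t with rfl | rfl | rfl | rfl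
        · exact (htu rfl).elim
        · exact (htq rfl).elim
        · exact iff_of_true qn.symm hnu
        · exact iff_of_false (fun h => hr.2 h.symm) (fun h => hur h.symm)
      · refine ⟨u, q, n, r, qu.symm, qn, nr, fun h => hnu h.symm, hur, hr.2, hnq u qu,
          fun t => ?_⟩
        have := hall t
        tauto

theorem NotEnd.pathLike_of_two [Finite V] (σ : G ≃g Gᶜ) (hp : IsPrime G) (hc : ¬ HasClaw G)
    {q r₁ r₂ : V} (hq : NotEnd G q) (h₁ : r₁ ∈ nonNbr G q) (h₂ : r₂ ∈ nonNbr G q)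
    (h₁₂ : r₁ ≠ r₂) : ∃ a b c d, PathLike σ a b c d := by
  classical
  have := Fintype.ofFinite V
  have hc' : ¬ HasClaw Gᶜ := not_hasClaw_of_iso σ.symm hc
  have hR : ∀ t ∈ nonNbr G q, t = r₁ ∨ t = r₂ := by
    intro t ht
    by_contra! hcon
    exact hq.not_three_nonNbr σ hp hc ht h₁ h₂ hcon.1 hcon.2 h₁₂
  obtain ⟨n₁, q₁, a₁⟩ := hq.exists_nbr_adj σ hp h₁
  obtain ⟨n₂, q₂, a₂⟩ := hq.exists_nbr_adj σ hp h₂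
  have b₁ : ¬ G.Adj n₁ r₂ := fun h => h₁₂ (hq.nonNbr_unique hp hc h₁ h₂ q₁ a₁ h)
  have b₂ : ¬ G.Adj n₂ r₁ := fun h => h₁₂ (hq.nonNbr_unique hp hc h₁ h₂ q₂ h a₂)
  have hn : n₁ ≠ n₂ := fun e => b₂ (e ▸ a₁)
  have hr := hq.indep_nonNbr hp h₁ h₂
  have two : ∀ r ∈ nonNbr G q, ((G.neighborFinset q).filter (fun n => ¬ G.Adj n r)).card ≤ 2 := by
    intro r hr
    by_contra! h
    obtain ⟨a, ha, b, hb, c, hc1, hab, hac, hbc⟩ := Finset.two_lt_card.1 h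
    simp only [Finset.mem_filter, mem_neighborFinset] at ha hb hc1
    have key : ∀ {m n}, G.Adj q m → G.Adj q n → ¬ G.Adj m r → ¬ G.Adj n r → ¬ G.Adj m n :=
      fun hm hn h h' hmn => (adj_or_adj_of_nonNbr hc' hr hm hn hmn).elim h h'
    exact no_claw hc ha.1 hb.1 hc1.1 ⟨hab, hac, hbc, key ha.1 hb.1 ha.2 hb.2,
      key ha.1 hc1.1 ha.2 hc1.2, key hb.1 hc1.1 hb.2 hc1.2⟩
  have hN4 : (G.neighborFinset q).card ≤ 4 := by
    have := two r₁ h₁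
    have := two r₂ h₂
    have h3 := Finset.card_union_le ((G.neighborFinset q).filter (fun n => ¬ G.Adj n r₁))
      ((G.neighborFinset q).filter (fun n => ¬ G.Adj n r₂))
    have h4 : G.neighborFinset q ⊆ (G.neighborFinset q).filter (fun n => ¬ G.Adj n r₁) ∪
        (G.neighborFinset q).filter (fun n => ¬ G.Adj n r₂) := by
      intro n hn
      have hqn : G.Adj q n := by simpa using hn
      simp only [Finset.mem_union, Finset.mem_filter, hn, true_and]
      by_contra! hcon
      exact h₁₂ (hq.nonNbr_unique hp hc h₁ h₂ hqn hcon.1 hcon.2)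
    have := Finset.card_le_card h4
    omega
  have hRc : Gᶜ.neighborFinset q = {r₁, r₂} := by
    ext t
    simp only [mem_neighborFinset, compl_adj, Finset.mem_insert, Finset.mem_singleton]
    constructor
    · exact fun h => hR t ⟨h.1.symm, h.2⟩
    · rintro (rfl | rfl)
      exacts [⟨h₁.1.symm, h₁.2⟩, ⟨h₂.1.symm, h₂.2⟩]
  have hNc : (G.neighborFinset q).card + 3 = Fintype.card V := by
    have e := congrArg Finset.card hRc
    rw [card_neighborFinset_eq_degree, degree_compl, Finset.card_pair h₁₂] at e
    have := G.degree_lt_card_verts q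
    rw [card_neighborFinset_eq_degree]
    omega
  have hsub : ({n₁, n₂} : Finset V) ⊆ G.neighborFinset q := by
    simp [Finset.insert_subset_iff, q₁, q₂]
  have hN2 : (G.neighborFinset q).card = 2 := by
    have hdvd := four_dvd_of_iso σ
    have := Finset.card_le_card hsub
    rw [Finset.card_pair hn] at this
    rw [← hNc] at hdvd
    clear * - hdvd this hN4
    interval_cases (G.neighborFinset q).card <;> simp_all
  have hNe := Finset.eq_of_subset_of_card_le hsub (by rw [hN2, Finset.card_pair hn])
  have hNall : ∀ t, G.Adj q t → t = n₁ ∨ t = n₂ := by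
    intro t ht
    have : t ∈ ({n₁, n₂} : Finset V) := hNe ▸ (G.mem_neighborFinset q t).2 ht
    simpa using this
  by_cases h : G.Adj n₁ n₂
  · refine ⟨r₁, n₁, n₂, r₂, pathLike_of_bull σ a₁.symm h a₂ (fun h => b₂ h.symm) hr b₁ h₁₂ q₁ q₂
      h₁.2 h₂.2 fun t => ?_⟩
    by_cases htq : t = q
    · exact Or.inr (Or.inr (Or.inr (Or.inr htq)))
    by_cases hqt : G.Adj q t
    · have := hNall t hqt
      tauto
    · have := hR t ⟨htq, hqt⟩
      tauto
  · exfalso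
    have bip : ∀ {x y}, G.Adj x y → (G.Adj q x ↔ ¬ G.Adj q y) := by
      intro x y hxy
      constructor
      · intro hx hy
        rcases hNall x hx with rfl | rfl <;> rcases hNall y hy with rfl | rfl
        exacts [G.loopless.irrefl _ hxy, h hxy, h hxy.symm, G.loopless.irrefl _ hxy]
      · intro hy
        by_contra hx
        by_cases hxq : x = q
        · exact hy (hxq ▸ hxy)
        by_cases hyq : y = q
        · exact hx (hyq ▸ hxy.symm)
        exact hq.indep_nonNbr hp ⟨hxq, hx⟩ ⟨hyq, hy⟩ hxy
    have t₁ := bip (Iso.adj_of_not_adj σ h₁.1.symm h₁.2)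
    have t₂ := bip (Iso.adj_of_not_adj σ h₂.1.symm h₂.2)
    have t₃ := bip (Iso.adj_of_not_adj σ h₁₂ hr)
    tauto

/-- A prime self-complementary graph without claws having a vertex that is not the end of an
induced path on four vertices is that path or the bull. -/
theorem NotEnd.exists_pathLike [Finite V] [Nontrivial V] (σ : G ≃g Gᶜ) (hp : IsPrime G)
    (hc : ¬ HasClaw G) {q : V} (hq : NotEnd G q) : ∃ a b c d, PathLike σ a b c d := by
  obtain ⟨p, hpq⟩ := exists_ne q
  obtain ⟨x, hx, r, hr, hxr⟩ := linked_compl_of_iso σ {q} ⟨q, rfl⟩ (fun h => hpq (by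
    have hmem := Set.mem_univ p
    rwa [← h] at hmem))
  rw [Set.mem_singleton_iff.1 hx] at hxr
  have hr : r ∈ nonNbr G q := ⟨hxr.1.symm, hxr.2⟩
  by_cases h : ∃ s ∈ nonNbr G q, s ≠ r
  · obtain ⟨s, hs, hsr⟩ := h
    exact hq.pathLike_of_two σ hp hc hs hr hsr
  · push Not at h
    exact hq.pathLike_of_unique σ hp hc hr h

theorem IsModule.map {W : Type*} {H : SimpleGraph W} (f : G ≃g H) {M : Set V} (h : IsModule G M) :
    IsModule H (f.symm ⁻¹' M) := by
  intro x hx a ha b hb hxa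
  exact f.symm.map_adj_iff.1 (h _ hx _ ha _ hb (f.symm.map_adj_iff.2 hxa))

theorem IsModule.union (hG : Linked G) (hG' : Linked Gᶜ) {M N : Set V} (hM : IsModule G M)
    (hN : IsModule G N) (hM' : M ≠ Set.univ) (hN' : N ≠ Set.univ) {z : V} (hzM : z ∈ M)
    (hzN : z ∈ N) : IsModule G (M ∪ N) ∧ M ∪ N ≠ Set.univ := by
  constructor
  · intro x hx a ha b hb hxa
    simp only [Set.mem_union, not_or] at hx
    have hxz : G.Adj x z := ha.elim (fun h => hM x hx.1 a h z hzM hxa)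
      (fun h => hN x hx.2 a h z hzN hxa)
    exact hb.elim (fun h => hM x hx.1 z hzM b h hxz) (fun h => hN x hx.2 z hzN b h hxz)
  · intro hU
    have cov : ∀ {x}, x ∉ M → x ∈ N := fun {x} hx =>
      (hU.symm ▸ Set.mem_univ x : x ∈ M ∪ N).resolve_left hx
    obtain ⟨p, hp⟩ := (Set.ne_univ_iff_exists_notMem M).1 hM'
    obtain ⟨s, hs⟩ := (Set.ne_univ_iff_exists_notMem N).1 hN'
    have hsM : s ∈ M := by
      by_contra h
      exact hs (cov h)
    by_cases hps : G.Adj p s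
    · obtain ⟨x, hx, y, hy, hxy⟩ := hG' M ⟨z, hzM⟩ hM'
      have hsy : G.Adj s y := hN s hs p (cov hp) y (cov hy) hps.symm
      exact hxy.2 (hM y hy s hsM x hx hsy.symm).symm
    · obtain ⟨x, hx, y, hy, hxy⟩ := hG M ⟨z, hzM⟩ hM'
      have hys : G.Adj y s := hM y hy x hx s hsM hxy.symm
      exact hps (hN s hs y (cov hy) p (cov hp) hys.symm).symm

/-- Some proper module contains both vertices. -/
def Close (G : SimpleGraph V) (x y : V) : Prop :=
  ∃ M, IsModule G M ∧ M ≠ Set.univ ∧ x ∈ M ∧ y ∈ M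

theorem Close.map {W : Type*} {H : SimpleGraph W} (f : G ≃g H) {x y : V} (h : Close G x y) :
    Close H (f x) (f y) := by
  obtain ⟨M, hM, hM', hx, hy⟩ := h
  refine ⟨_, hM.map f, fun hU => hM' ?_, by simpa, by simpa⟩
  rw [Set.eq_univ_iff_forall] at hU ⊢
  exact fun z => by simpa using hU (f z)

theorem Close.compl {x y : V} (h : Close G x y) : Close Gᶜ x y := by
  obtain ⟨M, hM, h⟩ := h
  exact ⟨M, hM.compl, h⟩

theorem Close.of_compl {x y : V} (h : Close Gᶜ x y) : Close G x y := by
  have := h.compl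
  rwa [compl_compl] at this

theorem Close.adj {x y z : V} (h : Close G x y) (hz : ¬ Close G x z) (hxz : G.Adj x z) :
    G.Adj y z := by
  obtain ⟨M, hM, hM', hx, hy⟩ := h
  exact (hM z (fun hzM => hz ⟨M, hM, hM', hx, hzM⟩) x hx y hy hxz.symm).symm

theorem isModule_singleton (x : V) : IsModule G {x} := by
  rintro y - a rfl b rfl h
  exact h

/-- Two vertices are equivalent when some proper module contains both. -/
def closeSetoid [Nontrivial V] (hG : Linked G) (hG' : Linked Gᶜ) : Setoid V where
  r := Close G
  iseqv :=
    { refl := fun x => ⟨{x}, isModule_singleton x, Set.singleton_ne_univ x, rfl, rfl⟩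
      symm := fun ⟨M, hM, hM', hx, hy⟩ => ⟨M, hM, hM', hy, hx⟩
      trans := fun ⟨M, hM, hM', hx, hy⟩ ⟨N, hN, hN', hy', hz⟩ =>
        have h := hM.union hG hG' hN hM' hN' hy hy'
        ⟨M ∪ N, h.1, h.2, Or.inl hx, Or.inr hz⟩ }

theorem exists_not_close [Finite V] [Nontrivial V] (hG : Linked G) (hG' : Linked Gᶜ) (x : V) :
    ∃ y, ¬ Close G x y := by
  obtain ⟨M, ⟨hM, hM', hx⟩, hmax⟩ :=
    (Set.toFinite {M | IsModule G M ∧ M ≠ Set.univ ∧ x ∈ M}).exists_maximal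
      ⟨{x}, isModule_singleton x, Set.singleton_ne_univ x, rfl⟩
  obtain ⟨y, hy⟩ := (Set.ne_univ_iff_exists_notMem M).1 hM'
  refine ⟨y, fun ⟨N, hN, hN', hxN, hyN⟩ => hy ?_⟩
  have h := hM.union hG hG' hN hM' hN' hx hxN
  exact hmax ⟨h.1, h.2, Or.inl hx⟩ Set.subset_union_left (Or.inr hyN)

theorem NoChair.of_embedding {W : Type*} {H : SimpleGraph W} (f : G ↪g H) (h : NoChair H) :
    NoChair G := by
  intro c x y z t h1 h2 h3 h4 h5 h6 h7 h8 h9 h10 h11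
  exact h (f c) (f x) (f y) (f z) (f t) (f.map_adj_iff.2 h1) (f.map_adj_iff.2 h2)
    (f.map_adj_iff.2 h3) (f.map_adj_iff.2 h4) (f.injective.ne h5) (mt f.map_adj_iff.1 h6)
    (mt f.map_adj_iff.1 h7) (mt f.map_adj_iff.1 h8) (mt f.map_adj_iff.1 h9)
    (mt f.map_adj_iff.1 h10) (mt f.map_adj_iff.1 h11)

theorem NoChair.noKite (σ : G ≃g Gᶜ) (h : NoChair G) : NoKite G := by
  have := (h.of_embedding σ.symm.toEmbedding).compl
  rwa [compl_compl] at this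

/-- `π` presents `H` as a prime quotient of `G`, and `τ` as the automorphism-like map induced by
`σ`. -/
structure PrimeQuotient {Q : Type*} {H : SimpleGraph Q} (σ : G ≃g Gᶜ) (τ : H ≃g Hᶜ) (π : V → Q) :
    Prop where
  surj : Function.Surjective π
  adj_iff : ∀ x y, π x ≠ π y → (H.Adj (π x) (π y) ↔ G.Adj x y)
  prime : IsPrime H
  comm : ∀ x, π (σ x) = τ (π x)
  twins : ∃ x y, x ≠ y ∧ π x = π y ∧ ¬ G.Adj x y

theorem exists_primeQuotient.{u} {V : Type u} {G : SimpleGraph V} [Finite V] (σ : G ≃g Gᶜ)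
    (hG : ¬ IsPrime G) :
    ∃ (Q : Type u) (_ : Finite Q) (_ : Nontrivial Q) (H : SimpleGraph Q) (τ : H ≃g Hᶜ) (π : V → Q),
      Nonempty (H ↪g G) ∧ PrimeQuotient σ τ π := by
  unfold IsPrime at hG
  push Not at hG
  obtain ⟨M, hM, hM1, hM2⟩ := hG
  obtain ⟨m, hm, m', hm', hmm⟩ := hM1
  have : Nontrivial V := ⟨m, m', hmm⟩
  have hl := linked_of_iso σ
  have hl' := linked_compl_of_iso σ
  let s := closeSetoid hl hl'
  have hclose : ∀ x y, (⟦x⟧ : Quotient s) = ⟦y⟧ ↔ Close G x y := fun x y => Quotient.eq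
  have hσ : ∀ x y, s.r x y ↔ s.r (σ.toEquiv x) (σ.toEquiv y) := by
    intro x y
    refine ⟨fun h => (h.map σ).of_compl, fun h => ?_⟩
    have h' := Close.map σ.symm (Close.compl h)
    have hx : ∀ x, σ.symm (σ.toEquiv x) = x := σ.symm_apply_apply
    rwa [hx, hx] at h'
  have hadj : ∀ x y, (⟦x⟧ : Quotient s) ≠ ⟦y⟧ →
      ((G.comap (Quotient.out : Quotient s → V)).Adj ⟦x⟧ ⟦y⟧ ↔ G.Adj x y) := by
    intro x y hxy
    have key : ∀ {u v x y : V}, Close G u x → Close G v y → ¬ Close G x y → G.Adj u v →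
        G.Adj x y := by
      intro u v x y hu hv hn h
      have h1 : ¬ Close G u v := fun h' => hn (s.iseqv.trans (s.iseqv.trans (s.iseqv.symm hu) h') hv)
      have h2 := hu.adj h1 h
      exact (hv.adj (fun h' => h1 (s.iseqv.trans hu (s.iseqv.symm h'))) h2.symm).symm
    have ho : ∀ x : V, Close G (⟦x⟧ : Quotient s).out x := fun x => Quotient.mk_out x
    have hn : ¬ Close G x y := fun h => hxy ((hclose x y).2 h)
    refine ⟨key (ho x) (ho y) hn, key (s.iseqv.symm (ho x)) (s.iseqv.symm (ho y)) fun h => ?_⟩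
    exact hn (s.iseqv.trans (s.iseqv.trans (s.iseqv.symm (ho x)) h) (ho y))
  refine ⟨Quotient s, inferInstance, ?_, G.comap Quotient.out,
    ⟨Quotient.congr σ.toEquiv hσ, ?_⟩, fun x => ⟦x⟧,
    ⟨Embedding.comap ⟨Quotient.out, Quotient.out_injective⟩ G⟩, ?_⟩
  · obtain ⟨y, hy⟩ := exists_not_close hl hl' m
    exact ⟨⟦m⟧, ⟦y⟧, fun h => hy ((hclose m y).1 h)⟩
  · intro p q
    induction p using Quotient.inductionOn with | h x => ?_
    induction q using Quotient.inductionOn with | h y => ?_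
    by_cases hxy : (⟦x⟧ : Quotient s) = ⟦y⟧
    · rw [hxy]
      simp
    · have hne : (⟦σ x⟧ : Quotient s) ≠ ⟦σ y⟧ := fun h =>
        hxy ((hclose x y).2 ((hσ x y).2 ((hclose _ _).1 h)))
      rw [hadj x y hxy, ← σ.map_adj_iff, compl_adj, Quotient.congr_mk, Quotient.congr_mk]
      have := hadj _ _ hne
      constructor
      · exact fun h => ⟨fun e => hne (e ▸ rfl), fun h' => h.2 (this.2 h')⟩
      · exact fun h => ⟨hne, fun h' => h.2 (this.1 h')⟩
  · refine ⟨Quotient.mk_surjective, hadj, ?_, fun x => rfl, ?_⟩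
    · intro N hN
      have hP : IsModule G {x | (⟦x⟧ : Quotient s) ∈ N} := by
        intro x hx a ha b hb hxa
        have h1 : ∀ {a : V}, (⟦a⟧ : Quotient s) ∈ N → (⟦x⟧ : Quotient s) ≠ ⟦a⟧ :=
          fun ha h => hx (show (⟦x⟧ : Quotient s) ∈ N from h ▸ ha)
        exact (hadj _ _ (h1 hb)).1 (hN _ hx _ ha _ hb ((hadj _ _ (h1 ha)).2 hxa))
      by_cases hU : {x | (⟦x⟧ : Quotient s) ∈ N} = Set.univ
      · right
        rw [Set.eq_univ_iff_forall] at hU ⊢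
        intro q
        induction q using Quotient.inductionOn with | h x => exact hU x
      · left
        intro p hp q hq
        induction p using Quotient.inductionOn with | h x => ?_
        induction q using Quotient.inductionOn with | h y => ?_
        exact (hclose x y).2 ⟨_, hP, hU, hp, hq⟩
    · have hc : (⟦m⟧ : Quotient s) = ⟦m'⟧ := (hclose _ _).2 ⟨M, hM, hM2, hm, hm'⟩
      by_cases h : G.Adj m m'
      · exact ⟨σ m, σ m', (σ.map_adj_iff.2 h).1,
          (hclose _ _).2 ((hσ _ _).1 ((hclose _ _).1 hc)), (σ.map_adj_iff.2 h).2⟩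
      · exact ⟨m, m', hmm, hc, h⟩

theorem PathLike.symm {σ : G ≃g Gᶜ} {a b c d : V} (h : PathLike σ a b c d) :
    PathLike σ d c b a := by
  refine ⟨h.cd.symm, h.bc.symm, h.ab.symm, fun h' => h.bd h'.symm, fun h' => h.ad h'.symm,
    fun h' => h.ac h'.symm, h.ne.symm, fun t => ?_⟩
  have := h.rest t
  tauto

section

variable {Q : Type*} {H : SimpleGraph Q} {σ : G ≃g Gᶜ} {τ : H ≃g Hᶜ} {π : V → Q}

theorem PrimeQuotient.notEnd (h : PrimeQuotient σ τ π) (hG : NoChair G) {x y : V} (hxy : x ≠ y)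
    (hπ : π x = π y) (hn : ¬ G.Adj x y) : NotEnd H (π x) := by
  intro b c d qb bc cd qc qd bd hne
  obtain ⟨b, rfl⟩ := h.surj b
  obtain ⟨c, rfl⟩ := h.surj c
  obtain ⟨d, rfl⟩ := h.surj d
  have hqd : π x ≠ π d := fun e => qc (e ▸ cd.symm)
  have hbd : π b ≠ π d := fun e => qd (e ▸ qb)
  have adj : ∀ {u v}, H.Adj (π u) (π v) → G.Adj u v := fun {u v} h' => (h.adj_iff u v h'.ne).1 h'
  have nadj : ∀ {u v}, π u ≠ π v → ¬ H.Adj (π u) (π v) → ¬ G.Adj u v := fun {u v} h1 h2 =>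
    mt (h.adj_iff u v h1).2 h2
  exact hG b x y c d (adj qb).symm (adj (hπ ▸ qb)).symm (adj bc) (adj cd) hxy hn (nadj hne qc)
    (nadj (hπ ▸ hne) (hπ ▸ qc)) (fun h => nadj hbd bd h.symm) (fun h => nadj hqd qd h.symm)
    (fun h => nadj (hπ ▸ hqd) (hπ ▸ qd) h.symm)

theorem PrimeQuotient.adj_of_end (h : PrimeQuotient σ τ π) (hG : NoChair G) {a b c d : Q}
    (hp : PathLike τ a b c d) {x y : V} (hx : π x = a) (hy : π y = a) (hxy : x ≠ y) :
    G.Adj x y := by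
  by_contra hn
  have hac : a ≠ c := fun e => hp.ad (e ▸ hp.cd)
  exact h.notEnd hG hxy (hx.trans hy.symm) hn b c d (hx ▸ hp.ab) hp.bc hp.cd (hx ▸ hp.ac)
    (hx ▸ hp.ad) hp.bd (hx ▸ hac)

theorem PrimeQuotient.not_adj_of_mid (h : PrimeQuotient σ τ π) (hG : NoChair G) {a b c d : Q}
    (hp : PathLike τ a b c d) {x y : V} (hx : π x = b) (hy : π y = b) : ¬ G.Adj x y := by
  intro hxy
  obtain ⟨ab, bc, cd, ac, ad, bd, ne, -⟩ := hp
  have hbd : b ≠ d := fun e => ad (e ▸ ab)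
  have hac : a ≠ c := fun e => ad (e ▸ cd)
  obtain ⟨a, rfl⟩ := h.surj a
  obtain ⟨c, rfl⟩ := h.surj c
  obtain ⟨d, rfl⟩ := h.surj d
  have adj : ∀ {u v}, H.Adj (π u) (π v) → G.Adj u v := fun {u v} h' => (h.adj_iff u v h'.ne).1 h'
  have nadj : ∀ {u v}, π u ≠ π v → ¬ H.Adj (π u) (π v) → ¬ G.Adj u v := fun {u v} h1 h2 =>
    mt (h.adj_iff u v h1).2 h2
  exact hG.noKite σ x y c a d hxy (adj (hx.symm ▸ bc)) (adj (hx.symm ▸ ab)).symm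
    (adj (hy.symm ▸ bc)) (adj (hy.symm ▸ ab)).symm (fun h => nadj hac ac h.symm) (adj cd).symm
    (fun h => nadj (hx.symm ▸ hbd) (hx.symm ▸ bd) h.symm)
    (fun h => nadj (hy.symm ▸ hbd) (hy.symm ▸ bd) h.symm) (fun h => nadj ne ad h.symm)

theorem PrimeQuotient.colOn [Finite V] (h : PrimeQuotient σ τ π) (hG : NoChair G) {a b c d : Q}
    (hp : PathLike τ a b c d) {k m : ℕ} (hA : (π ⁻¹' {a}).ncard + 1 ≤ m)
    (hD : (π ⁻¹' {d}).ncard + 1 ≤ m) (hk : k + 2 ≤ m)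
    (hE : ColOn G (π ⁻¹' {a, b, c, d}ᶜ) k) : ColOn G Set.univ m := by
  classical
  have col : ∀ S : Set V, ColOn G S S.ncard := by
    intro S
    have := ColOn.of_card (G := G) S.toFinite.toFinset
    rwa [Set.Finite.coe_toFinset, ← Set.ncard_eq_toFinset_card] at this
  obtain ⟨f, hf, hf'⟩ := col (π ⁻¹' {a})
  obtain ⟨g, hg, hg'⟩ := col (π ⁻¹' {d})
  obtain ⟨e, he, he'⟩ := hE
  have hab := hp.ab.ne
  have hbc := hp.bc.ne
  have hcd := hp.cd.ne
  have hbd : b ≠ d := fun e => hp.ad (e ▸ hp.ab)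
  have hac : a ≠ c := fun e => hp.ad (e ▸ hp.cd)
  have had := hp.ne
  have hr : ∀ x, π x = a ∨ π x = b ∨ π x = c ∨ π x = d ∨ (x ∈ π ⁻¹' {a, b, c, d}ᶜ ∧
      π x ≠ a ∧ π x ≠ b ∧ π x ≠ c ∧ π x ≠ d ∧ ¬ H.Adj (π x) a ∧ ¬ H.Adj (π x) d) := by
    intro x
    have := hp.rest (π x)
    simp only [Set.mem_preimage, Set.mem_compl_iff, Set.mem_insert_iff, Set.mem_singleton_iff]
    tauto
  let F : V → ℕ := fun x => if π x = a then f x + 1 else if π x = b then 0 else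
    if π x = c then 1 else if π x = d then (if g x = 0 then 0 else g x + 1) else e x + 2
  have Fa : ∀ {x}, π x = a → F x = f x + 1 := fun hx => by simp [F, hx]
  have Fb : ∀ {x}, π x = b → F x = 0 := fun hx => by simp [F, hx, hab.symm]
  have Fc : ∀ {x}, π x = c → F x = 1 := fun hx => by simp [F, hx, hac.symm, hbc.symm]
  have Fd : ∀ {x}, π x = d → F x = if g x = 0 then 0 else g x + 1 := fun hx => by
    simp [F, hx, had.symm, hbd.symm, hcd.symm]
  have Fe : ∀ {x}, π x ≠ a → π x ≠ b → π x ≠ c → π x ≠ d → F x = e x + 2 := fun h1 h2 h3 h4 => by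
    simp [F, h1, h2, h3, h4]
  have nadj : ∀ {u v}, π u ≠ π v → ¬ H.Adj (π u) (π v) → ¬ G.Adj u v := fun {u v} h1 h2 =>
    mt (h.adj_iff u v h1).2 h2
  have hlt : ∀ x, F x < m := by
    intro x
    rcases hr x with hx | hx | hx | hx | ⟨hx, h1, h2, h3, h4, -⟩
    · have := hf x hx
      rw [Fa hx]; omega
    · rw [Fb hx]; omega
    · rw [Fc hx]; omega
    · have := hg x hx
      rw [Fd hx]; split_ifs <;> omega
    · have := he x hx
      rw [Fe h1 h2 h3 h4]; omega
  have na : ∀ {x y}, π x = a → G.Adj x y → π y = a ∨ π y = b := by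
    intro x y hx hxy
    rcases hr y with hy | hy | hy | hy | ⟨hy, h1, h2, h3, h4, h5, h6⟩
    · exact Or.inl hy
    · exact Or.inr hy
    · exact (nadj (by rw [hx, hy]; exact hac) (by rw [hx, hy]; exact hp.ac) hxy).elim
    · exact (nadj (by rw [hx, hy]; exact had) (by rw [hx, hy]; exact hp.ad) hxy).elim
    · exact (nadj (by rw [hx]; exact h1) (by rw [hx]; exact h5) hxy.symm).elim
  have nd : ∀ {x y}, π x = d → G.Adj x y → π y = d ∨ π y = c := by
    intro x y hx hxy
    rcases hr y with hy | hy | hy | hy | ⟨hy, h1, h2, h3, h4, h5, h6⟩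
    · exact (nadj (by rw [hx, hy]; exact had) (by rw [hx, hy]; exact hp.ad) hxy.symm).elim
    · exact (nadj (by rw [hx, hy]; exact hbd) (by rw [hx, hy]; exact hp.bd) hxy.symm).elim
    · exact Or.inr hy
    · exact Or.inl hy
    · exact (nadj (by rw [hx]; exact h4) (by rw [hx]; exact h6) hxy.symm).elim
  have da : ∀ {x y}, π x = a → G.Adj x y → F x ≠ F y := by
    intro x y hx hxy
    rcases na hx hxy with hy | hy
    · rw [Fa hx, Fa hy]
      have := hf' x hx y hy hxy
      omega
    · rw [Fa hx, Fb hy]; omega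
  have dd : ∀ {x y}, π x = d → G.Adj x y → F x ≠ F y := by
    intro x y hx hxy
    rcases nd hx hxy with hy | hy
    · rw [Fd hx, Fd hy]
      have := hg' x hx y hy hxy
      split_ifs <;> omega
    · rw [Fd hx, Fc hy]
      split_ifs <;> omega
  refine ⟨F, fun x _ => hlt x, fun x _ y _ hxy => ?_⟩
  rcases hr x with hx | hx | hx | hx | ⟨hx, h1, h2, h3, h4, -⟩
  · exact da hx hxy
  · rcases hr y with hy | hy | hy | hy | ⟨hy, k1, k2, k3, k4, -⟩
    · exact (da hy hxy.symm).symm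
    · exact (h.not_adj_of_mid hG hp hx hy hxy).elim
    · rw [Fb hx, Fc hy]; omega
    · exact (dd hy hxy.symm).symm
    · rw [Fb hx, Fe k1 k2 k3 k4]; omega
  · rcases hr y with hy | hy | hy | hy | ⟨hy, k1, k2, k3, k4, -⟩
    · exact (da hy hxy.symm).symm
    · rw [Fb hy, Fc hx]; omega
    · exact (h.not_adj_of_mid hG hp.symm hx hy hxy).elim
    · exact (dd hy hxy.symm).symm
    · rw [Fc hx, Fe k1 k2 k3 k4]; omega
  · exact dd hx hxy
  · rcases hr y with hy | hy | hy | hy | ⟨hy, k1, k2, k3, k4, -⟩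
    · exact (da hy hxy.symm).symm
    · rw [Fb hy, Fe h1 h2 h3 h4]; omega
    · rw [Fc hy, Fe h1 h2 h3 h4]; omega
    · exact (dd hy hxy.symm).symm
    · rw [Fe h1 h2 h3 h4, Fe k1 k2 k3 k4]
      have := he' x hx y hy hxy
      omega

end

/-- Some vertex and some clique witness that Reed's bound is at least `t`. -/
def Bound (G : SimpleGraph V) (t : ℕ) : Prop :=
  ∃ (v : V) (K : Finset V), G.IsClique K ∧ t ≤ ((G.neighborSet v).ncard + K.card + 2) / 2

theorem Bound.reed {t : ℕ} (h : Bound G t) (h' : G.Colorable t) : Reed G := by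
  obtain ⟨v, K, hK, ht⟩ := h
  exact ⟨v, K, hK, h'.mono ht⟩

theorem Bound.of_clique [Finite V] {K : Finset V} (hK : G.IsClique K) (hne : K.Nonempty) :
    Bound G K.card := by
  classical
  obtain ⟨v, hv⟩ := hne
  refine ⟨v, K, hK, ?_⟩
  have h1 : ((K.erase v : Finset V) : Set V) ⊆ G.neighborSet v := by
    intro x hx
    simp only [Finset.coe_erase, Set.mem_sdiff, Set.mem_singleton_iff] at hx
    exact hK hv hx.1 (Ne.symm hx.2)
  have h2 := Set.ncard_le_ncard h1
  rw [Set.ncard_coe_finset, Finset.card_erase_of_mem hv] at h2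
  omega

theorem PrimeQuotient.bound_of_end [Finite V] {Q : Type*} {H : SimpleGraph Q} {σ : G ≃g Gᶜ}
    {τ : H ≃g Hᶜ} {π : V → Q} (h : PrimeQuotient σ τ π) (hG : NoChair G) {a b c d : Q}
    (hp : PathLike τ a b c d) : Bound G ((π ⁻¹' {a}).ncard + 1) := by
  classical
  obtain ⟨v, hv⟩ := h.surj b
  have hv' : v ∉ (Set.toFinite (π ⁻¹' {a})).toFinset := by
    rw [Set.Finite.mem_toFinset]
    exact fun e => hp.ab.ne (hv ▸ e : b = a).symm
  rw [Set.ncard_eq_toFinset_card _ (Set.toFinite _), ← Finset.card_insert_of_notMem hv']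
  refine Bound.of_clique ?_ (Finset.insert_nonempty _ _)
  rw [Finset.coe_insert, Set.Finite.coe_toFinset, isClique_insert]
  refine ⟨fun x hx y hy hxy => h.adj_of_end hG hp hx hy hxy, fun x hx _ => ?_⟩
  have hx : π x = a := hx
  rw [← h.adj_iff v x (by rw [hv, hx]; exact hp.ab.ne.symm), hv, hx]
  exact hp.ab.symm

theorem PrimeQuotient.bound_of_rest [Finite V] {Q : Type*} {H : SimpleGraph Q} {σ : G ≃g Gᶜ}
    {τ : H ≃g Hᶜ} {π : V → Q} (h : PrimeQuotient σ τ π) {a b c d : Q} (hp : PathLike τ a b c d)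
    {k : ℕ} (hk : Bound (G.induce (π ⁻¹' {a, b, c, d}ᶜ)) k) : Bound G (k + 2) := by
  classical
  obtain ⟨v, K, hK, hk⟩ := hk
  obtain ⟨x, hx⟩ := h.surj b
  obtain ⟨y, hy⟩ := h.surj c
  have hE : ∀ t : (π ⁻¹' {a, b, c, d}ᶜ : Set V), G.Adj t x ∧ G.Adj t y ∧ (t : V) ≠ x ∧
      (t : V) ≠ y := by
    rintro ⟨t, ht⟩
    simp only [Set.mem_preimage, Set.mem_compl_iff, Set.mem_insert_iff, Set.mem_singleton_iff,
      not_or] at ht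
    have := hp.rest (π t)
    simp only [ht.1, ht.2.1, ht.2.2.1, ht.2.2.2, false_or] at this
    have h1 : G.Adj t x := (h.adj_iff t x (hx ▸ ht.2.1)).1 (hx ▸ this.1)
    have h2 : G.Adj t y := (h.adj_iff t y (hy ▸ ht.2.2.1)).1 (hy ▸ this.2.1)
    exact ⟨h1, h2, h1.ne, h2.ne⟩
  have hxy : G.Adj x y := (h.adj_iff x y (by rw [hx, hy]; exact hp.bc.ne)).1
    (by rw [hx, hy]; exact hp.bc)
  have hyK : y ∉ K.map (Function.Embedding.subtype _) := by
    rintro hh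
    obtain ⟨t, -, e⟩ := Finset.mem_map.1 hh
    exact (hE t).2.2.2 e
  have hxK : x ∉ insert y (K.map (Function.Embedding.subtype _)) := by
    rintro hh
    rcases Finset.mem_insert.1 hh with e | hh
    · exact hxy.ne e
    · obtain ⟨t, -, e⟩ := Finset.mem_map.1 hh
      exact (hE t).2.2.1 e
  refine ⟨v, insert x (insert y (K.map (Function.Embedding.subtype _))), ?_, ?_⟩
  · simp only [Finset.coe_insert, isClique_insert]
    refine ⟨⟨?_, ?_⟩, ?_⟩
    · rw [Finset.coe_map]
      rintro _ ⟨s, hs, rfl⟩ _ ⟨t, ht, rfl⟩ hst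
      exact hK hs ht fun e => hst (e ▸ rfl)
    · rw [Finset.coe_map]
      rintro _ ⟨t, ht, rfl⟩ -
      exact (hE t).2.1.symm
    · rw [Finset.coe_map]
      rintro _ (rfl | ⟨t, ht, rfl⟩) -
      · exact hxy
      · exact (hE t).1.symm
  · rw [Finset.card_insert_of_notMem hxK, Finset.card_insert_of_notMem hyK, Finset.card_map]
    set N := (G.induce (π ⁻¹' {a, b, c, d}ᶜ)).neighborSet v
    have h1 : insert x (insert y (Subtype.val '' N)) ⊆ G.neighborSet v := by
      rintro _ (rfl | rfl | ⟨t, ht, rfl⟩)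
      exacts [(hE v).1, (hE v).2.1, ht]
    have h2 := Set.ncard_le_ncard h1
    rw [Set.ncard_insert_of_notMem, Set.ncard_insert_of_notMem,
      Set.ncard_image_of_injective _ Subtype.val_injective] at h2
    · omega
    · rintro ⟨t, -, e⟩
      exact (hE t).2.2.2 e
    · rintro (e | ⟨t, -, e⟩)
      · exact hxy.ne e
      · exact (hE t).2.2.1 e

theorem PrimeQuotient.mem_rest_iff {Q : Type*} {H : SimpleGraph Q} {σ : G ≃g Gᶜ}
    {τ : H ≃g Hᶜ} {π : V → Q} (h : PrimeQuotient σ τ π) {a b c d : Q} (hp : PathLike τ a b c d)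
    (x : V) : x ∈ π ⁻¹' {a, b, c, d}ᶜ ↔ σ x ∈ π ⁻¹' {a, b, c, d}ᶜ := by
  have key : ∀ t, t ∉ ({a, b, c, d} : Set Q) → τ t = t := by
    intro t ht
    simp only [Set.mem_insert_iff, Set.mem_singleton_iff, not_or] at ht
    have := hp.rest t
    tauto
  simp only [Set.mem_preimage, Set.mem_compl_iff, h.comm]
  refine ⟨fun hx => by rwa [key _ hx], fun hx => ?_⟩
  have := τ.injective (key _ hx)
  rwa [this] at hx

theorem reed_of_noChair.{u} (n : ℕ) : ∀ {V : Type u} [Finite V] [Nonempty V] {G : SimpleGraph V}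
    (_ : G ≃g Gᶜ), NoChair G → Nat.card V = n → Reed G := by
  classical
  induction n using Nat.strong_induction_on with | _ n ih => ?_
  intro V _ _ G σ hG hn
  have claw : ∀ {W : Type u} [Finite W] {H : SimpleGraph W} (_ : H ≃g Hᶜ), NoChair H →
      IsPrime H → ¬ HasClaw H := fun {W} _ {H} τ hH hp hc =>
    Basic.not_hasClaw ⟨hp, hH, hH.noKite τ⟩ hc
      (by_contra fun h' => not_hasClaw_of_iso τ h' hc)
  by_cases hp : IsPrime G
  · exact Reed.of_not_hasClaw σ (claw σ hG hp)
  obtain ⟨Q, _, _, H, τ, π, ⟨f⟩, h⟩ := exists_primeQuotient σ hp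
  obtain ⟨x, y, hxy, hπ, hna⟩ := h.twins
  have hH := hG.of_embedding f
  obtain ⟨a, b, c, d, hpl⟩ := (h.notEnd hG hxy hπ hna).exists_pathLike τ h.prime
    (claw τ hH h.prime)
  obtain ⟨k, hk, hkb⟩ : ∃ k, ColOn G (π ⁻¹' {a, b, c, d}ᶜ) k ∧ (k = 0 ∨ Bound G (k + 2)) := by
    rcases (π ⁻¹' {a, b, c, d}ᶜ).eq_empty_or_nonempty with hE | hE
    · refine ⟨0, ⟨fun _ => 0, ?_, ?_⟩, Or.inl rfl⟩ <;> rw [hE] <;> simp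
    · have : Nonempty (π ⁻¹' {a, b, c, d}ᶜ : Set V) := hE.to_subtype
      have hlt : Nat.card (π ⁻¹' {a, b, c, d}ᶜ : Set V) < n := by
        obtain ⟨z, hz⟩ := h.surj a
        rw [← hn, Nat.card_coe_set_eq]
        exact Set.ncard_lt_card fun e => by
          have hmem := Set.mem_univ z
          rw [← e] at hmem
          exact hmem (Or.inl hz)
      let σ' : G.induce (π ⁻¹' {a, b, c, d}ᶜ) ≃g (G.induce (π ⁻¹' {a, b, c, d}ᶜ))ᶜ :=
        { toEquiv := σ.toEquiv.subtypeEquiv (h.mem_rest_iff hpl)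
          map_rel_iff' := by
            rintro ⟨u, hu⟩ ⟨v, hv⟩
            have := σ.map_adj_iff (v := u) (w := v)
            simpa [Equiv.subtypeEquiv] using this }
      obtain ⟨v, K, hK, ⟨m⟩⟩ := ih _ hlt σ' (hG.of_embedding (Embedding.induce _)) rfl
      refine ⟨_, ⟨fun x => if hx : x ∈ π ⁻¹' {a, b, c, d}ᶜ then m ⟨x, hx⟩ else 0, ?_, ?_⟩,
        Or.inr (h.bound_of_rest hpl ⟨v, K, hK, le_rfl⟩)⟩
      · intro x hx
        beta_reduce
        rw [dif_pos hx]
        exact (m ⟨x, hx⟩).2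
      · intro x hx y hy hadj
        beta_reduce
        rw [dif_pos hx, dif_pos hy]
        exact fun e => (m.valid (v := ⟨x, hx⟩) (w := ⟨y, hy⟩) hadj) (Fin.ext e)
  have hA := h.bound_of_end hG hpl
  have hD := h.bound_of_end hG hpl.symm
  have col := fun m h1 h2 h3 => (h.colOn (m := m) hG hpl h1 h2 h3 hk).colorable
  have hA1 : 1 ≤ (π ⁻¹' {a}).ncard := by
    obtain ⟨z, hz⟩ := h.surj a
    exact Nat.one_le_iff_ne_zero.2 (Set.ncard_ne_zero_of_mem (a := z) hz)
  rcases le_total ((π ⁻¹' {a}).ncard + 1) ((π ⁻¹' {d}).ncard + 1) with h1 | h1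
  · rcases le_total (k + 2) ((π ⁻¹' {d}).ncard + 1) with h2 | h2
    · exact hD.reed (col _ h1 le_rfl h2)
    · rcases hkb with rfl | hkb
      · exact hD.reed (col _ h1 le_rfl (by omega))
      · exact hkb.reed (col _ (h1.trans h2) h2 le_rfl)
  · rcases le_total (k + 2) ((π ⁻¹' {a}).ncard + 1) with h2 | h2
    · exact hA.reed (col _ le_rfl h1 h2)
    · rcases hkb with rfl | hkb
      · exact hA.reed (col _ le_rfl h1 (by omega))
      · exact hkb.reed (col _ h2 (h1.trans h2) le_rfl)

theorem noChair_of_isEmpty (h : IsEmpty (chair ↪g G)) : NoChair G := by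
  intro c x y z t cx cy cz zt hxy nxy nxz nyz ntc ntx nty
  have hxz : x ≠ z := fun e => ntx (e ▸ zt).symm
  have hyz : y ≠ z := fun e => nty (e ▸ zt).symm
  have hct : c ≠ t := fun e => ntx (e ▸ cx)
  have hxt : x ≠ t := fun e => ntc (e ▸ cx.symm)
  have hyt : y ≠ t := fun e => ntc (e ▸ cy.symm)
  refine h.false ⟨⟨![x, c, z, t, y], ?_⟩, ?_⟩
  · intro i j
    fin_cases i <;> fin_cases j <;>
      simp [cx.ne, cx.ne.symm, cy.ne, cy.ne.symm, cz.ne, cz.ne.symm, zt.ne, zt.ne.symm, hxy,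
        hxy.symm, hxz, hxz.symm, hyz, hyz.symm, hct, hct.symm, hxt, hxt.symm, hyt, hyt.symm]
  · have h1 : ¬ G.Adj y x := fun h => nxy h.symm
    have h2 : ¬ G.Adj z x := fun h => nxz h.symm
    have h3 : ¬ G.Adj z y := fun h => nyz h.symm
    have h4 : ¬ G.Adj c t := fun h => ntc h.symm
    have h5 : ¬ G.Adj x t := fun h => ntx h.symm
    have h6 : ¬ G.Adj y t := fun h => nty h.symm
    intro i j
    change G.Adj (![x, c, z, t, y] i) (![x, c, z, t, y] j) ↔ _
    fin_cases i <;> fin_cases j <;>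
      simp [chair, cx, cx.symm, cy, cy.symm, cz, cz.symm, zt, zt.symm, nxy, nxz, nyz, ntc, ntx,
        nty, h1, h2, h3, h4, h5, h6]

end ChairFree

/-- Reed's conjecture holds for self-complementary Chair-free graphs. -/
theorem reed_selfComplementary_chair_free {V : Type*} [Fintype V] (G : SimpleGraph V)
    [DecidableRel G.Adj]
    (hsc : Nonempty (G ≃g Gᶜ)) (h1 : IsEmpty (chair ↪g G)) :
    G.chromaticNumber ≤ (((G.maxDegree + G.cliqueNum + 1) ⌈/⌉ 2 : ℕ) : ℕ∞) := by
  rcases isEmpty_or_nonempty V with hV | hV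
  · simp [chromaticNumber_eq_zero_of_isEmpty]
  obtain ⟨σ⟩ := hsc
  obtain ⟨v, K, hK, hcol⟩ := ChairFree.reed_of_noChair _ σ (ChairFree.noChair_of_isEmpty h1) rfl
  refine (hcol.mono ?_).chromaticNumber_le
  have hd : (G.neighborSet v).ncard ≤ G.maxDegree := by
    rw [Set.ncard_eq_toFinset_card']
    exact G.degree_le_maxDegree v
  have hw : K.card ≤ G.cliqueNum := hK.card_le_cliqueNum
  rw [Nat.ceilDiv_eq_add_pred_div]
  exact Nat.div_le_div_right (by omega)
end

section
/- Let H be the 3-sun: the graph on six vertices v1,...,v6 whose edges are exactly the triangle v1v2, v2v3, v1v3 together with v4v1, v4v2, v5v2, v5v3, v6v1, v6v3. Let G be a finite simple graph that contains no induced subgraph isomorphic to K2 ∪ 2K1 (the disjoint union of one edge and two isolated vertices) and no induced subgraph isomorphic to H. Then χ(G) ≤ ⌈(Δ(G) + ω(G) + 1)/2⌉. -/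
open SimpleGraph

/-- `K2 ∪ 2K1`: the disjoint union of one edge (`0-1`) and two isolated vertices
(`2` and `3`). -/
def k2Union2K1 : SimpleGraph (Fin 4) :=
  SimpleGraph.fromRel (fun a b => a = 0 ∧ b = 1)

/-- The 3-sun `H`: the triangle `0-1-2` (for `v1, v2, v3`) together with three pairwise
nonadjacent vertices `3, 4, 5` (for `v4, v5, v6`), where `3` is adjacent to `0` and `1`,
`4` is adjacent to `1` and `2`, and `5` is adjacent to `0` and `2`. -/
def threeSun : SimpleGraph (Fin 6) :=
  SimpleGraph.fromRel (fun a b =>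
    (a = 0 ∧ b = 1) ∨ (a = 1 ∧ b = 2) ∨ (a = 0 ∧ b = 2) ∨
    (a = 3 ∧ b = 0) ∨ (a = 3 ∧ b = 1) ∨
    (a = 4 ∧ b = 1) ∨ (a = 4 ∧ b = 2) ∨
    (a = 5 ∧ b = 0) ∨ (a = 5 ∧ b = 2))

namespace SimpleGraph

/-- A perfect matching of the complement partitions the vertices into independent pairs. -/
lemma colorable_of_isPerfectMatching_compl {W : Type*} [Finite W] {H : SimpleGraph W}
    {M : Hᶜ.Subgraph} (hM : M.IsPerfectMatching) {k : ℕ} (hk : Nat.card W = 2 * k) :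
    H.Colorable k := by
  classical
  cases nonempty_fintype W
  have hcard : Fintype.card M.spanningCoe.edgeSet = k := by
    have hsum := M.spanningCoe.sum_degrees_eq_twice_card_edges
    have hdeg (v : W) : M.spanningCoe.degree v = 1 := by
      obtain ⟨w, hw, huniq⟩ := Subgraph.isPerfectMatching_iff.mp hM v
      rw [← card_neighborFinset_eq_degree, Finset.card_eq_one]
      refine ⟨w, Finset.ext fun x => ?_⟩
      simp only [mem_neighborFinset, Finset.mem_singleton, Subgraph.spanningCoe_adj]
      exact ⟨huniq x, fun h => h ▸ hw⟩
    rw [Nat.card_eq_fintype_card] at hk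
    simp only [hdeg, Finset.sum_const, Finset.card_univ, smul_eq_mul, mul_one] at hsum
    rw [← edgeFinset_card]
    omega
  choose f hf huniq using Subgraph.isPerfectMatching_iff.mp hM
  let c : H.Coloring M.spanningCoe.edgeSet := Coloring.mk (fun v => ⟨s(v, f v), hf v⟩) <| by
    intro v w hvw heq
    have h := hf v
    rcases Sym2.eq_iff.mp (congrArg Subtype.val heq) with ⟨h', -⟩ | ⟨-, h'⟩
    · exact hvw.ne h'
    · rw [h'] at h
      exact h.adj_sub.2 hvw
  exact hcard ▸ c.colorable

/-- A form of Tutte's theorem for graphs of even order: if there is no perfect matching, some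
vertex set `u` leaves at least `|u| + 2` components, with representatives `r`. -/
lemma exists_perfectMatching_or_exists_separated {W : Type*} [Finite W] (K : SimpleGraph W)
    (heven : Even (Nat.card W)) :
    (∃ M : K.Subgraph, M.IsPerfectMatching) ∨
      ∃ u r : Set W, Disjoint r u ∧ u.ncard + 2 ≤ r.ncard ∧
        r.Pairwise fun a b => ¬ K.Adj a b ∧ ∀ x ∉ u, K.Adj a x → ¬ K.Adj b x := by
  refine or_iff_not_imp_left.mpr fun hno => ?_
  rw [tutte] at hno
  push Not at hno
  obtain ⟨u, hu⟩ := hno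
  set L := ((⊤ : K.Subgraph).deleteVerts u).coe with hL
  have hadj {a b : W} (ha : a ∈ ((⊤ : K.Subgraph).deleteVerts u).verts)
      (hb : b ∈ ((⊤ : K.Subgraph).deleteVerts u).verts) (h : K.Adj a b) :
      L.Adj ⟨a, ha⟩ ⟨b, hb⟩ := by
    simp only [Subgraph.deleteVerts_verts, Set.mem_sdiff] at ha hb
    simp [hL, h, ha.2, hb.2]
  have hcard : Nat.card ((⊤ : K.Subgraph).deleteVerts u).verts + u.ncard = Nat.card W := by
    rw [Nat.card_coe_set_eq, Subgraph.deleteVerts_verts, Subgraph.verts_top,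
      Set.ncard_sdiff_add_ncard_of_subset (Set.subset_univ u), Set.ncard_univ]
  refine ⟨u, (fun C : L.ConnectedComponent => (C.out : W)) '' L.oddComponents, ?_, ?_, ?_⟩
  · rw [Set.disjoint_left]
    rintro _ ⟨C, -, rfl⟩
    exact (Subtype.prop (Quot.out C)).2
  · have hinj : Function.Injective (fun C : L.ConnectedComponent => (C.out : W)) :=
      Subtype.val_injective.comp fun C D h => by
        rw [← C.out_eq, ← D.out_eq]; exact congrArg _ h
    rw [Set.ncard_image_of_injective _ hinj]
    have hpar := L.odd_ncard_oddComponents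
    rw [IsTutteViolator] at hu
    grind
  · rintro _ ⟨C, -, rfl⟩ _ ⟨D, -, rfl⟩ hne
    have hCD : ¬ L.Reachable C.out D.out := fun h => by
      have : C = D := by
        rw [← C.out_eq, ← D.out_eq]; exact ConnectedComponent.sound h
      exact hne (by rw [this])
    refine ⟨fun h => hCD (hadj _ _ h).reachable, fun x hx h h' => hCD ?_⟩
    have hx' : x ∈ ((⊤ : K.Subgraph).deleteVerts u).verts := by simpa using hx
    exact (hadj (Subtype.prop _) hx' h).reachable.trans
      (hadj (Subtype.prop _) hx' h').reachable.symm

/-- The case of independence number at most two, where the complement is triangle-free. -/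
lemma colorable_of_forall_adj_of_triple {V : Type*} [Finite V] {G : SimpleGraph V} {D w : ℕ}
    (hα : ∀ a b c, a ≠ b → a ≠ c → b ≠ c → G.Adj a b ∨ G.Adj a c ∨ G.Adj b c)
    (hD : ∀ v, (G.neighborSet v).ncard ≤ D) (hw : ∀ s, G.IsClique s → s.ncard ≤ w) :
    G.Colorable ((D + w + 2) / 2) := by
  cases isEmpty_or_nonempty V
  · exact .of_isEmpty _
  set k := (D + w + 2) / 2 with hk
  have hnon (v : V) (s : Set V) :
      Nat.card V ≤ {x | x ∉ s ∧ x ≠ v ∧ ¬ G.Adj v x}.ncard + s.ncard + D + 1 := by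
    have hsub : (Set.univ : Set V) ⊆
        {x | x ∉ s ∧ x ≠ v ∧ ¬ G.Adj v x} ∪ s ∪ G.neighborSet v ∪ {v} := by
      intro x _
      simp only [Set.mem_union, Set.mem_ofPred_eq, mem_neighborSet, Set.mem_singleton_iff]
      tauto
    have h1 := Set.ncard_le_ncard hsub
    rw [Set.ncard_univ] at h1
    have h2 := Set.ncard_union_le ({x | x ∉ s ∧ x ≠ v ∧ ¬ G.Adj v x} ∪ s ∪ G.neighborSet v) {v}
    have h3 := Set.ncard_union_le ({x | x ∉ s ∧ x ≠ v ∧ ¬ G.Adj v x} ∪ s) (G.neighborSet v)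
    have h4 := Set.ncard_union_le {x | x ∉ s ∧ x ≠ v ∧ ¬ G.Adj v x} s
    have h5 := hD v
    rw [Set.ncard_singleton] at h2
    omega
  have hclique (v : V) (s : Set V) : G.IsClique {x | x ∉ s ∧ x ≠ v ∧ ¬ G.Adj v x} := by
    rintro x ⟨-, hxv, hx⟩ y ⟨-, hyv, hy⟩ hxy
    have := hα v x y hxv.symm hyv.symm hxy
    tauto
  have hn : Nat.card V ≤ 2 * k := by
    obtain ⟨v⟩ := ‹Nonempty V›
    have h1 := hnon v ∅
    have h2 := hw _ (hclique v ∅)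
    rw [Set.ncard_empty] at h1
    omega
  obtain ⟨d, hd⟩ := Nat.exists_eq_add_of_le hn
  let H : SimpleGraph (V ⊕ Fin d) := G ⊕g (⊥ : SimpleGraph (Fin d))
  have hcard : Nat.card (V ⊕ Fin d) = 2 * k := by
    rw [Nat.card_sum, Nat.card_fin, hd]
  refine Colorable.of_sum_left (H := (⊥ : SimpleGraph (Fin d))) ?_
  change H.Colorable k
  rcases Hᶜ.exists_perfectMatching_or_exists_separated (hcard ▸ even_two_mul k) with
    ⟨M, hM⟩ | ⟨u, r, hru, hur, hr⟩
  · exact colorable_of_isPerfectMatching_compl hM hcard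
  exfalso
  have huniv (i : Fin d) (x : V ⊕ Fin d) (hx : x ≠ .inr i) : Hᶜ.Adj x (.inr i) := by
    rw [compl_adj]
    refine ⟨hx, ?_⟩
    cases x <;> simp [H]
  obtain ⟨a, ha, b, hb, hab⟩ := (Set.one_lt_ncard).mp (show 1 < r.ncard by omega)
  have hinr (i : Fin d) : .inr i ∈ u := by
    by_contra hi
    obtain ⟨h1, h2⟩ := hr ha hb hab
    by_cases hai : a = .inr i
    · subst hai
      exact h1 (huniv i b hab.symm).symm
    by_cases hbi : b = .inr i
    · subst hbi
      exact h1 (huniv i a hab)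
    · exact h2 _ hi (huniv i a hai) (huniv i b hbi)
  have hr_inl (x) (hx : x ∈ r) : ∃ v, Sum.inl v = x := by
    rcases x with v | i
    · exact ⟨v, rfl⟩
    · exact absurd (hinr i) (Set.disjoint_left.mp hru hx)
  have hHadj {x y : V} : ¬ Hᶜ.Adj (.inl x) (.inl y) → x ≠ y → G.Adj x y := by
    intro h hxy
    by_contra h'
    exact h ⟨by simpa using hxy, by simpa [H] using h'⟩
  have hHadj' {x y : V} (hxy : x ≠ y) (h : ¬ G.Adj x y) : Hᶜ.Adj (.inl x) (.inl y) :=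
    ⟨by simpa using hxy, by simpa [H] using h⟩
  obtain ⟨v, rfl⟩ := hr_inl a ha
  set S : Set V := Sum.inl ⁻¹' u with hS
  set R : Set V := Sum.inl ⁻¹' (r \ {Sum.inl v}) with hR
  have hSu : S.ncard + d ≤ u.ncard := by
    have hsub : Sum.inl '' S ∪ Sum.inr '' (Set.univ : Set (Fin d)) ⊆ u := by
      rintro _ (⟨x, hx, rfl⟩ | ⟨i, -, rfl⟩)
      · exact hx
      · exact hinr i
    have h := Set.ncard_le_ncard hsub
    rwa [Set.ncard_union_eq (by
        rw [Set.disjoint_left]; rintro _ ⟨x, -, rfl⟩ ⟨y, -, h⟩; cases h),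
      Set.ncard_image_of_injective _ Sum.inl_injective,
      Set.ncard_image_of_injective _ Sum.inr_injective, Set.ncard_univ, Nat.card_fin] at h
  have hRr : R.ncard + 1 = r.ncard := by
    rw [hR, Set.ncard_preimage_of_injective_subset_range Sum.inl_injective
      (fun x hx => hr_inl x hx.1), Set.ncard_sdiff_singleton_add_one ha]
  set N : Set V := {x | x ∉ S ∧ x ≠ v ∧ ¬ G.Adj v x} with hN
  have hNR {x y : V} (hx : x ∈ N) (hy : y ∈ R) : x ≠ y ∧ G.Adj x y := by
    obtain ⟨h1, h2⟩ := hr ha hy.1 (fun h => hy.2 h.symm)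
    have hvx : Hᶜ.Adj (.inl v) (.inl x) := hHadj' hx.2.1.symm hx.2.2
    have hxy : x ≠ y := by
      rintro rfl
      exact h1 hvx
    exact ⟨hxy, hHadj (fun h => h2 _ hx.1 hvx h.symm) hxy⟩
  have hI : G.IsClique (N ∪ R) := by
    rintro x (hx | hx) y (hy | hy) hxy
    · exact hclique v S hx hy hxy
    · exact (hNR hx hy).2
    · exact (hNR hy hx).2.symm
    · exact hHadj (hr hx.1 hy.1 (by simpa using hxy)).1 hxy
  have h1 := hw _ hI
  rw [Set.ncard_union_eq (Set.disjoint_left.mpr fun x hx hx' => (hNR hx hx').1 rfl)] at h1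
  have h2 := hnon v S
  rw [← hN] at h2
  omega

/-- In a `K2 ∪ 2K1`-free graph, every edge `xy` is joined by an edge to every
nonadjacent pair `p, q`. -/
lemma adj_of_isEmpty_k2Union2K1_embedding {V : Type*} {G : SimpleGraph V}
    (hG : IsEmpty (k2Union2K1 ↪g G)) {x y p q : V} (hxy : G.Adj x y) (hpq : p ≠ q)
    (hpq' : ¬ G.Adj p q) :
    G.Adj x p ∨ G.Adj x q ∨ G.Adj y p ∨ G.Adj y q := by
  by_contra! ⟨hxp, hxq, hyp, hyq⟩
  have hne : x ≠ y ∧ x ≠ p ∧ x ≠ q ∧ y ≠ p ∧ y ≠ q := by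
    refine ⟨hxy.ne, ?_, ?_, ?_, ?_⟩ <;> rintro rfl
    exacts [hyp hxy.symm, hyq hxy.symm, hxp hxy, hxq hxy]
  have hadj : ∀ i j : Fin 4, G.Adj (![x, y, p, q] i) (![x, y, p, q] j) ↔ k2Union2K1.Adj i j := by
    intro i j
    fin_cases i <;> fin_cases j <;>
      simp [k2Union2K1, hxy, hxy.symm, hxp, hxq, hyp, hyq, hpq', mt G.adj_symm hxp,
        mt G.adj_symm hxq, mt G.adj_symm hyp, mt G.adj_symm hyq, mt G.adj_symm hpq']
  refine hG.false ⟨⟨![x, y, p, q], fun i j hij => ?_⟩, hadj _ _⟩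
  fin_cases i <;> fin_cases j <;> first | rfl | (simp at hij; grind)

/-- Reed's bound for graphs whose complement contains no induced diamond. -/
lemma colorable_of_isEmpty_k2Union2K1_embedding {V : Type*} [Finite V] (G : SimpleGraph V)
    (hG : IsEmpty (k2Union2K1 ↪g G)) (D w : ℕ)
    (hD : ∀ v, (G.neighborSet v).ncard ≤ D) (hw : ∀ s, G.IsClique s → s.ncard ≤ w) :
    G.Colorable ((D + w + 2) / 2) := by
  induction hn : Nat.card V using Nat.strong_induction_on generalizing V D with
  | _ n ih =>
  by_cases hα : ∀ a b c, a ≠ b → a ≠ c → b ≠ c → G.Adj a b ∨ G.Adj a c ∨ G.Adj b c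
  · exact colorable_of_forall_adj_of_triple hα hD hw
  push Not at hα
  obtain ⟨a, b, c, hab, hac, hbc, nab, nac, nbc⟩ := hα
  have hfin : {s : Set V | G.IsIndepSet s}.Finite := Set.toFinite _
  have habc : G.IsIndepSet {a, b, c} := by
    simp [IsIndepSet, Set.pairwise_insert, *, G.adj_comm]
  obtain ⟨K, hKsub, hK⟩ := hfin.exists_le_maximal habc
  have hKi : ∀ x ∈ K, ∀ y ∈ K, ¬ G.Adj x y := by
    intro x hx y hy h
    exact hK.prop hx hy h.ne h
  have hK3 : 3 ≤ K.ncard := by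
    rw [← Set.ncard_eq_three.mpr ⟨a, b, c, hab, hac, hbc, rfl⟩]
    exact Set.ncard_le_ncard hKsub
  have hout (v : V) (hv : v ∉ K) : K.ncard ≤ (G.neighborSet v ∩ K).ncard + 1 := by
    have hex : ∃ z ∈ K, G.Adj v z := by
      by_contra! hno
      refine hv (hK.le_of_ge (y := insert v K) ?_ (Set.subset_insert v K) (Set.mem_insert v K))
      refine Set.Pairwise.insert hK.prop fun z hz _ => ⟨hno z hz, fun h => hno z hz h.symm⟩
    obtain ⟨z, hz, hvz⟩ := hex
    have hle : (K \ G.neighborSet v).ncard ≤ 1 := by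
      rw [Set.ncard_le_one_iff]
      rintro p q ⟨hp, hp'⟩ ⟨hq, hq'⟩
      by_contra hpq
      rcases adj_of_isEmpty_k2Union2K1_embedding hG hvz hpq (hKi p hp q hq) with h | h | h | h
      exacts [hp' h, hq' h, hKi z hz p hp h, hKi z hz q hq h]
    have := Set.ncard_inter_add_ncard_sdiff_eq_ncard K (G.neighborSet v)
    rw [Set.inter_comm] at this
    omega
  have hdeg (v : V) (hv : v ∉ K) : ((G.induce Kᶜ).neighborSet ⟨v, hv⟩).ncard + 2 ≤ D := by
    have h1 : ((G.induce Kᶜ).neighborSet ⟨v, hv⟩).ncard = (G.neighborSet v \ K).ncard := by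
      rw [← Set.ncard_image_of_injective _ Subtype.val_injective]
      congr 1
      ext x
      simp [and_comm]
    have h2 := Set.ncard_inter_add_ncard_sdiff_eq_ncard (G.neighborSet v) K
    have h3 := hout v hv
    have h4 := hD v
    omega
  have hcol : (G.induce Kᶜ).Colorable ((D + w + 2) / 2 - 1) := by
    cases isEmpty_or_nonempty (Kᶜ : Set V)
    · exact .of_isEmpty _
    obtain ⟨v, hv⟩ := ‹Nonempty (Kᶜ : Set V)›
    have hD2 := hdeg v hv
    have := ih (Nat.card (Kᶜ : Set V)) ?_ (G.induce Kᶜ) ?_ (D - 2) ?_ ?_ rfl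
    · convert this using 1
      omega
    · have h := Set.ncard_add_ncard_compl K
      rw [Nat.card_coe_set_eq]
      omega
    · exact ⟨fun f => hG.false ((Embedding.induce _).comp f)⟩
    · rintro ⟨x, hx⟩
      have := hdeg x hx
      omega
    · intro s hs
      rw [← Set.ncard_image_of_injective s Subtype.val_injective]
      refine hw _ ?_
      rintro _ ⟨x, hx, rfl⟩ _ ⟨y, hy, rfl⟩ hxy
      exact hs hx hy (fun h => hxy (by rw [h]))
  classical
  obtain ⟨C⟩ := hcol
  let C' : G.Coloring (Option (Fin ((D + w + 2) / 2 - 1))) :=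
    Coloring.mk (fun v => if hv : v ∈ K then none else some (C ⟨v, hv⟩)) <| by
      intro x y hxy
      by_cases hx : x ∈ K <;> by_cases hy : y ∈ K
      · exact absurd hxy (hKi x hx y hy)
      · simp [hx, hy]
      · simp [hx, hy]
      · simp only [hx, hy, dite_false, ne_eq, Option.some.injEq]
        exact C.valid (show (G.induce Kᶜ).Adj ⟨x, hx⟩ ⟨y, hy⟩ from hxy)
  have := C'.colorable
  rw [Fintype.card_option, Fintype.card_fin] at this
  convert this using 1
  omega

end SimpleGraph

/-- Reed's conjecture holds for `{K2 ∪ 2K1, H}`-free graphs, where `H` is the 3-sun. -/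
theorem reed_k2Union2K1_threeSun_free {V : Type*} [Fintype V] (G : SimpleGraph V)
    [DecidableRel G.Adj]
    (h1 : IsEmpty (k2Union2K1 ↪g G)) (h2 : IsEmpty (threeSun ↪g G)) :
    G.chromaticNumber ≤ (((G.maxDegree + G.cliqueNum + 1) ⌈/⌉ 2 : ℕ) : ℕ∞) := by
  rw [Nat.ceilDiv_eq_add_pred_div]
  refine (G.colorable_of_isEmpty_k2Union2K1_embedding h1 G.maxDegree G.cliqueNum
    (fun v => ?_) fun s hs => ?_).chromaticNumber_le
  · rw [Set.ncard_eq_toFinset_card']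
    exact G.degree_le_maxDegree v
  · classical
    rw [Set.ncard_eq_toFinset_card']
    exact IsClique.card_le_cliqueNum (tc := by simpa using hs)
end
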